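/- Let $\hat{Q} = (0,1)^2$, $s \in (0, 1/2]$, and $\mathbf{u} = (u_1, u_2) \in \mathbf{H}^s(\hat{Q})$ with $\mathrm{div}\,\mathbf{u} \in L^2(\hat{Q})$. Let $\hat{\Pi}_{\mathrm{RT}}\mathbf{u} = (a + cx_1,\ b + dx_2)^\top$ be the lowest-order Raviart–Thomas interpolant defined by matching weak edge fluxes. Then there is a constant $C$ independent of $\mathbf{u}$ such that $\|(\hat{\Pi}_{\mathrm{RT}}\mathbf{u})_1\|_{L^2(\hat{Q})} \le C\big(\|u_1\|_{H^s(\hat{Q})} + |u_2|_{AH_2^s(\hat{Q})} + \|\mathrm{div}\,\mathbf{u}\|_{L^2(\hat{Q})}\big)$, where $|u_2|_{AH_2^s(\hat{Q})}^2 = \int_0^1 |u_2(x_1,\cdot)|_{H^s(0,1)}^2\, dx_1$ with $|\cdot|_{H^s(0,1)}$ the 1D Gagliardo seminorm. -/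

import Mathlib

open MeasureTheory Set

noncomputable section

/-- The open unit square `Q̂ = (0,1)²`. -/
def Qhat : Set (ℝ × ℝ) := Ioo 0 1 ×ˢ Ioo 0 1

/-- Squared 1D Gagliardo seminorm on `(0,1)`. -/
def gag1Sq (s : ℝ) (u : ℝ → ℝ) : ℝ :=
  ∫ x in Ioo (0:ℝ) 1, ∫ y in Ioo (0:ℝ) 1, (u x - u y) ^ 2 / |x - y| ^ (1 + 2 * s)

/-- Squared 2D Gagliardo `H^s` seminorm on `D` (Euclidean distance). -/
def gag2Sq (s : ℝ) (D : Set (ℝ × ℝ)) (u : ℝ × ℝ → ℝ) : ℝ :=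
  ∫ x in D, ∫ y in D,
    (u x - u y) ^ 2 / ((x.1 - y.1) ^ 2 + (x.2 - y.2) ^ 2) ^ ((2 + 2 * s) / 2)

/-- `H^s(Q̂)` norm. -/
def HsNorm (s : ℝ) (u : ℝ × ℝ → ℝ) : ℝ :=
  Real.sqrt (∫ x in Qhat, u x ^ 2) + Real.sqrt (gag2Sq s Qhat u)

/-- Anisotropic seminorm `|u|_{AH₂ˢ(Q̂)}`. -/
def AH2Semi (s : ℝ) (u : ℝ × ℝ → ℝ) : ℝ :=
  Real.sqrt (∫ x1 in Ioo (0:ℝ) 1, gag1Sq s (fun x2 => u (x1, x2)))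

/-- Partial derivatives. -/
def pd1 (φ : ℝ × ℝ → ℝ) (x : ℝ × ℝ) : ℝ := fderiv ℝ φ x (1, 0)
def pd2 (φ : ℝ × ℝ → ℝ) (x : ℝ × ℝ) : ℝ := fderiv ℝ φ x (0, 1)

/-- The Green-formula pairing `(u,∇φ)_{0,Q̂} + ∫_{Q̂} (div u) φ = ⟨u·n, φ⟩_{∂Q̂}`
used to define the weak normal trace. -/
def pairing (u1 u2 dv φ : ℝ × ℝ → ℝ) : ℝ :=
  (∫ x in Qhat, (u1 x * pd1 φ x + u2 x * pd2 φ x)) + ∫ x in Qhat, dv x * φ x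

/-- An admissible test function for the weak flux: `φ ∈ H^{1-ε}(Q̂)` with boundary
values `w1` on the left edge, `w2` on the right edge, `w3` on the bottom edge, and
`w4` on the top edge (edges without corners), such that all pairing integrals are
defined. -/
structure Adm (ε : ℝ) (u1 u2 dv : ℝ × ℝ → ℝ) (φ : ℝ × ℝ → ℝ)
    (w1 w2 w3 w4 : ℝ) : Prop where
  diff : DifferentiableOn ℝ φ Qhat
  cont : ContinuousOn φ (closure Qhat \ {(0, 0), (0, 1), (1, 0), (1, 1)})
  left : ∀ t ∈ Ioo (0:ℝ) 1, φ (0, t) = w1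
  right : ∀ t ∈ Ioo (0:ℝ) 1, φ (1, t) = w2
  bottom : ∀ t ∈ Ioo (0:ℝ) 1, φ (t, 0) = w3
  top : ∀ t ∈ Ioo (0:ℝ) 1, φ (t, 1) = w4
  mem : IntegrableOn
    (fun q : (ℝ × ℝ) × (ℝ × ℝ) =>
      (φ q.1 - φ q.2) ^ 2 /
        ((q.1.1 - q.2.1) ^ 2 + (q.1.2 - q.2.2) ^ 2) ^ ((2 + 2 * (1 - ε)) / 2))
    (Qhat ×ˢ Qhat)
  memL2 : IntegrableOn (fun x => φ x ^ 2) Qhat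
  int1 : IntegrableOn (fun x => u1 x * pd1 φ x + u2 x * pd2 φ x) Qhat
  int2 : IntegrableOn (fun x => dv x * φ x) Qhat

/-- Lipschitz functions with compact support inside `U`. -/
def LipTest (U : Set (ℝ × ℝ)) (η : ℝ × ℝ → ℝ) : Prop :=
  (∃ K, LipschitzWith K η) ∧ HasCompactSupport η ∧ tsupport η ⊆ U

/-- The Green density `u · ∇f + (div u) f`. -/
def greenDensity (u1 u2 dv f : ℝ × ℝ → ℝ) (x : ℝ × ℝ) : ℝ :=
  u1 x * pd1 f x + u2 x * pd2 f x + dv x * f x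

open scoped Convolution

lemma fderiv_mollification_apply {K : NNReal} {f : ℝ × ℝ → ℝ} (hf : LipschitzWith K f)
    (hc : HasCompactSupport f) (ρ : ContDiffBump (0 : ℝ × ℝ)) (v x : ℝ × ℝ) :
    fderiv ℝ (ρ.normed volume ⋆[ContinuousLinearMap.lsmul ℝ ℝ, volume] f) x v =
      (ρ.normed volume ⋆[ContinuousLinearMap.lsmul ℝ ℝ, volume]
        (fun y => lineDeriv ℝ f y v)) x := by
  have hρ : ContDiff ℝ 1 (ρ.normed volume) := ρ.contDiff_normed
  have hρc : HasCompactSupport (ρ.normed volume) := ρ.hasCompactSupport_normed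
  obtain ⟨D, hD⟩ := hρ.lipschitzWith_of_hasCompactSupport hρc one_ne_zero
  have hloc : LocallyIntegrable f volume := hf.continuous.locallyIntegrable
  have hex : ConvolutionExistsAt (fderiv ℝ (ρ.normed volume)) f x
      ((ContinuousLinearMap.lsmul ℝ ℝ).precompL (ℝ × ℝ)) volume :=
    (hρc.fderiv ℝ).convolutionExists_left _ (hρ.continuous_fderiv one_ne_zero) hloc x
  rw [(hρc.hasFDerivAt_convolution_left (ContinuousLinearMap.lsmul ℝ ℝ) hρ hloc x).fderiv,
    convolution_def, ContinuousLinearMap.integral_apply hex]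
  simp only [convolution_def, ContinuousLinearMap.precompL_apply, ContinuousLinearMap.lsmul_apply,
    smul_eq_mul]
  set g : ℝ × ℝ → ℝ := fun t => f (x - t) with hg
  have hgL : LipschitzWith K g := by
    refine LipschitzWith.of_dist_le_mul fun a b => (hf.dist_le_mul _ _).trans ?_
    rw [dist_sub_left]
  have hgc : HasCompactSupport g := hc.comp_homeomorph (Homeomorph.subLeft x)
  have key := hD.integral_lineDeriv_mul_eq (μ := volume) hgL hgc v
  have e1 : ∀ t, fderiv ℝ (ρ.normed volume) t v = lineDeriv ℝ (ρ.normed volume) t v := fun t =>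
    ((hρ.differentiable one_ne_zero) t).lineDeriv_eq_fderiv.symm
  have e2 : ∀ t, lineDeriv ℝ g t (-v) = lineDeriv ℝ f (x - t) v := by
    intro t
    simp only [lineDeriv, hg]
    congr 1
    ext s
    congr 1
    simp only [smul_neg]
    abel
  simp only [e1]
  rw [key]
  simp only [e2, mul_comm]

lemma abs_fderiv_mollification_apply_le {K : NNReal} {f : ℝ × ℝ → ℝ} (hf : LipschitzWith K f)
    (hc : HasCompactSupport f) (ρ : ContDiffBump (0 : ℝ × ℝ)) (v x : ℝ × ℝ) :
    |fderiv ℝ (ρ.normed volume ⋆[ContinuousLinearMap.lsmul ℝ ℝ, volume] f) x v| ≤ K * ‖v‖ := by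
  rw [fderiv_mollification_apply hf hc]
  simp only [convolution_def, ContinuousLinearMap.lsmul_apply, smul_eq_mul]
  have h1 : ∀ t, ‖ρ.normed volume t * lineDeriv ℝ f (x - t) v‖ ≤
      ρ.normed volume t * (K * ‖v‖) := by
    intro t
    rw [norm_mul, Real.norm_of_nonneg (ρ.nonneg_normed t)]
    exact mul_le_mul_of_nonneg_left (norm_lineDeriv_le_of_lipschitz ℝ hf) (ρ.nonneg_normed t)
  have := norm_integral_le_of_norm_le (ρ.integrable_normed.mul_const _)
    (Filter.Eventually.of_forall h1)
  rwa [integral_mul_const, ρ.integral_normed, one_mul] at this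

lemma abs_pd1_le {K : NNReal} {f : ℝ × ℝ → ℝ} (hf : LipschitzWith K f) (x : ℝ × ℝ) :
    |pd1 f x| ≤ K := by
  have := (fderiv ℝ f x).le_of_opNorm_le (norm_fderiv_le_of_lipschitz ℝ hf) ((1, 0) : ℝ × ℝ)
  simpa [pd1] using this

lemma abs_pd2_le {K : NNReal} {f : ℝ × ℝ → ℝ} (hf : LipschitzWith K f) (x : ℝ × ℝ) :
    |pd2 f x| ≤ K := by
  have := (fderiv ℝ f x).le_of_opNorm_le (norm_fderiv_le_of_lipschitz ℝ hf) ((0, 1) : ℝ × ℝ)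
  simpa [pd2] using this

lemma measurable_pd1 (f : ℝ × ℝ → ℝ) : Measurable (pd1 f) := measurable_fderiv_apply_const ℝ f _

lemma measurable_pd2 (f : ℝ × ℝ → ℝ) : Measurable (pd2 f) := measurable_fderiv_apply_const ℝ f _

lemma isOpen_Qhat : IsOpen Qhat := isOpen_Ioo.prod isOpen_Ioo

lemma measurableSet_Qhat : MeasurableSet Qhat := isOpen_Qhat.measurableSet

/-- `(u1, u2)` is integrable on the square with integrable weak divergence `dv`. -/
structure WeakDiv (u1 u2 dv : ℝ × ℝ → ℝ) : Prop where
  int1 : IntegrableOn u1 Qhat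
  int2 : IntegrableOn u2 Qhat
  intd : IntegrableOn dv Qhat
  weak : ∀ ψ : ℝ × ℝ → ℝ, ContDiff ℝ (⊤ : ℕ∞) ψ → HasCompactSupport ψ → tsupport ψ ⊆ Qhat →
    (∫ x in Qhat, (u1 x * pd1 ψ x + u2 x * pd2 ψ x)) = -∫ x in Qhat, dv x * ψ x

lemma LipTest.bounded {U : Set (ℝ × ℝ)} {η : ℝ × ℝ → ℝ} (h : LipTest U η) :
    ∃ M, ∀ x, |η x| ≤ M := by
  obtain ⟨⟨K, hK⟩, hc, -⟩ := h
  exact hc.exists_bound_of_continuous hK.continuous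

lemma exists_bump_seq : ∃ ρ : ℕ → ContDiffBump (0 : ℝ × ℝ),
    (∀ n, (ρ n).rOut = 2 * (1 / ((n : ℝ) + 1))) ∧ ∀ n, (ρ n).rIn = 1 / ((n : ℝ) + 1) :=
  ⟨fun n => ⟨1 / ((n : ℝ) + 1), 2 * (1 / ((n : ℝ) + 1)), by positivity, by
    have : (0:ℝ) < 1 / ((n : ℝ) + 1) := by positivity
    linarith⟩, fun _ => rfl, fun _ => rfl⟩

open Filter Topology in
lemma WeakDiv.green_lipTest {u1 u2 dv : ℝ × ℝ → ℝ} (h : WeakDiv u1 u2 dv) {η : ℝ × ℝ → ℝ}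
    (hη : LipTest Qhat η) : ∫ x in Qhat, greenDensity u1 u2 dv η x = 0 := by
  obtain ⟨M, hM⟩ := hη.bounded
  obtain ⟨⟨K, hK⟩, hc, hs⟩ := hη
  have hloc : LocallyIntegrable η volume := hK.continuous.locallyIntegrable
  obtain ⟨ρ, hout, hin⟩ := exists_bump_seq
  have hlim : Tendsto (fun n => (ρ n).rOut) atTop (𝓝 0) := by
    simp only [hout]
    simpa using (tendsto_one_div_add_atTop_nhds_zero_nat (𝕜 := ℝ)).const_mul 2
  have hrat : ∀ᶠ n in atTop, (ρ n).rOut ≤ 2 * (ρ n).rIn :=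
    Eventually.of_forall fun n => by rw [hout, hin]
  set F : ℕ → ℝ × ℝ → ℝ := fun n =>
    (ρ n).normed volume ⋆[ContinuousLinearMap.lsmul ℝ ℝ, volume] η with hF
  have hFM : ∀ n x, |F n x| ≤ M := by
    intro n x
    simp only [hF, convolution_def, ContinuousLinearMap.lsmul_apply, smul_eq_mul]
    have h1 : ∀ t, ‖(ρ n).normed volume t * η (x - t)‖ ≤ (ρ n).normed volume t * M := by
      intro t
      rw [norm_mul, Real.norm_of_nonneg ((ρ n).nonneg_normed t)]
      exact mul_le_mul_of_nonneg_left (hM _) ((ρ n).nonneg_normed t)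
    have := norm_integral_le_of_norm_le ((ρ n).integrable_normed.mul_const _)
      (Eventually.of_forall h1)
    rwa [integral_mul_const, (ρ n).integral_normed, one_mul] at this
  have hFs : ∀ n, ContDiff ℝ (⊤ : ℕ∞) (F n) := fun n =>
    (ρ n).hasCompactSupport_normed.contDiff_convolution_left _ (ρ n).contDiff_normed hloc
  have hFc : ∀ n, HasCompactSupport (F n) := fun n =>
    (ρ n).hasCompactSupport_normed.convolution _ hc
  obtain ⟨δ, hδ, hδs⟩ := hc.isCompact.exists_cthickening_subset_open isOpen_Qhat hs
  have hFQ : ∀ᶠ n in atTop, tsupport (F n) ⊆ Qhat := by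
    filter_upwards [hlim.eventually (gt_mem_nhds hδ)] with n hn
    refine subset_trans (closure_minimal ?_ Metric.isClosed_cthickening) hδs
    refine (support_convolution_subset _).trans ?_
    rintro _ ⟨a, ha, b, hb, rfl⟩
    rw [(ρ n).support_normed_eq, Metric.mem_ball, dist_zero_right] at ha
    refine Metric.mem_cthickening_of_dist_le _ b _ _ (subset_tsupport _ hb) ?_
    simp only [dist_eq_norm, add_sub_cancel_right]
    exact (ha.trans hn).le
  have hzero : ∀ᶠ n in atTop, ∫ x in Qhat, greenDensity u1 u2 dv (F n) x = 0 := by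
    filter_upwards [hFQ] with n hn
    have hw := h.weak (F n) (hFs n) (hFc n) hn
    have hb : ∀ x v, |fderiv ℝ (F n) x v| ≤ K * ‖v‖ := fun x v =>
      abs_fderiv_mollification_apply_le hK hc (ρ n) v x
    have i1 : IntegrableOn (fun x => u1 x * pd1 (F n) x) Qhat :=
      h.int1.mul_bdd (measurable_pd1 _).aestronglyMeasurable
        (Eventually.of_forall fun x => hb x (1, 0))
    have i2 : IntegrableOn (fun x => u2 x * pd2 (F n) x) Qhat :=
      h.int2.mul_bdd (measurable_pd2 _).aestronglyMeasurable
        (Eventually.of_forall fun x => hb x (0, 1))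
    have i3 : IntegrableOn (fun x => dv x * F n x) Qhat :=
      h.intd.mul_bdd (hFs n).continuous.aestronglyMeasurable
        (Eventually.of_forall fun x => hFM n x)
    unfold greenDensity
    refine (integral_add (f := fun x => u1 x * pd1 (F n) x + u2 x * pd2 (F n) x)
      (i1.add i2) i3).trans ?_
    rw [hw]
    simp
  have hT : Tendsto (fun n => ∫ x in Qhat, greenDensity u1 u2 dv (F n) x) atTop
      (𝓝 (∫ x in Qhat, greenDensity u1 u2 dv η x)) := by
    refine tendsto_integral_of_dominated_convergence
      (fun x => |u1 x| * K + |u2 x| * K + |dv x| * M) ?_ ?_ ?_ ?_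
    · intro n
      exact ((h.int1.aestronglyMeasurable.mul (measurable_pd1 _).aestronglyMeasurable).add
        (h.int2.aestronglyMeasurable.mul (measurable_pd2 _).aestronglyMeasurable)).add
        (h.intd.aestronglyMeasurable.mul (hFs n).continuous.aestronglyMeasurable)
    · exact ((h.int1.abs.mul_const _).add (h.int2.abs.mul_const _)).add (h.intd.abs.mul_const _)
    · intro n
      refine Eventually.of_forall fun x => ?_
      have hb : ∀ x v, |fderiv ℝ (F n) x v| ≤ K * ‖v‖ := fun x v =>
        abs_fderiv_mollification_apply_le hK hc (ρ n) v x
      have b1 : |pd1 (F n) x| ≤ K := by simpa [pd1, pd2] using hb x (1, 0)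
      have b2 : |pd2 (F n) x| ≤ K := by simpa [pd1, pd2] using hb x (0, 1)
      have b3 := hFM n x
      simp only [greenDensity, Real.norm_eq_abs]
      refine (abs_add_three _ _ _).trans ?_
      simp only [abs_mul]
      gcongr
    · refine ae_restrict_of_ae ?_
      filter_upwards [ContDiffBump.ae_convolution_tendsto_right_of_locallyIntegrable hlim hrat
          (hK.locallyIntegrable_lineDeriv (μ := volume) ((1, 0) : ℝ × ℝ)),
        ContDiffBump.ae_convolution_tendsto_right_of_locallyIntegrable hlim hrat
          (hK.locallyIntegrable_lineDeriv (μ := volume) ((0, 1) : ℝ × ℝ)),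
        ContDiffBump.ae_convolution_tendsto_right_of_locallyIntegrable hlim hrat hloc,
        hK.ae_differentiableAt (μ := volume)] with x h1 h2 h3 h4
      have e1 : ∀ n, pd1 (F n) x = ((ρ n).normed volume ⋆[ContinuousLinearMap.lsmul ℝ ℝ, volume]
        (fun y => lineDeriv ℝ η y (1, 0))) x := fun n => fderiv_mollification_apply hK hc _ _ _
      have e2 : ∀ n, pd2 (F n) x = ((ρ n).normed volume ⋆[ContinuousLinearMap.lsmul ℝ ℝ, volume]
        (fun y => lineDeriv ℝ η y (0, 1))) x := fun n => fderiv_mollification_apply hK hc _ _ _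
      rw [h4.lineDeriv_eq_fderiv] at h1 h2
      simp only [greenDensity, e1, e2]
      exact ((h1.const_mul _).add (h2.const_mul _)).add (h3.const_mul _)
  exact tendsto_nhds_unique hT ((tendsto_congr' hzero).2 tendsto_const_nhds)

/-- Cutoff vanishing at distance `≤ 1/k` from `F`, equal to one at distance `≥ 2/k`. -/
def cutoff (F : Set (ℝ × ℝ)) (k : ℕ) (x : ℝ × ℝ) : ℝ :=
  max 0 (min 1 (k * Metric.infDist x F - 1))

lemma cutoff_nonneg (F : Set (ℝ × ℝ)) (k : ℕ) (x : ℝ × ℝ) : 0 ≤ cutoff F k x := le_max_left _ _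

lemma cutoff_le_one (F : Set (ℝ × ℝ)) (k : ℕ) (x : ℝ × ℝ) : cutoff F k x ≤ 1 :=
  max_le zero_le_one (min_le_left _ _)

lemma abs_cutoff_le_one (F : Set (ℝ × ℝ)) (k : ℕ) (x : ℝ × ℝ) : |cutoff F k x| ≤ 1 := by
  rw [abs_of_nonneg (cutoff_nonneg F k x)]
  exact cutoff_le_one F k x

lemma lipschitzWith_cutoff (F : Set (ℝ × ℝ)) (k : ℕ) : LipschitzWith k (cutoff F k) := by
  refine LipschitzWith.const_max (LipschitzWith.const_min ?_ 1) 0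
  refine LipschitzWith.of_dist_le_mul fun a b => ?_
  rw [Real.dist_eq, sub_sub_sub_cancel_right, ← mul_sub, abs_mul, ← Real.dist_eq]
  simpa using mul_le_mul_of_nonneg_left ((Metric.lipschitz_infDist_pt F).dist_le_mul a b)
    (Nat.cast_nonneg (α := ℝ) k)

lemma cutoff_eq_one {F : Set (ℝ × ℝ)} {k : ℕ} {x : ℝ × ℝ} (h : 2 ≤ k * Metric.infDist x F) :
    cutoff F k x = 1 := by
  unfold cutoff
  rw [min_eq_left (by linarith), max_eq_right zero_le_one]

lemma cutoff_eq_zero {F : Set (ℝ × ℝ)} {k : ℕ} {x : ℝ × ℝ} (h : k * Metric.infDist x F ≤ 1) :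
    cutoff F k x = 0 := by
  unfold cutoff
  exact max_eq_left ((min_le_right _ _).trans (by linarith))

lemma fderiv_cutoff_eq_zero {F : Set (ℝ × ℝ)} {k : ℕ} {x : ℝ × ℝ}
    (h : 2 < k * Metric.infDist x F) : fderiv ℝ (cutoff F k) x = 0 := by
  have hev : cutoff F k =ᶠ[nhds x] fun _ => (1 : ℝ) := by
    have hc : Continuous fun y : ℝ × ℝ => (k : ℝ) * Metric.infDist y F :=
      continuous_const.mul (Metric.continuous_infDist_pt F)
    filter_upwards [hc.continuousAt.eventually (lt_mem_nhds h)] with y hy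
    exact cutoff_eq_one (le_of_lt hy)
  rw [hev.fderiv_eq]
  simp

lemma greenDensity_mul {u1 u2 dv f g : ℝ × ℝ → ℝ} {x : ℝ × ℝ} (hf : DifferentiableAt ℝ f x)
    (hg : DifferentiableAt ℝ g x) :
    greenDensity u1 u2 dv (fun y => f y * g y) x =
      g x * greenDensity u1 u2 dv f x + f x * (u1 x * pd1 g x + u2 x * pd2 g x) := by
  have e : fderiv ℝ (fun y => f y * g y) x = f x • fderiv ℝ g x + g x • fderiv ℝ f x :=
    fderiv_fun_mul hf hg
  simp only [greenDensity, pd1, pd2, e, add_apply, smul_apply,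
    smul_eq_mul]
  ring

lemma ae_fderiv_eq_zero_of_eqOn_zero {f : ℝ × ℝ → ℝ} {S : Set (ℝ × ℝ)} (hS : MeasurableSet S)
    (hf : ∀ x ∈ S, f x = 0) :
    ∀ᵐ x, x ∈ S → DifferentiableAt ℝ f x → fderiv ℝ f x = 0 := by
  set T : Set (ℝ × ℝ) := S ∩ {x | DifferentiableAt ℝ f x} with hT
  have hTm : MeasurableSet T := hS.inter (measurableSet_of_differentiableAt ℝ f)
  set g : ℝ × ℝ → ℝ × ℝ := fun x => (f x, 0) with hg
  have hA : ApproximatesLinearOn g (0 : ℝ × ℝ →L[ℝ] ℝ × ℝ) T 0 := by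
    intro x hx y hy
    simp [hg, hf x hx.1, hf y hy.1]
  have key := hA.norm_fderiv_sub_le volume hTm
    (fun x => (fderiv ℝ f x).prod 0)
    (fun x hx => ((hx.2.hasFDerivAt).prodMk (hasFDerivAt_const (0:ℝ) x)).hasFDerivWithinAt)
  rw [ae_restrict_iff' hTm] at key
  filter_upwards [key] with x hx h1 h2
  have h0 := hx ⟨h1, h2⟩
  have h00 : (fderiv ℝ f x).prod (0 : ℝ × ℝ →L[ℝ] ℝ) = 0 := by
    have : ‖(fderiv ℝ f x).prod (0 : ℝ × ℝ →L[ℝ] ℝ) - 0‖₊ = 0 := le_antisymm h0 bot_le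
    rwa [sub_zero, nnnorm_eq_zero] at this
  exact ContinuousLinearMap.ext fun v => congrArg Prod.fst (DFunLike.congr_fun h00 v)

lemma measurableSet_zero_inter_Qhat {f : ℝ × ℝ → ℝ} (hf : ContinuousOn f Qhat) :
    MeasurableSet {x | x ∈ Qhat ∧ f x = 0} := by
  have h1 : IsOpen (Qhat ∩ f ⁻¹' {0}ᶜ) := hf.isOpen_inter_preimage isOpen_Qhat
    isOpen_compl_singleton
  convert measurableSet_Qhat.diff h1.measurableSet using 1
  ext x
  simp +contextual

lemma ae_greenDensity_eq_zero {u1 u2 dv f : ℝ × ℝ → ℝ} (hf : ContinuousOn f Qhat)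
    (hd : ∀ᵐ x ∂volume.restrict Qhat, DifferentiableAt ℝ f x) :
    ∀ᵐ x ∂volume.restrict Qhat, f x = 0 → greenDensity u1 u2 dv f x = 0 := by
  have h := ae_fderiv_eq_zero_of_eqOn_zero (measurableSet_zero_inter_Qhat hf) (fun x hx => hx.2)
  filter_upwards [ae_restrict_of_ae h, hd, ae_restrict_mem measurableSet_Qhat] with x h1 h2 h3 h4
  simp [greenDensity, pd1, pd2, h1 ⟨h3, h4⟩ h2, h4]

open Filter Topology in
/-- Removing a closed set `F` by cutoffs, provided the commutator terms vanish in the limit. -/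
lemma integral_greenDensity_eq_zero_of_cutoff {u1 u2 dv f : ℝ × ℝ → ℝ} {F : Set (ℝ × ℝ)} {M : ℝ}
    (hu1 : IntegrableOn u1 Qhat) (hu2 : IntegrableOn u2 Qhat)
    (hf : ContinuousOn f Qhat)
    (hd : ∀ᵐ x ∂volume.restrict Qhat, DifferentiableAt ℝ f x)
    (hint : IntegrableOn (greenDensity u1 u2 dv f) Qhat)
    (hM : ∀ x ∈ Qhat, |f x| ≤ M)
    (hF : ∀ᵐ x ∂volume.restrict Qhat, Metric.infDist x F = 0 → greenDensity u1 u2 dv f x = 0)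
    (hcut : ∀ k, 0 < k → ∫ x in Qhat, greenDensity u1 u2 dv (fun y => f y * cutoff F k y) x = 0)
    (hrem : Tendsto (fun k => ∫ x in Qhat, f x * (u1 x * pd1 (cutoff F k) x +
      u2 x * pd2 (cutoff F k) x)) atTop (𝓝 0)) :
    ∫ x in Qhat, greenDensity u1 u2 dv f x = 0 := by
  have i1 : ∀ k, IntegrableOn (fun x => cutoff F k x * greenDensity u1 u2 dv f x) Qhat := fun k =>
    hint.bdd_mul (lipschitzWith_cutoff F k).continuous.aestronglyMeasurable
      (Eventually.of_forall fun x => abs_cutoff_le_one F k x)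
  have i2 : ∀ k, IntegrableOn (fun x => f x * (u1 x * pd1 (cutoff F k) x +
      u2 x * pd2 (cutoff F k) x)) Qhat := fun k => by
    refine Integrable.bdd_mul (c := M) ?_ (hf.aestronglyMeasurable measurableSet_Qhat) ?_
    · exact (hu1.mul_bdd (measurable_pd1 _).aestronglyMeasurable (Eventually.of_forall fun x =>
        abs_pd1_le (lipschitzWith_cutoff F k) x)).add
        (hu2.mul_bdd (measurable_pd2 _).aestronglyMeasurable (Eventually.of_forall fun x =>
        abs_pd2_le (lipschitzWith_cutoff F k) x))
    · filter_upwards [ae_restrict_mem measurableSet_Qhat] with x hx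
      exact hM x hx
  have hsum : ∀ k, 0 < k → ∫ x in Qhat, cutoff F k x * greenDensity u1 u2 dv f x =
      - ∫ x in Qhat, f x * (u1 x * pd1 (cutoff F k) x + u2 x * pd2 (cutoff F k) x) := by
    intro k hk
    rw [eq_neg_iff_add_eq_zero, ← integral_add (i1 k) (i2 k), ← hcut k hk]
    refine integral_congr_ae ?_
    filter_upwards [hd, ae_restrict_of_ae
      ((lipschitzWith_cutoff F k).ae_differentiableAt (μ := volume))] with x h1 h2
    exact (greenDensity_mul h1 h2).symm
  have hT : Tendsto (fun k => ∫ x in Qhat, cutoff F k x * greenDensity u1 u2 dv f x) atTop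
      (𝓝 (∫ x in Qhat, greenDensity u1 u2 dv f x)) := by
    refine tendsto_integral_of_dominated_convergence (fun x => |greenDensity u1 u2 dv f x|)
      (fun k => (i1 k).aestronglyMeasurable) hint.abs ?_ ?_
    · intro k
      refine Eventually.of_forall fun x => ?_
      rw [norm_mul]
      exact mul_le_of_le_one_left (norm_nonneg _) (abs_cutoff_le_one F k x)
    · filter_upwards [hF] with x hx
      rcases (Metric.infDist_nonneg (x := x) (s := F)).eq_or_lt with h0 | h0
      · simp [hx h0.symm]
      · refine tendsto_const_nhds.congr' ?_
        filter_upwards [(tendsto_natCast_atTop_atTop.atTop_mul_const h0).eventually_ge_atTop 2]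
          with k hk
        rw [cutoff_eq_one hk, one_mul]
  have hT2 : Tendsto (fun k => ∫ x in Qhat, cutoff F k x * greenDensity u1 u2 dv f x) atTop
      (𝓝 0) := by
    have := hrem.neg
    rw [neg_zero] at this
    refine this.congr' ?_
    filter_upwards [eventually_gt_atTop 0] with k hk
    exact (hsum k hk).symm
  exact tendsto_nhds_unique hT hT2

open Filter Topology in
lemma tendsto_commutator_of_le_infDist {u1 u2 f : ℝ × ℝ → ℝ} {F : Set (ℝ × ℝ)} {C : ℝ}
    (hu1 : IntegrableOn u1 Qhat) (hu2 : IntegrableOn u2 Qhat)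
    (hf : ContinuousOn f Qhat) (hC : 0 ≤ C)
    (hfd : ∀ x ∈ Qhat, |f x| ≤ C * Metric.infDist x F) :
    Tendsto (fun k => ∫ x in Qhat, f x * (u1 x * pd1 (cutoff F k) x +
      u2 x * pd2 (cutoff F k) x)) atTop (𝓝 0) := by
  have key : Tendsto (fun k => ∫ x in Qhat, f x * (u1 x * pd1 (cutoff F k) x +
      u2 x * pd2 (cutoff F k) x)) atTop (𝓝 (∫ x in Qhat, (0:ℝ))) := by
    refine tendsto_integral_of_dominated_convergence (fun x => (|u1 x| + |u2 x|) * (2 * C))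
      ?_ ((hu1.abs.add hu2.abs).mul_const _) ?_ ?_
    · intro k
      exact (hf.aestronglyMeasurable measurableSet_Qhat).mul
        ((hu1.aestronglyMeasurable.mul (measurable_pd1 _).aestronglyMeasurable).add
        (hu2.aestronglyMeasurable.mul (measurable_pd2 _).aestronglyMeasurable))
    · intro k
      filter_upwards [ae_restrict_mem measurableSet_Qhat] with x hx
      rcases lt_or_ge 2 (k * Metric.infDist x F) with h | h
      · simp only [pd1, pd2, fderiv_cutoff_eq_zero h]
        simp only [zero_apply, mul_zero, add_zero, norm_zero]
        positivity
      · have b1 := abs_pd1_le (lipschitzWith_cutoff F k) x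
        have b2 := abs_pd2_le (lipschitzWith_cutoff F k) x
        simp only [NNReal.coe_natCast] at b1 b2
        have h3 : |u1 x * pd1 (cutoff F k) x + u2 x * pd2 (cutoff F k) x| ≤
            (|u1 x| + |u2 x|) * k := by
          refine (abs_add_le _ _).trans ?_
          rw [abs_mul, abs_mul, add_mul]
          gcongr
        rw [norm_mul, Real.norm_eq_abs, Real.norm_eq_abs]
        calc _ ≤ (C * Metric.infDist x F) * ((|u1 x| + |u2 x|) * k) :=
              mul_le_mul (hfd x hx) h3 (abs_nonneg _)
                (mul_nonneg hC Metric.infDist_nonneg)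
          _ = (|u1 x| + |u2 x|) * (C * (k * Metric.infDist x F)) := by ring
          _ ≤ (|u1 x| + |u2 x|) * (C * 2) := by gcongr
          _ = _ := by ring
    · filter_upwards [ae_restrict_mem measurableSet_Qhat] with x hx
      rcases (Metric.infDist_nonneg (x := x) (s := F)).eq_or_lt with h0 | h0
      · have : f x = 0 := by simpa [← h0] using hfd x hx
        simp [this]
      · refine tendsto_const_nhds.congr' ?_
        filter_upwards [(tendsto_natCast_atTop_atTop.atTop_mul_const h0).eventually_gt_atTop 2]
          with k hk
        simp [pd1, pd2, fderiv_cutoff_eq_zero hk]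
  simpa using key

lemma lipschitzWith_mul_of_bounded {f g : ℝ × ℝ → ℝ} {K L : NNReal} {M N : ℝ}
    (hf : LipschitzWith K f) (hg : LipschitzWith L g) (hM : ∀ x, |f x| ≤ M)
    (hN : ∀ x, |g x| ≤ N) : ∃ C, LipschitzWith C fun x => f x * g x := by
  have hM0 : 0 ≤ M := (abs_nonneg _).trans (hM 0)
  have hN0 : 0 ≤ N := (abs_nonneg _).trans (hN 0)
  refine ⟨K * N.toNNReal + M.toNNReal * L, LipschitzWith.of_dist_le_mul fun a b => ?_⟩
  have h1 := hf.dist_le_mul a b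
  have h2 := hg.dist_le_mul a b
  rw [Real.dist_eq] at h1 h2 ⊢
  push_cast
  rw [Real.coe_toNNReal _ hM0, Real.coe_toNNReal _ hN0]
  calc |f a * g a - f b * g b| = |(f a - f b) * g a + f b * (g a - g b)| := by congr 1; ring
    _ ≤ |f a - f b| * |g a| + |f b| * |g a - g b| := by
      rw [← abs_mul, ← abs_mul]
      exact abs_add_le _ _
    _ ≤ (K * dist a b) * N + M * (L * dist a b) := by
      gcongr
      exacts [hN a, hM b]
    _ = _ := by ring

lemma LipTest.mul {U : Set (ℝ × ℝ)} {η g : ℝ × ℝ → ℝ} (hη : LipTest U η) {L : NNReal} {N : ℝ}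
    (hg : LipschitzWith L g) (hN : ∀ x, |g x| ≤ N) : LipTest U fun x => η x * g x := by
  obtain ⟨M, hM⟩ := hη.bounded
  obtain ⟨⟨K, hK⟩, hc, hs⟩ := hη
  exact ⟨lipschitzWith_mul_of_bounded hK hg hM hN, hc.mul_right,
    (tsupport_mul_subset_left).trans hs⟩

lemma LipTest.mono {U V : Set (ℝ × ℝ)} {η : ℝ × ℝ → ℝ} (hη : LipTest U η) (h : U ⊆ V) :
    LipTest V η := ⟨hη.1, hη.2.1, hη.2.2.trans h⟩

lemma fderiv_eq_zero_of_notMem_tsupport {f : ℝ × ℝ → ℝ} {x : ℝ × ℝ} (hx : x ∉ tsupport f) :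
    fderiv ℝ f x = 0 := by
  have : x ∉ Function.support (fderiv ℝ f) := fun h => hx (support_fderiv_subset ℝ h)
  simpa using this

lemma ae_differentiableAt_of_differentiableOn {φ : ℝ × ℝ → ℝ} (hφ : DifferentiableOn ℝ φ Qhat) :
    ∀ᵐ x ∂volume.restrict Qhat, DifferentiableAt ℝ φ x := by
  filter_upwards [ae_restrict_mem measurableSet_Qhat] with x hx
  exact hφ.differentiableAt (isOpen_Qhat.mem_nhds hx)

lemma WeakDiv.integrableOn_greenDensity_mul {u1 u2 dv : ℝ × ℝ → ℝ} (h : WeakDiv u1 u2 dv)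
    {φ η : ℝ × ℝ → ℝ} (hφ : DifferentiableOn ℝ φ Qhat)
    (hi : IntegrableOn (fun x => u1 x * pd1 φ x + u2 x * pd2 φ x) Qhat) (hη : LipTest Qhat η) :
    IntegrableOn (greenDensity u1 u2 dv fun x => φ x * η x) Qhat := by
  obtain ⟨N, hN⟩ := hη.bounded
  obtain ⟨⟨K, hK⟩, hc, hs⟩ := hη
  obtain ⟨M, hM⟩ := hc.isCompact.exists_bound_of_continuousOn (hφ.continuousOn.mono hs)
  have hφm := hφ.continuousOn.aestronglyMeasurable (μ := volume) measurableSet_Qhat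
  have i1 : IntegrableOn (fun x => η x * (u1 x * pd1 φ x + u2 x * pd2 φ x)) Qhat :=
    Integrable.bdd_mul hi hK.continuous.aestronglyMeasurable
      (Filter.Eventually.of_forall fun x => hN x)
  have i2 : IntegrableOn (fun x => φ x * (u1 x * pd1 η x + u2 x * pd2 η x)) Qhat := by
    refine Integrable.mono' (g := fun x => |M| * ((|u1 x| + |u2 x|) * K)) ?_ ?_ ?_
    · exact ((h.int1.abs.add h.int2.abs).mul_const _).const_mul _
    · exact hφm.mul ((h.int1.aestronglyMeasurable.mul (measurable_pd1 _).aestronglyMeasurable).add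
        (h.int2.aestronglyMeasurable.mul (measurable_pd2 _).aestronglyMeasurable))
    · refine Filter.Eventually.of_forall fun x => ?_
      by_cases hx : x ∈ tsupport η
      · rw [norm_mul]
        refine mul_le_mul ((hM x hx).trans (le_abs_self M)) ?_ (norm_nonneg _) (abs_nonneg _)
        refine (abs_add_le _ _).trans ?_
        rw [abs_mul, abs_mul, add_mul]
        have b1 := abs_pd1_le hK x
        have b2 := abs_pd2_le hK x
        gcongr
      · simp only [pd1, pd2, fderiv_eq_zero_of_notMem_tsupport hx]
        simp only [zero_apply, mul_zero, add_zero, norm_zero]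
        positivity
  have i3 : IntegrableOn (fun x => dv x * (φ x * η x)) Qhat := by
    refine Integrable.mul_bdd (c := |M| * N) h.intd
      (hφm.mul hK.continuous.aestronglyMeasurable) ?_
    refine Filter.Eventually.of_forall fun x => ?_
    have hN0 : 0 ≤ N := (abs_nonneg _).trans (hN 0)
    by_cases hx : x ∈ tsupport η
    · rw [norm_mul]
      exact mul_le_mul ((hM x hx).trans (le_abs_self M)) (hN x) (norm_nonneg _) (abs_nonneg _)
    · rw [image_eq_zero_of_notMem_tsupport hx, mul_zero, norm_zero]
      positivity
  refine ((i1.add i2).add i3).congr ?_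
  filter_upwards [ae_differentiableAt_of_differentiableOn hφ, ae_restrict_of_ae
    (hK.ae_differentiableAt (μ := volume))] with x h1 h2
  rw [greenDensity_mul h1 h2]
  simp only [Pi.add_apply, greenDensity]
  ring

open scoped Manifold ContDiff in
lemma integral_greenDensity_mul_eq_zero_of_locally {u1 u2 dv : ℝ × ℝ → ℝ}
    (h : WeakDiv u1 u2 dv)
    {φ η : ℝ × ℝ → ℝ} (hφ : DifferentiableOn ℝ φ Qhat)
    (hi : IntegrableOn (fun x => u1 x * pd1 φ x + u2 x * pd2 φ x) Qhat) (hη : LipTest Qhat η)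
    (hloc : ∀ x ∈ tsupport η, ∃ U, IsOpen U ∧ x ∈ U ∧ U ⊆ Qhat ∧ ∀ ζ, LipTest U ζ →
      ∫ x in Qhat, greenDensity u1 u2 dv (fun y => φ y * ζ y) x = 0) :
    ∫ x in Qhat, greenDensity u1 u2 dv (fun y => φ y * η y) x = 0 := by
  choose! U hUo hxU hUQ hU using hloc
  obtain ⟨t, ht, hcov⟩ := hη.2.1.isCompact.elim_nhds_subcover U
    fun x hx => (hUo x hx).mem_nhds (hxU x hx)
  obtain ⟨p, hp⟩ := SmoothPartitionOfUnity.exists_isSubordinate 𝓘(ℝ, ℝ × ℝ) (isClosed_tsupport η)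
    (fun i : t => U i) (fun i => hUo i (ht i i.2)) (by simpa [iUnion_subtype] using hcov)
  have hbdd : Bornology.IsBounded Qhat :=
    (Metric.isBounded_Ioo (0:ℝ) 1).prod (Metric.isBounded_Ioo (0:ℝ) 1)
  have hpc : ∀ i, HasCompactSupport (p i) := fun i =>
    Metric.isCompact_of_isClosed_isBounded (isClosed_tsupport _)
      (hbdd.subset ((hp i).trans (hUQ i (ht i i.2))))
  have hpl : ∀ i, ∃ C, LipschitzWith C (p i) := fun i =>
    ContDiff.lipschitzWith_of_hasCompactSupport (n := ∞) (hpc i)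
      (p i).contMDiff.contDiff (by simp)
  have hpt : ∀ i : t, LipTest (U i) fun x => η x * p i x := fun i => by
    obtain ⟨C, hC⟩ := hpl i
    have h1 := hη.mul hC (N := 1) fun x => by
      rw [abs_of_nonneg (p.nonneg i x)]
      exact p.le_one i x
    exact ⟨h1.1, h1.2.1, (tsupport_mul_subset_right).trans (hp i)⟩
  have hsum : ∀ x, η x = ∑ i, η x * p i x := by
    intro x
    rw [← Finset.mul_sum]
    by_cases hx : x ∈ tsupport η
    · have := p.sum_eq_one hx
      rw [finsum_eq_sum_of_fintype] at this
      rw [this, mul_one]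
    · rw [image_eq_zero_of_notMem_tsupport hx, zero_mul]
  have hae : ∀ᵐ x ∂volume.restrict Qhat, greenDensity u1 u2 dv (fun y => φ y * η y) x =
      ∑ i, greenDensity u1 u2 dv (fun y => φ y * (η y * p i y)) x := by
    have hd : ∀ᵐ x ∂volume.restrict Qhat, ∀ i, DifferentiableAt ℝ (fun y => η y * p i y) x := by
      rw [ae_all_iff]
      intro i
      obtain ⟨⟨C, hC⟩, -⟩ := hpt i
      exact ae_restrict_of_ae hC.ae_differentiableAt
    filter_upwards [ae_differentiableAt_of_differentiableOn hφ, hd] with x h1 h2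
    have h3 : (fun y => φ y * η y) = fun y => ∑ i, φ y * (η y * p i y) := by
      ext y
      rw [← Finset.mul_sum, ← hsum]
    have h4 : fderiv ℝ (fun y => φ y * η y) x =
        ∑ i, fderiv ℝ (fun y => φ y * (η y * p i y)) x := by
      rw [h3]
      exact fderiv_fun_sum fun i _ => h1.mul (h2 i)
    have h5 : φ x * η x = ∑ i, φ x * (η x * p i x) := congrFun h3 x
    simp only [greenDensity, pd1, pd2, h4, h5, sum_apply, Finset.sum_add_distrib,
      Finset.mul_sum]
  rw [integral_congr_ae hae, integral_finsetSum]
  · exact Finset.sum_eq_zero fun i _ => hU i (ht i i.2) _ (hpt i)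
  · exact fun i _ => h.integrableOn_greenDensity_mul hφ hi ((hpt i).mono (hUQ i (ht i i.2)))

/-- Points of the square where `φ` has difference quotients bounded by `n + 1` at scale
`1 / (n + 1)`. -/
def lipLevel (φ : ℝ × ℝ → ℝ) (n : ℕ) : Set (ℝ × ℝ) :=
  {x | ∀ y ∈ Qhat, dist y x < 1 / ((n : ℝ) + 1) → |φ y - φ x| ≤ (n + 1) * dist y x}

open Filter Topology in
lemma exists_mem_lipLevel {φ : ℝ × ℝ → ℝ} {x : ℝ × ℝ} (hφ : DifferentiableAt ℝ φ x) :
    ∃ n, x ∈ lipLevel φ n := by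
  obtain ⟨C, hC⟩ := hφ.isBigO_sub.bound
  obtain ⟨ε, hε, hball⟩ := Metric.eventually_nhds_iff.1 hC
  obtain ⟨n, hn⟩ := exists_nat_ge (max C (1 / ε))
  refine ⟨n, fun y _ hy => ?_⟩
  have h1 : 1 / ((n : ℝ) + 1) ≤ ε := by
    rw [div_le_iff₀ (by positivity)]
    have := (le_max_right _ _).trans hn
    rw [div_le_iff₀ hε] at this
    nlinarith
  have h2 := hball (hy.trans_le h1)
  rw [Real.norm_eq_abs, ← dist_eq_norm] at h2
  refine h2.trans (mul_le_mul_of_nonneg_right ?_ dist_nonneg)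
  linarith [(le_max_left C (1 / ε)).trans hn]

open Filter Topology in
lemma mem_lipLevel_of_mem_closure {φ : ℝ × ℝ → ℝ} (hφ : ContinuousOn φ Qhat) {n : ℕ}
    {x : ℝ × ℝ} (hx : x ∈ Qhat) (hcl : x ∈ closure (Qhat ∩ lipLevel φ n)) : x ∈ lipLevel φ n := by
  intro y hy hyx
  obtain ⟨z, hz, hzl⟩ := mem_closure_iff_seq_limit.1 hcl
  have h1 : Tendsto (fun j => dist y (z j)) atTop (𝓝 (dist y x)) := tendsto_const_nhds.dist hzl
  have h2 : Tendsto (fun j => |φ y - φ (z j)|) atTop (𝓝 |φ y - φ x|) :=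
    ((((hφ.continuousAt (isOpen_Qhat.mem_nhds hx)).tendsto.comp hzl)).const_sub (φ y)).abs
  refine le_of_tendsto_of_tendsto h2 (h1.const_mul ((n : ℝ) + 1)) ?_
  filter_upwards [h1.eventually (gt_mem_nhds hyx)] with j hj
  exact (hz j).2 y hy hj

open Filter Topology in
/-- Baire category: a nonempty relatively closed subset of the square has a portion contained in
some `lipLevel`. -/
lemma exists_portion_subset_lipLevel {φ : ℝ × ℝ → ℝ} (hφ : DifferentiableOn ℝ φ Qhat)
    {P : Set (ℝ × ℝ)} (hPQ : P ⊆ Qhat) (hP : IsLocallyClosed P) (hne : P.Nonempty) :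
    ∃ x ∈ P, ∃ r > 0, ∃ n, P ∩ Metric.ball x r ⊆ lipLevel φ n := by
  have := hP.locallyCompactSpace
  have := hne.to_subtype
  obtain ⟨n, x, hx⟩ := nonempty_interior_of_iUnion_of_closed
    (f := fun n : ℕ => {x : P | (x : ℝ × ℝ) ∈ lipLevel φ n})
    (fun n => by
      rw [← closure_subset_iff_isClosed]
      intro x hx
      refine mem_lipLevel_of_mem_closure hφ.continuousOn (hPQ x.2) ?_
      have := image_closure_subset_closure_image continuous_subtype_val (mem_image_of_mem _ hx)
      refine closure_mono ?_ this
      rintro _ ⟨y, hy, rfl⟩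
      exact ⟨hPQ y.2, hy⟩)
    (eq_univ_of_forall fun x => by
      obtain ⟨n, hn⟩ := exists_mem_lipLevel
        (hφ.differentiableAt (isOpen_Qhat.mem_nhds (hPQ x.2)))
      exact mem_iUnion.2 ⟨n, hn⟩)
  rw [mem_interior_iff_mem_nhds, Metric.mem_nhds_iff] at hx
  obtain ⟨r, hr, hsub⟩ := hx
  exact ⟨x, x.2, r, hr, n, fun y hy => hsub (show (⟨y, hy.1⟩ : P) ∈ Metric.ball x r from hy.2)⟩

lemma greenDensity_sub {u1 u2 dv f g : ℝ × ℝ → ℝ} {x : ℝ × ℝ} (hf : DifferentiableAt ℝ f x)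
    (hg : DifferentiableAt ℝ g x) :
    greenDensity u1 u2 dv (fun y => f y - g y) x =
      greenDensity u1 u2 dv f x - greenDensity u1 u2 dv g x := by
  simp only [greenDensity, pd1, pd2, fderiv_fun_sub hf hg, sub_apply]
  ring

lemma exists_lipschitzWith_mul_of_hasCompactSupport {f g : ℝ × ℝ → ℝ} {K L : NNReal}
    (hf : LipschitzWith K f) (hg : LipschitzWith L g) (hc : HasCompactSupport g) :
    ∃ C, LipschitzWith C fun x => f x * g x := by
  obtain ⟨M, hM⟩ := hc.isCompact.exists_bound_of_continuousOn hf.continuous.continuousOn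
  obtain ⟨N, hN⟩ := LipTest.bounded (U := univ) ⟨⟨L, hg⟩, hc, subset_univ _⟩
  have h1 : LipschitzWith K fun x => max (-|M|) (min |M| (f x)) :=
    (hf.const_min _).const_max _
  obtain ⟨C, hC⟩ := lipschitzWith_mul_of_bounded h1 hg (M := |M|) (fun x => by
    rw [abs_le]
    exact ⟨le_max_left _ _, max_le (by linarith [abs_nonneg M]) (min_le_left _ _)⟩) hN
  refine ⟨C, ?_⟩
  convert hC using 2 with x
  by_cases hx : x ∈ tsupport g
  · have h2 := abs_le.1 (((Real.norm_eq_abs _).symm.le.trans (hM x hx)).trans (le_abs_self M))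
    rw [min_eq_right h2.2, max_eq_right h2.1]
  · simp [image_eq_zero_of_notMem_tsupport hx]

/-- Green's formula for products of an everywhere differentiable function with a compactly
supported Lipschitz function. -/
theorem WeakDiv.integral_greenDensity_mul_eq_zero {u1 u2 dv : ℝ × ℝ → ℝ} (h : WeakDiv u1 u2 dv)
    {φ : ℝ × ℝ → ℝ} (hφ : DifferentiableOn ℝ φ Qhat)
    (hi : IntegrableOn (fun x => u1 x * pd1 φ x + u2 x * pd2 φ x) Qhat)
    {η : ℝ × ℝ → ℝ} (hη : LipTest Qhat η) :
    ∫ x in Qhat, greenDensity u1 u2 dv (fun y => φ y * η y) x = 0 := by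
  set G : Set (ℝ × ℝ) := ⋃₀ {U | IsOpen U ∧ U ⊆ Qhat ∧ ∀ ζ, LipTest U ζ →
      ∫ x in Qhat, greenDensity u1 u2 dv (fun y => φ y * ζ y) x = 0} with hG
  have hGo : IsOpen G := isOpen_sUnion fun U hU => hU.1
  have hgood : ∀ ζ, LipTest Qhat ζ → tsupport ζ ⊆ G →
      ∫ x in Qhat, greenDensity u1 u2 dv (fun y => φ y * ζ y) x = 0 := by
    intro ζ hζ hs
    refine integral_greenDensity_mul_eq_zero_of_locally h hφ hi hζ fun x hx => ?_
    obtain ⟨U, ⟨h1, h2, h3⟩, hxU⟩ := hs hx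
    exact ⟨U, h1, hxU, h2, h3⟩
  refine hgood η hη (hη.2.2.trans ?_)
  by_contra hcon
  have hPne : (Qhat ∩ Gᶜ).Nonempty := by
    obtain ⟨x, hx, hxG⟩ := not_subset.1 hcon
    exact ⟨x, hx, hxG⟩
  obtain ⟨x0, hx0, r0, hr0, n, hn⟩ := exists_portion_subset_lipLevel hφ inter_subset_left
    (isOpen_Qhat.isLocallyClosed.inter hGo.isClosed_compl.isLocallyClosed) hPne
  obtain ⟨r1, hr1, hball⟩ := Metric.isOpen_iff.1 isOpen_Qhat x0 hx0.1
  obtain ⟨r, hr, hrr0, hrr1, hrn⟩ : ∃ r > 0, r ≤ r0 ∧ r ≤ r1 ∧ 2 * r ≤ 1 / ((n : ℝ) + 1) := by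
    have h0 : (0:ℝ) < 1 / ((n : ℝ) + 1) := by positivity
    refine ⟨min (min r0 r1) (1 / ((n : ℝ) + 1) / 2), by positivity,
      (min_le_left _ _).trans (min_le_left _ _), (min_le_left _ _).trans (min_le_right _ _), ?_⟩
    linarith [min_le_right (min r0 r1) (1 / ((n : ℝ) + 1) / 2)]
  set F : Set (ℝ × ℝ) := (Qhat ∩ Gᶜ) ∩ Metric.ball x0 r with hF
  have hFl : F ⊆ lipLevel φ n := fun x hx => hn ⟨hx.1, Metric.ball_subset_ball hrr0 hx.2⟩
  have hx0F : x0 ∈ F := ⟨hx0, Metric.mem_ball_self hr⟩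
  have hbQ : Metric.ball x0 r ⊆ Qhat := (Metric.ball_subset_ball hrr1).trans hball
  have hest : ∀ p ∈ F, ∀ y ∈ Metric.ball x0 r, |φ y - φ p| ≤ (n + 1) * dist y p := by
    intro p hp y hy
    refine hFl hp y (hbQ hy) (lt_of_lt_of_le ?_ hrn)
    have h1 := Metric.mem_ball.1 hy
    have h2 := Metric.mem_ball'.1 hp.2
    linarith [dist_triangle y x0 p]
  have hLip : LipschitzOnWith (n + 1 : NNReal) φ F := by
    refine LipschitzOnWith.of_dist_le_mul fun y hy p hp => ?_
    rw [Real.dist_eq]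
    exact_mod_cast hest p hp y hy.2
  obtain ⟨Φ, hΦ, hΦeq⟩ := hLip.extend_real
  refine hx0.2 (mem_sUnion.2 ⟨Metric.ball x0 r, ⟨Metric.isOpen_ball, hbQ, fun ζ hζ => ?_⟩,
    Metric.mem_ball_self hr⟩)
  have hζQ : LipTest Qhat ζ := hζ.mono hbQ
  obtain ⟨N, hN⟩ := hζ.bounded
  have hN0 : 0 ≤ N := (abs_nonneg _).trans (hN 0)
  have hΦζ : LipTest Qhat fun y => Φ y * ζ y := by
    obtain ⟨⟨K, hK⟩, hc, hs⟩ := hζQ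
    exact ⟨exists_lipschitzWith_mul_of_hasCompactSupport hΦ hK hc, hc.mul_left,
      tsupport_mul_subset_right.trans hs⟩
  set f : ℝ × ℝ → ℝ := fun y => φ y * ζ y - Φ y * ζ y with hf
  obtain ⟨⟨K, hK⟩, hζc, hζs⟩ := hζ
  obtain ⟨K', hK'⟩ := hΦζ.1
  have hFne : F.Nonempty := ⟨x0, hx0F⟩
  have hζ0 : ∀ y, y ∉ Metric.ball x0 r → ζ y = 0 := fun y hy =>
    image_eq_zero_of_notMem_tsupport fun h => hy (hζs h)
  have hfd : ∀ y ∈ Qhat, |f y| ≤ (2 * ((n : ℝ) + 1) * N) * Metric.infDist y F := by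
    intro y _
    by_cases hy : y ∈ Metric.ball x0 r
    · rcases (mul_nonneg (by positivity : 0 ≤ 2 * ((n : ℝ) + 1)) hN0).eq_or_lt with h0 | h0
      · have : N = 0 := by
          have h1 : 0 < 2 * ((n : ℝ) + 1) := by positivity
          exact (mul_eq_zero.1 h0.symm).resolve_left h1.ne'
        have h2 : ζ y = 0 := abs_nonpos_iff.1 ((hN y).trans this.le)
        simp [hf, h2, this]
      · rw [mul_comm, ← div_le_iff₀ h0, Metric.le_infDist hFne]
        intro p hp
        rw [div_le_iff₀ h0]
        have h1 := hest p hp y hy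
        have h2 := hΦ.dist_le_mul y p
        rw [Real.dist_eq, ← hΦeq hp] at h2
        have h3 : |φ y - Φ y| ≤ 2 * ((n : ℝ) + 1) * dist y p := by
          have h4 : |φ y - Φ y| ≤ |φ y - φ p| + |Φ y - φ p| := by
            rw [abs_sub_comm (Φ y)]
            exact abs_sub_le _ _ _
          push_cast at h2
          linarith
        calc |f y| = |φ y - Φ y| * |ζ y| := by rw [hf, ← abs_mul]; ring_nf
          _ ≤ (2 * ((n : ℝ) + 1) * dist y p) * N := by gcongr; exact hN y
          _ = _ := by ring
    · simp only [hf, hζ0 y hy, mul_zero, sub_zero, abs_zero]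
      exact mul_nonneg (by positivity) Metric.infDist_nonneg
  have hφd := ae_differentiableAt_of_differentiableOn hφ
  have hζd : ∀ᵐ x ∂volume.restrict Qhat, DifferentiableAt ℝ ζ x :=
    ae_restrict_of_ae hK.ae_differentiableAt
  have hΦd : ∀ᵐ x ∂volume.restrict Qhat, DifferentiableAt ℝ (fun y => Φ y * ζ y) x :=
    ae_restrict_of_ae hK'.ae_differentiableAt
  have hfc : ContinuousOn f Qhat :=
    (hφ.continuousOn.mul hK.continuous.continuousOn).sub hK'.continuous.continuousOn
  have hfdiff : ∀ᵐ x ∂volume.restrict Qhat, DifferentiableAt ℝ f x := by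
    filter_upwards [hφd, hζd, hΦd] with x h1 h2 h3 using (h1.mul h2).sub h3
  have hgf : ∀ᵐ x ∂volume.restrict Qhat, greenDensity u1 u2 dv f x =
      greenDensity u1 u2 dv (fun y => φ y * ζ y) x -
        greenDensity u1 u2 dv (fun y => Φ y * ζ y) x := by
    filter_upwards [hφd, hζd, hΦd] with x h1 h2 h3 using greenDensity_sub (h1.mul h2) h3
  have hI1 := h.integrableOn_greenDensity_mul hφ hi hζQ
  have hI2 : ∀ η, LipTest Qhat η → IntegrableOn (greenDensity u1 u2 dv η) Qhat := by
    intro η hη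
    simpa using h.integrableOn_greenDensity_mul (φ := fun _ => 1)
      (differentiableOn_const 1) (by simp [pd1, pd2]) hη
  have hfz : ∫ x in Qhat, greenDensity u1 u2 dv f x = 0 := by
    obtain ⟨A, hA⟩ := hK'.continuous.bounded_above_of_compact_support hΦζ.2.1
    obtain ⟨B, hB⟩ := hζc.isCompact.exists_bound_of_continuousOn
      (hφ.continuousOn.mono (hζs.trans hbQ))
    refine integral_greenDensity_eq_zero_of_cutoff (F := F) (M := |B| * N + A)
      h.int1 h.int2 hfc hfdiff ((hI1.sub (hI2 _ hΦζ)).congr (hgf.mono fun x hx => hx.symm))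
      ?_ ?_ ?_ (tendsto_commutator_of_le_infDist h.int1 h.int2 hfc (by positivity) hfd)
    · intro x _
      have h1 : |φ x * ζ x| ≤ |B| * N := by
        by_cases hx : x ∈ tsupport ζ
        · rw [abs_mul]
          exact mul_le_mul ((hB x hx).trans (le_abs_self B)) (hN x) (abs_nonneg _) (abs_nonneg _)
        · rw [image_eq_zero_of_notMem_tsupport hx, mul_zero, abs_zero]
          positivity
      exact (abs_sub _ _).trans (add_le_add h1 (hA x))
    · filter_upwards [ae_greenDensity_eq_zero (u1 := u1) (u2 := u2) (dv := dv) hfc hfdiff,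
        ae_restrict_mem measurableSet_Qhat] with x h1 h2 h3
      refine h1 (abs_nonpos_iff.1 ?_)
      have := hfd x h2
      rwa [h3, mul_zero] at this
    · intro k hk
      have hcl := lipschitzWith_cutoff F k
      have hζk := hζQ.mul hcl (abs_cutoff_le_one F k)
      have hΦk := hΦζ.mul hcl (abs_cutoff_le_one F k)
      have h1 := hgood _ hζk (by
        intro x hx
        by_contra hxG
        have hxζ : x ∈ tsupport ζ := tsupport_mul_subset_left hx
        have hxF : x ∈ F := ⟨⟨hbQ (hζs hxζ), hxG⟩, hζs hxζ⟩
        have hxc : x ∈ tsupport (cutoff F k) := tsupport_mul_subset_right hx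
        have hcl1 : IsClosed {y | 1 ≤ (k : ℝ) * Metric.infDist y F} :=
          isClosed_le continuous_const (continuous_const.mul (Metric.continuous_infDist_pt F))
        have h2 : x ∈ {y | 1 ≤ (k : ℝ) * Metric.infDist y F} := by
          refine closure_minimal (fun y hy => ?_) hcl1 hxc
          by_contra hlt
          exact hy (cutoff_eq_zero (not_le.1 hlt).le)
        rw [mem_ofPred_eq, Metric.infDist_zero_of_mem hxF] at h2
        norm_num at h2)
      have h2 := h.green_lipTest hΦk
      have hcd : ∀ᵐ x ∂volume.restrict Qhat, DifferentiableAt ℝ (cutoff F k) x :=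
        ae_restrict_of_ae hcl.ae_differentiableAt
      have h3 : ∀ᵐ x ∂volume.restrict Qhat,
          greenDensity u1 u2 dv (fun y => f y * cutoff F k y) x =
          greenDensity u1 u2 dv (fun y => φ y * (ζ y * cutoff F k y)) x -
            greenDensity u1 u2 dv (fun y => Φ y * ζ y * cutoff F k y) x := by
        filter_upwards [hφd, hζd, hΦd, hcd] with x g1 g2 g3 g4
        rw [← greenDensity_sub (f := fun y => φ y * (ζ y * cutoff F k y))
          (g := fun y => Φ y * ζ y * cutoff F k y) (g1.mul (g2.mul g4)) (g3.mul g4)]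
        congr 1
        ext y
        simp only [hf]
        ring
      rw [integral_congr_ae h3,
        integral_sub (h.integrableOn_greenDensity_mul hφ hi hζk) (hI2 _ hΦk), h1, h2, sub_zero]
  rw [integral_congr_ae hgf, integral_sub hI1 (hI2 _ hΦζ), h.green_lipTest hΦζ, sub_zero] at hfz
  exact hfz

/-- A continuous truncation kernel, vanishing near `0` and near infinity. -/
def truncKernel (n : ℕ) (t : ℝ) : ℝ := max 0 (min 1 (min (n * |t| - 1) (n + 1 - |t|)))

/-- The primitive of `truncKernel n` vanishing at `0`. -/
def trunc (n : ℕ) (t : ℝ) : ℝ := ∫ τ in (0:ℝ)..t, truncKernel n τ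

lemma continuous_truncKernel (n : ℕ) : Continuous (truncKernel n) := by
  unfold truncKernel
  fun_prop

lemma truncKernel_nonneg (n : ℕ) (t : ℝ) : 0 ≤ truncKernel n t := le_max_left _ _

lemma truncKernel_le_one (n : ℕ) (t : ℝ) : truncKernel n t ≤ 1 :=
  max_le zero_le_one (min_le_left _ _)

lemma abs_truncKernel_le_one (n : ℕ) (t : ℝ) : |truncKernel n t| ≤ 1 := by
  rw [abs_of_nonneg (truncKernel_nonneg n t)]
  exact truncKernel_le_one n t

lemma truncKernel_eq_zero {n : ℕ} {t : ℝ} (h : n * |t| ≤ 1) : truncKernel n t = 0 := by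
  refine max_eq_left ((min_le_right _ _).trans ((min_le_left _ _).trans ?_))
  linarith

open Filter Topology in
lemma tendsto_truncKernel {t : ℝ} (ht : t ≠ 0) :
    Tendsto (fun n => truncKernel n t) atTop (𝓝 1) := by
  refine tendsto_const_nhds.congr' ?_
  obtain ⟨N, hN⟩ := exists_nat_ge (max (2 / |t|) |t|)
  filter_upwards [eventually_ge_atTop N] with n hn
  have h1 : max (2 / |t|) |t| ≤ n := hN.trans (by exact_mod_cast hn)
  have h2 : 2 ≤ n * |t| := (div_le_iff₀ (abs_pos.2 ht)).1 ((le_max_left _ _).trans h1)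
  have h3 := (le_max_right _ _).trans h1
  rw [truncKernel, min_eq_left, max_eq_right zero_le_one]
  exact le_min (by linarith) (by linarith)

lemma hasDerivAt_trunc (n : ℕ) (t : ℝ) : HasDerivAt (trunc n) (truncKernel n t) t :=
  intervalIntegral.integral_hasDerivAt_right ((continuous_truncKernel n).intervalIntegrable _ _)
    ((continuous_truncKernel n).stronglyMeasurableAtFilter _ _) (continuous_truncKernel n).continuousAt

lemma abs_trunc_le (n : ℕ) (t : ℝ) : |trunc n t| ≤ |t| := by
  have := intervalIntegral.norm_integral_le_of_norm_le_const (a := 0) (b := t) (C := 1)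
    (f := truncKernel n) fun x _ => abs_truncKernel_le_one n x
  simpa [trunc] using this

lemma trunc_eq_zero {n : ℕ} {t : ℝ} (h : n * |t| ≤ 1) : trunc n t = 0 := by
  rw [trunc, intervalIntegral.integral_congr (g := fun _ => (0:ℝ)), intervalIntegral.integral_zero]
  intro x hx
  refine truncKernel_eq_zero (le_trans ?_ h)
  have := abs_sub_left_of_mem_uIcc hx
  simp only [sub_zero] at this
  gcongr

lemma trunc_bounded (n : ℕ) : ∃ M, ∀ t, |trunc n t| ≤ M := by
  have hc : HasCompactSupport (truncKernel n) := by
    refine HasCompactSupport.intro (isCompact_closedBall (0:ℝ) (n + 1)) fun x hx => ?_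
    refine max_eq_left ((min_le_right _ _).trans ((min_le_right _ _).trans ?_))
    rw [Metric.mem_closedBall, dist_zero_right, Real.norm_eq_abs, not_le] at hx
    linarith
  have hi := (continuous_truncKernel n).integrable_of_hasCompactSupport (μ := volume) hc
  refine ⟨∫ x, ‖truncKernel n x‖, fun t => ?_⟩
  refine (intervalIntegral.norm_integral_le_integral_norm_uIoc (f := truncKernel n)
    (μ := volume)).trans ?_
  exact setIntegral_le_integral hi.norm (Filter.Eventually.of_forall fun x => norm_nonneg _)

open Filter Topology in
lemma tendsto_trunc (t : ℝ) : Tendsto (fun n => trunc n t) atTop (𝓝 t) := by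
  have h : Tendsto (fun n => ∫ τ in (0:ℝ)..t, truncKernel n τ) atTop
      (𝓝 (∫ _ in (0:ℝ)..t, (1:ℝ))) := by
    refine intervalIntegral.tendsto_integral_filter_of_dominated_convergence (fun _ => 1) ?_ ?_ ?_ ?_
    · exact Eventually.of_forall fun n => (continuous_truncKernel n).aestronglyMeasurable
    · exact Eventually.of_forall fun n => Eventually.of_forall fun x _ => abs_truncKernel_le_one n x
    · exact intervalIntegrable_const
    · have : ∀ᵐ x : ℝ, x ≠ 0 := by simp [ae_iff]
      filter_upwards [this] with x hx _ using tendsto_truncKernel hx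
  rw [intervalIntegral.integral_const, smul_eq_mul, mul_one, sub_zero] at h
  exact h

lemma greenDensity_trunc_comp {u1 u2 dv w : ℝ × ℝ → ℝ} {x : ℝ × ℝ} (n : ℕ)
    (hw : DifferentiableAt ℝ w x) :
    greenDensity u1 u2 dv (fun y => trunc n (w y)) x =
      truncKernel n (w x) * (u1 x * pd1 w x + u2 x * pd2 w x) + dv x * trunc n (w x) := by
  have h := ((hasDerivAt_trunc n (w x)).comp_hasFDerivAt x hw.hasFDerivAt).fderiv
  have h' : fderiv ℝ (fun y => trunc n (w y)) x = truncKernel n (w x) • fderiv ℝ w x := h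
  simp only [greenDensity, pd1, pd2, h', smul_apply, smul_eq_mul]
  ring

lemma tsupport_cutoff_subset (F : Set (ℝ × ℝ)) (k : ℕ) :
    tsupport (cutoff F k) ⊆ {y | 1 ≤ (k : ℝ) * Metric.infDist y F} := by
  refine closure_minimal (fun y hy => ?_)
    (isClosed_le continuous_const (continuous_const.mul (Metric.continuous_infDist_pt F)))
  by_contra hlt
  exact hy (cutoff_eq_zero (not_le.1 hlt).le)

lemma isBounded_Qhat : Bornology.IsBounded Qhat :=
  (Metric.isBounded_Ioo (0:ℝ) 1).prod (Metric.isBounded_Ioo (0:ℝ) 1)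

lemma lipTest_cutoff_compl (k : ℕ) : LipTest Qhat (cutoff Qhatᶜ k) := by
  have h : tsupport (cutoff Qhatᶜ k) ⊆ Qhat := by
    intro x hx
    by_contra hxQ
    have := tsupport_cutoff_subset _ _ hx
    rw [mem_ofPred_eq, Metric.infDist_zero_of_mem (mem_compl hxQ)] at this
    norm_num at this
  exact ⟨⟨k, lipschitzWith_cutoff _ k⟩, Metric.isCompact_of_isClosed_isBounded
    (isClosed_tsupport _) (isBounded_Qhat.subset h), h⟩

lemma exists_cutoff_compl_eq_one {K : Set (ℝ × ℝ)} (hK : IsCompact K) (hKQ : K ⊆ Qhat) :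
    ∃ m, ∀ x ∈ K, cutoff Qhatᶜ m x = 1 := by
  rcases K.eq_empty_or_nonempty with rfl | hne
  · exact ⟨0, fun x hx => hx.elim⟩
  obtain ⟨x0, hx0, hmin⟩ := hK.exists_isMinOn hne
    (Metric.continuous_infDist_pt (Qhatᶜ)).continuousOn
  have hne' : (Qhatᶜ).Nonempty := ⟨(0, 0), fun h => lt_irrefl _ h.1.1⟩
  have hpos : 0 < Metric.infDist x0 Qhatᶜ :=
    (isOpen_Qhat.isClosed_compl.notMem_iff_infDist_pos hne').1 fun h => h (hKQ hx0)
  obtain ⟨m, hm⟩ := exists_nat_ge (2 / Metric.infDist x0 Qhatᶜ)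
  refine ⟨m, fun x hx => cutoff_eq_one ?_⟩
  rw [div_le_iff₀ hpos] at hm
  exact hm.trans (mul_le_mul_of_nonneg_left (hmin hx) (Nat.cast_nonneg m))

/-- Cauchy–Schwarz for integrals. -/
lemma sq_integral_mul_le {α : Type*} [MeasurableSpace α] {μ : Measure α} {f g : α → ℝ}
    (hf : Integrable (fun x => f x ^ 2) μ) (hg : Integrable (fun x => g x ^ 2) μ)
    (hfg : Integrable (fun x => f x * g x) μ) :
    (∫ x, f x * g x ∂μ) ^ 2 ≤ (∫ x, f x ^ 2 ∂μ) * ∫ x, g x ^ 2 ∂μ := by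
  have key : ∀ t : ℝ, 0 ≤ (∫ x, g x ^ 2 ∂μ) * (t * t) + (2 * ∫ x, f x * g x ∂μ) * t +
      ∫ x, f x ^ 2 ∂μ := by
    intro t
    have h1 : 0 ≤ ∫ x, (f x + t * g x) ^ 2 ∂μ := integral_nonneg fun x => sq_nonneg _
    have h2 : ∀ x, (f x + t * g x) ^ 2 = (g x ^ 2 * (t * t) + (f x * g x) * (2 * t)) + f x ^ 2 :=
      fun x => by ring
    simp_rw [h2] at h1
    have h3 := hg.mul_const (t * t)
    have h4 := hfg.mul_const (2 * t)
    rw [integral_add (f := fun x => g x ^ 2 * (t * t) + f x * g x * (2 * t)) (h3.add h4) hf,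
      integral_add h3 h4, integral_mul_const, integral_mul_const] at h1
    linarith
  have := discrim_le_zero key
  rw [discrim] at this
  nlinarith

/-- The corners of the square. -/
def corners : Set (ℝ × ℝ) := {(0, 0), (0, 1), (1, 0), (1, 1)}

lemma corners_nonempty : corners.Nonempty := ⟨(0, 0), Or.inl rfl⟩

lemma finite_corners : corners.Finite := by simp [corners]

lemma infDist_corners_pos {x : ℝ × ℝ} (hx : x ∈ Qhat) : 0 < Metric.infDist x corners := by
  refine (finite_corners.isClosed.notMem_iff_infDist_pos corners_nonempty).1 ?_
  rintro (rfl | rfl | rfl | rfl)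
  · exact lt_irrefl _ hx.1.1
  · exact lt_irrefl _ hx.1.1
  · exact lt_irrefl _ hx.1.2
  · exact lt_irrefl _ hx.1.2

lemma volume_infDist_corners_le {k : ℕ} (hk : 0 < k) :
    volume {x : ℝ × ℝ | (k : ℝ) * Metric.infDist x corners ≤ 2} ≠ ⊤ ∧
    volume.real {x : ℝ × ℝ | (k : ℝ) * Metric.infDist x corners ≤ 2} ≤ 64 / (k : ℝ) ^ 2 := by
  have hk' : (0 : ℝ) < k := by exact_mod_cast hk
  have hsub : {x : ℝ × ℝ | (k : ℝ) * Metric.infDist x corners ≤ 2} ⊆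
      ⋃ c ∈ finite_corners.toFinset, Metric.closedBall c (2 / k) := by
    intro x hx
    obtain ⟨c, hc, hd⟩ := finite_corners.isCompact.exists_infDist_eq_dist corners_nonempty x
    refine mem_iUnion₂.2 ⟨c, by simpa using hc, ?_⟩
    rw [Metric.mem_closedBall, ← hd, le_div_iff₀ hk', mul_comm]
    exact hx
  have hball : ∀ c : ℝ × ℝ, volume.real (Metric.closedBall c (2 / k)) = 16 / (k : ℝ) ^ 2 := by
    rintro ⟨a, b⟩
    rw [← closedBall_prod_same, Measure.volume_eq_prod, measureReal_prod_prod,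
      Real.volume_real_closedBall (by positivity), Real.volume_real_closedBall (by positivity)]
    field_simp
    norm_num
  have hfin : volume (⋃ c ∈ finite_corners.toFinset, Metric.closedBall c (2 / (k : ℝ))) ≠ ⊤ := by
    refine ((measure_biUnion_finset_le _ _).trans_lt ?_).ne
    exact ENNReal.sum_lt_top.2 fun c _ => measure_closedBall_lt_top
  refine ⟨measure_ne_top_of_subset hsub hfin, ?_⟩
  refine (measureReal_mono hsub hfin).trans ((measureReal_biUnion_finset_le _ _).trans ?_)
  simp only [hball, Finset.sum_const, nsmul_eq_mul]
  have hcard : finite_corners.toFinset.card ≤ 4 := by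
    have : finite_corners.toFinset = {(0, 0), (0, 1), (1, 0), (1, 1)} := by
      ext x
      simp [corners]
    rw [this]
    exact Finset.card_le_four
  calc (finite_corners.toFinset.card : ℝ) * (16 / (k : ℝ) ^ 2) ≤ 4 * (16 / (k : ℝ) ^ 2) := by
        gcongr
        exact_mod_cast hcard
    _ = 64 / (k : ℝ) ^ 2 := by ring

lemma integrable_of_sq {u : ℝ × ℝ → ℝ} (hm : AEStronglyMeasurable u (volume.restrict Qhat))
    (h : IntegrableOn (fun x => u x ^ 2) Qhat) : IntegrableOn u Qhat := by
  have hfin : IsFiniteMeasure (volume.restrict Qhat) :=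
    ⟨by simpa using isBounded_Qhat.measure_lt_top⟩
  refine Integrable.mono' ((integrable_const (1:ℝ)).add h) hm (Filter.Eventually.of_forall fun x => ?_)
  rw [Real.norm_eq_abs, Pi.add_apply, ← sq_abs (u x)]
  nlinarith [sq_nonneg (|u x| - 1), sq_nonneg (|u x|)]

open Filter Topology in
/-- The mass of a square integrable function in the shrinking corner regions is `o(1/k)`. -/
lemma tendsto_mul_integral_corner {u : ℝ × ℝ → ℝ} (hu : IntegrableOn u Qhat)
    (hu2 : IntegrableOn (fun x => u x ^ 2) Qhat) :
    Tendsto (fun k : ℕ => (k : ℝ) *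
      ∫ x in Qhat ∩ {x | (k : ℝ) * Metric.infDist x corners ≤ 2}, |u x|) atTop (𝓝 0) := by
  set S : ℕ → Set (ℝ × ℝ) := fun k => {x | (k : ℝ) * Metric.infDist x corners ≤ 2} with hS
  have hSm : ∀ k, MeasurableSet (S k) := fun k => (isClosed_le
    (continuous_const.mul (Metric.continuous_infDist_pt _)) continuous_const).measurableSet
  have h1 : Tendsto (fun k => ∫ x in Qhat ∩ S k, u x ^ 2) atTop (𝓝 0) := by
    have : Tendsto (fun k => ∫ x in Qhat, (S k).indicator (fun x => u x ^ 2) x) atTop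
        (𝓝 (∫ x in Qhat, (0:ℝ))) := by
      refine tendsto_integral_of_dominated_convergence (fun x => u x ^ 2)
        (fun k => hu2.aestronglyMeasurable.indicator (hSm k)) hu2 (fun k => ?_) ?_
      · refine Eventually.of_forall fun x => ?_
        rw [Real.norm_eq_abs, abs_of_nonneg (indicator_nonneg (fun _ _ => sq_nonneg _) _)]
        exact indicator_le_self' (fun _ _ => sq_nonneg _) _
      · filter_upwards [ae_restrict_mem measurableSet_Qhat] with x hx
        refine tendsto_const_nhds.congr' ?_
        obtain ⟨N, hN⟩ := exists_nat_gt (2 / Metric.infDist x corners)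
        filter_upwards [eventually_ge_atTop N] with k hk
        rw [indicator_of_notMem]
        rw [div_lt_iff₀ (infDist_corners_pos hx)] at hN
        have : (N : ℝ) * Metric.infDist x corners ≤ k * Metric.infDist x corners :=
          mul_le_mul_of_nonneg_right (by exact_mod_cast hk) Metric.infDist_nonneg
        simp only [hS, mem_ofPred_eq, not_le]
        linarith
    simpa [setIntegral_indicator, hSm] using this
  have h2 : Tendsto (fun k => Real.sqrt (64 * ∫ x in Qhat ∩ S k, u x ^ 2)) atTop (𝓝 0) := by
    have := (h1.const_mul 64).sqrt
    simpa using this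
  refine squeeze_zero' (Eventually.of_forall fun k => by positivity) ?_ h2
  filter_upwards [eventually_gt_atTop 0] with k hk
  have hk' : (0 : ℝ) < k := by exact_mod_cast hk
  refine Real.le_sqrt_of_sq_le ?_
  have hfin : volume (Qhat ∩ S k) < ⊤ := (isBounded_Qhat.subset inter_subset_left).measure_lt_top
  have : IsFiniteMeasure (volume.restrict (Qhat ∩ S k)) := ⟨by simpa using hfin⟩
  have h3 := sq_integral_mul_le (μ := volume.restrict (Qhat ∩ S k)) (f := fun x => |u x|)
    (g := fun _ => 1) (by simp only [sq_abs]; exact hu2.mono_set inter_subset_left) (integrable_const _)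
    (by simpa using (hu.mono_set inter_subset_left).abs)
  simp only [mul_one, sq_abs, one_pow, integral_const, smul_eq_mul, measureReal_restrict_apply_univ]
    at h3
  have h4 : volume.real (Qhat ∩ S k) ≤ 64 / (k : ℝ) ^ 2 := by
    exact (measureReal_mono inter_subset_right (volume_infDist_corners_le hk).1).trans
      (volume_infDist_corners_le hk).2
  have h5 : 0 ≤ ∫ x in Qhat ∩ S k, u x ^ 2 := integral_nonneg fun x => sq_nonneg _
  calc ((k : ℝ) * ∫ x in Qhat ∩ S k, |u x|) ^ 2 = (k : ℝ) ^ 2 * (∫ x in Qhat ∩ S k, |u x|) ^ 2 := by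
        ring
    _ ≤ (k : ℝ) ^ 2 * ((∫ x in Qhat ∩ S k, u x ^ 2) * (64 / (k : ℝ) ^ 2)) := by
        gcongr
        exact h3.trans (by gcongr)
    _ = 64 * ∫ x in Qhat ∩ S k, u x ^ 2 := by field_simp

open Filter Topology in
lemma tendsto_commutator_corners {u1 u2 f : ℝ × ℝ → ℝ} {M : ℝ}
    (hu1 : IntegrableOn u1 Qhat) (hu2 : IntegrableOn u2 Qhat)
    (hu1s : IntegrableOn (fun x => u1 x ^ 2) Qhat) (hu2s : IntegrableOn (fun x => u2 x ^ 2) Qhat)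
    (hM : ∀ x ∈ Qhat, |f x| ≤ M) :
    Tendsto (fun k => ∫ x in Qhat, f x * (u1 x * pd1 (cutoff corners k) x +
      u2 x * pd2 (cutoff corners k) x)) atTop (𝓝 0) := by
  set S : ℕ → Set (ℝ × ℝ) := fun k => {x | (k : ℝ) * Metric.infDist x corners ≤ 2} with hS
  have hSm : ∀ k, MeasurableSet (S k) := fun k => (isClosed_le
    (continuous_const.mul (Metric.continuous_infDist_pt _)) continuous_const).measurableSet
  have hlim := ((tendsto_mul_integral_corner hu1 hu1s).add
    (tendsto_mul_integral_corner hu2 hu2s)).const_mul |M|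
  simp only [add_zero, mul_zero] at hlim
  refine squeeze_zero_norm (fun k => ?_) hlim
  have hi : Integrable (fun x => |M| * ((k : ℝ) * (|u1 x| + |u2 x|)))
      (volume.restrict (Qhat ∩ S k)) :=
    (((hu1.abs.add hu2.abs).const_mul _).const_mul _).mono_measure
      (Measure.restrict_mono inter_subset_left le_rfl)
  have hb : ∀ x ∈ Qhat, ‖f x * (u1 x * pd1 (cutoff corners k) x +
      u2 x * pd2 (cutoff corners k) x)‖ ≤
      (S k).indicator (fun x => |M| * ((k : ℝ) * (|u1 x| + |u2 x|))) x := by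
    intro x hx
    by_cases hxS : x ∈ S k
    · rw [indicator_of_mem hxS, norm_mul]
      have h1 := abs_pd1_le (lipschitzWith_cutoff corners k) x
      have h2 := abs_pd2_le (lipschitzWith_cutoff corners k) x
      push_cast at h1 h2
      refine mul_le_mul ((hM x hx).trans (le_abs_self M)) ?_ (norm_nonneg _) (abs_nonneg _)
      refine (norm_add_le _ _).trans ?_
      rw [norm_mul, norm_mul, Real.norm_eq_abs, Real.norm_eq_abs, Real.norm_eq_abs,
        Real.norm_eq_abs]
      nlinarith [abs_nonneg (u1 x), abs_nonneg (u2 x)]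
    · have h0 : fderiv ℝ (cutoff corners k) x = 0 := fderiv_cutoff_eq_zero (not_le.1 hxS)
      rw [indicator_of_notMem hxS]
      simp [pd1, pd2, h0]
  refine (norm_integral_le_of_norm_le (g := (S k).indicator fun x =>
    |M| * ((k : ℝ) * (|u1 x| + |u2 x|))) ?_ ?_).trans (le_of_eq ?_)
  · rw [integrable_indicator_iff (hSm k), IntegrableOn, Measure.restrict_restrict (hSm k),
      inter_comm]
    exact hi
  · filter_upwards [ae_restrict_mem measurableSet_Qhat] with x hx using hb x hx
  · rw [setIntegral_indicator (hSm k), integral_const_mul, integral_const_mul, integral_add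
      (hu1.mono_set inter_subset_left).abs (hu2.mono_set inter_subset_left).abs]
    ring

/-- Green's formula without boundary terms for a bounded function which is compactly supported
in the square away from the corners. -/
lemma WeakDiv.integral_greenDensity_eq_zero_of_bounded {u1 u2 dv : ℝ × ℝ → ℝ}
    (h : WeakDiv u1 u2 dv)
    (hu1s : IntegrableOn (fun x => u1 x ^ 2) Qhat) (hu2s : IntegrableOn (fun x => u2 x ^ 2) Qhat)
    {W : ℝ × ℝ → ℝ} {M : ℝ} (hW : DifferentiableOn ℝ W Qhat)
    (hi : IntegrableOn (fun x => u1 x * pd1 W x + u2 x * pd2 W x) Qhat)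
    (hM : ∀ x ∈ Qhat, |W x| ≤ M)
    (hsupp : ∀ k : ℕ, 0 < k → ∃ ζ, LipTest Qhat ζ ∧
      ∀ x ∈ Qhat, W x * cutoff corners k x = W x * ζ x) :
    ∫ x in Qhat, greenDensity u1 u2 dv W x = 0 := by
  refine integral_greenDensity_eq_zero_of_cutoff (F := corners) (M := M) h.int1 h.int2
    hW.continuousOn (ae_differentiableAt_of_differentiableOn hW) ?_ hM ?_ ?_
    (tendsto_commutator_corners h.int1 h.int2 hu1s hu2s hM)
  · refine hi.add (h.intd.mul_bdd (c := M)
      (hW.continuousOn.aestronglyMeasurable measurableSet_Qhat) ?_)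
    filter_upwards [ae_restrict_mem measurableSet_Qhat] with x hx using hM x hx
  · filter_upwards [ae_restrict_mem measurableSet_Qhat] with x hx h0
    exact absurd h0 (infDist_corners_pos hx).ne'
  · intro k hk
    obtain ⟨ζ, hζ, heq⟩ := hsupp k hk
    rw [← h.integral_greenDensity_mul_eq_zero hW hi hζ]
    refine setIntegral_congr_fun measurableSet_Qhat fun x hx => ?_
    have h1 : (fun y => W y * cutoff corners k y) =ᶠ[nhds x] fun y => W y * ζ y := by
      filter_upwards [isOpen_Qhat.mem_nhds hx] with y hy using heq y hy
    simp only [greenDensity, pd1, pd2, h1.fderiv_eq, heq x hx]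

open Filter Topology in
/-- Green's formula for functions vanishing on the open edges: no boundary terms. -/
theorem WeakDiv.integral_greenDensity_eq_zero_of_trace {u1 u2 dv : ℝ × ℝ → ℝ}
    (h : WeakDiv u1 u2 dv)
    (hu1s : IntegrableOn (fun x => u1 x ^ 2) Qhat) (hu2s : IntegrableOn (fun x => u2 x ^ 2) Qhat)
    {w : ℝ × ℝ → ℝ} (hw : DifferentiableOn ℝ w Qhat)
    (hc : ContinuousOn w (closure Qhat \ corners))
    (h0 : ∀ x ∈ closure Qhat \ corners, x ∉ Qhat → w x = 0)
    (hi : IntegrableOn (fun x => u1 x * pd1 w x + u2 x * pd2 w x) Qhat)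
    (hdw : IntegrableOn (fun x => dv x * w x) Qhat) :
    ∫ x in Qhat, greenDensity u1 u2 dv w x = 0 := by
  have hdiff := ae_differentiableAt_of_differentiableOn hw
  have hWd : ∀ n, DifferentiableOn ℝ (fun y => trunc n (w y)) Qhat := fun n x hx =>
    ((hasDerivAt_trunc n (w x)).differentiableAt.comp x
      (hw.differentiableAt (isOpen_Qhat.mem_nhds hx))).differentiableWithinAt
  have hgrad : ∀ n, ∀ x ∈ Qhat, u1 x * pd1 (fun y => trunc n (w y)) x +
      u2 x * pd2 (fun y => trunc n (w y)) x =
      truncKernel n (w x) * (u1 x * pd1 w x + u2 x * pd2 w x) := by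
    intro n x hx
    have := greenDensity_trunc_comp (u1 := u1) (u2 := u2) (dv := fun _ => 0) n
      (hw.differentiableAt (isOpen_Qhat.mem_nhds hx))
    simpa [greenDensity] using this
  have hκm : ∀ n, AEStronglyMeasurable (fun x => truncKernel n (w x)) (volume.restrict Qhat) :=
    fun n => ((continuous_truncKernel n).comp_continuousOn hw.continuousOn).aestronglyMeasurable
      measurableSet_Qhat
  have hWi : ∀ n, IntegrableOn (fun x => u1 x * pd1 (fun y => trunc n (w y)) x +
      u2 x * pd2 (fun y => trunc n (w y)) x) Qhat := fun n =>
    (integrableOn_congr_fun (hgrad n) measurableSet_Qhat).2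
      (Integrable.bdd_mul hi (hκm n) (Eventually.of_forall fun x => abs_truncKernel_le_one n (w x)))
  have hz : ∀ n : ℕ, 0 < n →
      ∫ x in Qhat, greenDensity u1 u2 dv (fun y => trunc n (w y)) x = 0 := by
    intro n hn
    obtain ⟨M, hM⟩ := trunc_bounded n
    refine h.integral_greenDensity_eq_zero_of_bounded hu1s hu2s (hWd n) (hWi n)
      (fun x _ => hM (w x)) fun k hk => ?_
    have hk' : (0 : ℝ) < k := by exact_mod_cast hk
    have hn' : (0 : ℝ) < n := by exact_mod_cast hn
    set A : Set (ℝ × ℝ) := closure Qhat ∩ {x | 1 ≤ (k : ℝ) * Metric.infDist x corners} with hA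
    have hAc : IsClosed A := isClosed_closure.inter
      (isClosed_le continuous_const (continuous_const.mul (Metric.continuous_infDist_pt _)))
    have hAsub : A ⊆ closure Qhat \ corners := by
      rintro x ⟨hx, hx1⟩
      refine ⟨hx, fun hxc => ?_⟩
      rw [mem_ofPred_eq, Metric.infDist_zero_of_mem hxc] at hx1
      norm_num at hx1
    set B : Set (ℝ × ℝ) := A ∩ w ⁻¹' {t | 1 ≤ n * |t|} with hB
    have hBc : IsCompact B := Metric.isCompact_of_isClosed_isBounded
      ((hc.mono hAsub).preimage_isClosed_of_isClosed hAc
        (isClosed_le continuous_const (continuous_const.mul continuous_abs)))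
      (isBounded_Qhat.closure.subset fun x hx => hx.1.1)
    have hBQ : B ⊆ Qhat := by
      rintro x ⟨hx, hx1⟩
      by_contra hxQ
      rw [mem_preimage, h0 x (hAsub hx) hxQ, mem_ofPred_eq] at hx1
      norm_num at hx1
    obtain ⟨m, hm⟩ := exists_cutoff_compl_eq_one hBc hBQ
    refine ⟨_, (lipTest_cutoff_compl m).mul (lipschitzWith_cutoff corners k)
      (abs_cutoff_le_one corners k), fun x hx => ?_⟩
    by_cases hxB : x ∈ B
    · simp only [hm x hxB, one_mul]
    · by_cases hxA : x ∈ A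
      · have : ¬ 1 ≤ n * |w x| := fun hc => hxB ⟨hxA, hc⟩
        simp [trunc_eq_zero (not_le.1 this).le]
      · have : ¬ 1 ≤ (k : ℝ) * Metric.infDist x corners := fun hc =>
          hxA ⟨subset_closure hx, hc⟩
        simp [cutoff_eq_zero (not_le.1 this).le]
  have hlim : Tendsto (fun n => ∫ x in Qhat, greenDensity u1 u2 dv (fun y => trunc n (w y)) x)
      atTop (𝓝 (∫ x in Qhat, greenDensity u1 u2 dv w x)) := by
    refine tendsto_integral_of_dominated_convergence
      (fun x => |u1 x * pd1 w x + u2 x * pd2 w x| + |dv x * w x|) (fun n => ?_)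
      (hi.abs.add hdw.abs) (fun n => ?_) ?_
    · exact (hWi n).aestronglyMeasurable.add (h.intd.aestronglyMeasurable.mul
        ((hWd n).continuousOn.aestronglyMeasurable measurableSet_Qhat))
    · filter_upwards [hdiff] with x hx
      rw [greenDensity_trunc_comp n hx]
      refine (norm_add_le _ _).trans (add_le_add ?_ ?_)
      · rw [norm_mul]
        exact mul_le_of_le_one_left (norm_nonneg _) (abs_truncKernel_le_one n _)
      · rw [norm_mul, abs_mul]
        exact mul_le_mul_of_nonneg_left (abs_trunc_le n _) (norm_nonneg _)
    · filter_upwards [hdiff, ae_greenDensity_eq_zero (u1 := u1) (u2 := u2) (dv := dv)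
        hw.continuousOn hdiff] with x hx hx0
      simp_rw [greenDensity_trunc_comp _ hx]
      by_cases hwx : w x = 0
      · rw [hx0 hwx]
        simp [hwx, truncKernel_eq_zero, trunc_eq_zero]
      · simpa [greenDensity] using ((tendsto_truncKernel hwx).mul_const
          (u1 x * pd1 w x + u2 x * pd2 w x)).add ((tendsto_trunc (w x)).const_mul (dv x))
  refine tendsto_nhds_unique hlim (tendsto_const_nhds.congr' ?_)
  filter_upwards [eventually_gt_atTop 0] with n hn using (hz n hn).symm

/-- The pairing only depends on the boundary values of the test function. -/
lemma WeakDiv.pairing_congr {u1 u2 dv : ℝ × ℝ → ℝ} (h : WeakDiv u1 u2 dv)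
    (hu1s : IntegrableOn (fun x => u1 x ^ 2) Qhat) (hu2s : IntegrableOn (fun x => u2 x ^ 2) Qhat)
    {φ ψ : ℝ × ℝ → ℝ} (hφ : DifferentiableOn ℝ φ Qhat) (hψ : DifferentiableOn ℝ ψ Qhat)
    (hφc : ContinuousOn φ (closure Qhat \ corners)) (hψc : ContinuousOn ψ (closure Qhat \ corners))
    (heq : ∀ x ∈ closure Qhat \ corners, x ∉ Qhat → φ x = ψ x)
    (hφi : IntegrableOn (fun x => u1 x * pd1 φ x + u2 x * pd2 φ x) Qhat)
    (hψi : IntegrableOn (fun x => u1 x * pd1 ψ x + u2 x * pd2 ψ x) Qhat)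
    (hφd : IntegrableOn (fun x => dv x * φ x) Qhat)
    (hψd : IntegrableOn (fun x => dv x * ψ x) Qhat) :
    pairing u1 u2 dv φ = pairing u1 u2 dv ψ := by
  have hgrad : ∀ x ∈ Qhat, u1 x * pd1 (fun y => φ y - ψ y) x + u2 x * pd2 (fun y => φ y - ψ y) x =
      (u1 x * pd1 φ x + u2 x * pd2 φ x) - (u1 x * pd1 ψ x + u2 x * pd2 ψ x) := by
    intro x hx
    have h1 := hφ.differentiableAt (isOpen_Qhat.mem_nhds hx)
    have h2 := hψ.differentiableAt (isOpen_Qhat.mem_nhds hx)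
    simp only [pd1, pd2, fderiv_fun_sub h1 h2, sub_apply]
    ring
  have hi : IntegrableOn (fun x => u1 x * pd1 (fun y => φ y - ψ y) x +
      u2 x * pd2 (fun y => φ y - ψ y) x) Qhat :=
    (integrableOn_congr_fun hgrad measurableSet_Qhat).2 (hφi.sub hψi)
  have hd : IntegrableOn (fun x => dv x * (φ x - ψ x)) Qhat := by
    simp only [mul_sub]
    exact hφd.sub hψd
  have key := h.integral_greenDensity_eq_zero_of_trace hu1s hu2s (hφ.sub hψ) (hφc.sub hψc)
    (fun x hx hxQ => sub_eq_zero.2 (heq x hx hxQ)) hi hd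
  have key2 : (∫ x in Qhat, (u1 x * pd1 (fun y => φ y - ψ y) x +
      u2 x * pd2 (fun y => φ y - ψ y) x)) + ∫ x in Qhat, dv x * (φ x - ψ x) = 0 :=
    (integral_add hi hd).symm.trans key
  rw [setIntegral_congr_fun measurableSet_Qhat hgrad, integral_sub hφi hψi] at key2
  simp only [mul_sub] at key2
  rw [integral_sub hφd hψd] at key2
  simp only [pairing]
  linarith

lemma closure_Qhat : closure Qhat = Icc 0 1 ×ˢ Icc 0 1 := by
  rw [Qhat, closure_prod_eq, closure_Ioo zero_ne_one]

/-- A function on `closure Qhat` away from the corners has the edge values `w1, w2, w3, w4` on the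
left, right, bottom and top edge. -/
structure EdgeValues (φ : ℝ × ℝ → ℝ) (w1 w2 w3 w4 : ℝ) : Prop where
  left : ∀ t ∈ Ioo (0:ℝ) 1, φ (0, t) = w1
  right : ∀ t ∈ Ioo (0:ℝ) 1, φ (1, t) = w2
  bottom : ∀ t ∈ Ioo (0:ℝ) 1, φ (t, 0) = w3
  top : ∀ t ∈ Ioo (0:ℝ) 1, φ (t, 1) = w4

lemma EdgeValues.eq {φ ψ : ℝ × ℝ → ℝ} {w1 w2 w3 w4 : ℝ} (hφ : EdgeValues φ w1 w2 w3 w4)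
    (hψ : EdgeValues ψ w1 w2 w3 w4) {x : ℝ × ℝ} (hx : x ∈ closure Qhat \ corners)
    (hxQ : x ∉ Qhat) : φ x = ψ x := by
  obtain ⟨a, b⟩ := x
  rw [closure_Qhat] at hx
  obtain ⟨⟨⟨ha0, ha1⟩, hb0, hb1⟩, hc⟩ := hx
  simp only [corners, mem_insert_iff, mem_singleton_iff, Prod.mk.injEq, not_or] at hc
  simp only at ha0 ha1 hb0 hb1
  rcases ha0.eq_or_lt with rfl | ha0
  · have : b ∈ Ioo (0:ℝ) 1 := ⟨hb0.lt_of_ne fun h => by simp [← h] at hc,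
      hb1.lt_of_ne fun h => by simp [h] at hc⟩
    rw [hφ.left b this, hψ.left b this]
  rcases ha1.eq_or_lt with rfl | ha1
  · have : b ∈ Ioo (0:ℝ) 1 := ⟨hb0.lt_of_ne fun h => by simp [← h] at hc,
      hb1.lt_of_ne fun h => by simp [h] at hc⟩
    rw [hφ.right b this, hψ.right b this]
  rcases hb0.eq_or_lt with rfl | hb0
  · rw [hφ.bottom a ⟨ha0, ha1⟩, hψ.bottom a ⟨ha0, ha1⟩]
  rcases hb1.eq_or_lt with rfl | hb1
  · rw [hφ.top a ⟨ha0, ha1⟩, hψ.top a ⟨ha0, ha1⟩]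
  exact absurd ⟨⟨ha0, ha1⟩, hb0, hb1⟩ hxQ

/-- The sum of the powers `t ^ (-p)` of the distances to the two endpoints of `(0,1)`. -/
def endWeight (p t : ℝ) : ℝ := t ^ (-p) + (1 - t) ^ (-p)

lemma endWeight_nonneg {p t : ℝ} (ht : t ∈ Ioo (0:ℝ) 1) : 0 ≤ endWeight p t :=
  add_nonneg (Real.rpow_nonneg ht.1.le _) (Real.rpow_nonneg (by linarith [ht.2]) _)

lemma endWeight_one_sub (p t : ℝ) : endWeight p (1 - t) = endWeight p t := by
  rw [endWeight, endWeight, sub_sub_cancel, add_comm]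

lemma rpow_neg_le_endWeight {p t : ℝ} (ht : t ∈ Ioo (0:ℝ) 1) : t ^ (-p) ≤ endWeight p t :=
  le_add_of_nonneg_right (Real.rpow_nonneg (by linarith [ht.2]) _)

lemma continuousOn_endWeight (p : ℝ) : ContinuousOn (endWeight p) (Ioo 0 1) := by
  intro t ht
  refine ContinuousAt.continuousWithinAt (ContinuousAt.add ?_ ?_)
  · exact Real.continuousAt_rpow_const _ _ (Or.inl ht.1.ne')
  · exact ContinuousAt.rpow_const (by fun_prop) (Or.inl (by linarith [ht.2]))

lemma integrableOn_endWeight {p : ℝ} (hp : p < 1) : IntegrableOn (endWeight p) (Ioo 0 1) := by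
  have h1 : IntervalIntegrable (fun t : ℝ => t ^ (-p)) volume 0 1 :=
    intervalIntegral.intervalIntegrable_rpow' (by linarith)
  have h2 : IntervalIntegrable (fun t : ℝ => (1 - t) ^ (-p)) volume 0 1 := by
    have := (h1.comp_sub_left 1).symm
    simpa using this
  rw [intervalIntegrable_iff_integrableOn_Ioo_of_le zero_le_one] at h1 h2
  exact h1.add h2

lemma rpow_mul_one_sub_le {q t : ℝ} (hq0 : 0 ≤ q) (hq : q ≤ 1) (ht : t ∈ Ioo (0:ℝ) 1) :
    (t * (1 - t)) ^ (-q) ≤ 2 * endWeight q t := by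
  have h1 : 0 < 1 - t := by linarith [ht.2]
  have half : ∀ r : ℝ, 1 / 2 ≤ r → r ^ (-q) ≤ 2 := by
    intro r hr
    calc r ^ (-q) ≤ (1 / 2 : ℝ) ^ (-q) :=
          Real.rpow_le_rpow_of_nonpos (by norm_num) hr (by linarith)
      _ = 2 ^ q := by
          rw [one_div, Real.inv_rpow (by norm_num), Real.rpow_neg (by norm_num), inv_inv]
      _ ≤ 2 ^ (1:ℝ) := Real.rpow_le_rpow_of_exponent_le (by norm_num) hq
      _ = 2 := Real.rpow_one 2
  have p1 := Real.rpow_nonneg ht.1.le (-q)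
  have p2 := Real.rpow_nonneg h1.le (-q)
  rw [Real.mul_rpow ht.1.le h1.le, endWeight]
  rcases le_total t (1 / 2) with h | h
  · nlinarith [half (1 - t) (by linarith)]
  · nlinarith [half t h]

lemma restrict_Qhat : (volume.restrict Qhat : Measure (ℝ × ℝ)) =
    (volume.restrict (Ioo (0:ℝ) 1)).prod (volume.restrict (Ioo (0:ℝ) 1)) := by
  rw [Qhat, Measure.prod_restrict, Measure.volume_eq_prod]

lemma pd1_eq_of_hasDerivAt {φ : ℝ × ℝ → ℝ} {x : ℝ × ℝ} {d : ℝ} (hφ : DifferentiableAt ℝ φ x)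
    (h : HasDerivAt (fun t => φ (t, x.2)) d x.1) : pd1 φ x = d := by
  have h1 : HasDerivAt (fun t : ℝ => (t, x.2)) ((1, 0) : ℝ × ℝ) x.1 :=
    (hasDerivAt_id x.1).prodMk (hasDerivAt_const x.1 x.2)
  exact (hφ.hasFDerivAt.comp_hasDerivAt x.1 h1).unique h

lemma hasDerivAt_pd2 {φ : ℝ × ℝ → ℝ} {x : ℝ × ℝ} (hφ : DifferentiableAt ℝ φ x) :
    HasDerivAt (fun t => φ (x.1, t)) (pd2 φ x) x.2 := by
  have h1 : HasDerivAt (fun t : ℝ => (x.1, t)) ((0, 1) : ℝ × ℝ) x.2 :=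
    (hasDerivAt_const x.2 x.1).prodMk (hasDerivAt_id x.2)
  exact hφ.hasFDerivAt.comp_hasDerivAt x.2 h1

lemma pd2_eq_of_hasDerivAt {φ : ℝ × ℝ → ℝ} {x : ℝ × ℝ} {d : ℝ} (hφ : DifferentiableAt ℝ φ x)
    (h : HasDerivAt (fun t => φ (x.1, t)) d x.2) : pd2 φ x = d :=
  (hasDerivAt_pd2 hφ).unique h

/-- A lifting of edge values with finite weighted Dirichlet energy and vertical derivative of
mean zero on vertical lines. -/
structure EdgeLift (s : ℝ) (φ : ℝ × ℝ → ℝ) : Prop where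
  diff : DifferentiableOn ℝ φ Qhat
  cont : ContinuousOn φ (closure Qhat \ corners)
  bdd : ∀ x ∈ Qhat, |φ x| ≤ 1
  grad1 : IntegrableOn (fun x => pd1 φ x ^ 2 / endWeight (s / 2) x.1) Qhat
  grad2 : IntegrableOn (fun x => pd2 φ x ^ 2) Qhat
  mean : ∀ t ∈ Ioo (0:ℝ) 1, ∫ y in Ioo (0:ℝ) 1, pd2 φ (t, y) = 0

/-- The profile of the edge lifting: `1` for `r = 0` and `0` for `r = 1`, `y = 0` and `y = 1`. -/
def edgeProfile (δ r y : ℝ) : ℝ := (1 - r) * (y * (1 - y)) / (y * (1 - y) + r ^ (1 - δ))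

lemma inv_sq_le_rpow {δ r y : ℝ} (hδ0 : 0 < δ) (hδ1 : δ < 1) (hr : r ∈ Ioo (0:ℝ) 1)
    (hy : y ∈ Ioo (0:ℝ) 1) :
    1 / (y * (1 - y) + r ^ (1 - δ)) ^ 2 ≤ r ^ (-(1 - δ ^ 2)) * (2 * endWeight (1 - δ) y) := by
  have hb : 0 < y * (1 - y) := mul_pos hy.1 (by linarith [hy.2])
  have hτ : 0 < r ^ (1 - δ) := Real.rpow_pos_of_pos hr.1 _
  have hD : 0 < y * (1 - y) + r ^ (1 - δ) := by positivity
  have h1 : 1 / (y * (1 - y) + r ^ (1 - δ)) ^ 2 =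
      (y * (1 - y) + r ^ (1 - δ)) ^ (-(1 + δ)) * (y * (1 - y) + r ^ (1 - δ)) ^ (-(1 - δ)) := by
    rw [← Real.rpow_add hD, one_div, ← Real.rpow_natCast, ← Real.rpow_neg hD.le]
    congr 1
    push_cast
    ring
  have h2 : (y * (1 - y) + r ^ (1 - δ)) ^ (-(1 + δ)) ≤ r ^ (-(1 - δ ^ 2)) := by
    calc _ ≤ (r ^ (1 - δ)) ^ (-(1 + δ)) :=
          Real.rpow_le_rpow_of_nonpos hτ (by linarith) (by linarith)
      _ = r ^ (-(1 - δ ^ 2)) := by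
          rw [← Real.rpow_mul hr.1.le]
          congr 1
          ring
  have h3 : (y * (1 - y) + r ^ (1 - δ)) ^ (-(1 - δ)) ≤ 2 * endWeight (1 - δ) y :=
    (Real.rpow_le_rpow_of_nonpos hb (by linarith) (by linarith)).trans
      (rpow_mul_one_sub_le (by linarith) (by linarith) hy)
  rw [h1]
  exact mul_le_mul h2 h3 (Real.rpow_nonneg hD.le _) (Real.rpow_nonneg hr.1.le _)

lemma hasDerivAt_edgeProfile_fst {δ r y : ℝ} (hr : 0 < r) (hy : y ∈ Ioo (0:ℝ) 1) :
    HasDerivAt (fun r => edgeProfile δ r y)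
      ((-(y * (1 - y)) * (y * (1 - y) + r ^ (1 - δ)) -
        (1 - r) * (y * (1 - y)) * ((1 - δ) * r ^ (-δ))) / (y * (1 - y) + r ^ (1 - δ)) ^ 2) r := by
  have hb : 0 < y * (1 - y) := mul_pos hy.1 (by linarith [hy.2])
  have hτ : 0 < r ^ (1 - δ) := Real.rpow_pos_of_pos hr _
  have h1 : HasDerivAt (fun r : ℝ => (1 - r) * (y * (1 - y))) (-(y * (1 - y))) r := by
    simpa using ((hasDerivAt_id r).const_sub 1).mul_const (y * (1 - y))
  have h2 : HasDerivAt (fun r : ℝ => y * (1 - y) + r ^ (1 - δ)) ((1 - δ) * r ^ (-δ)) r := by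
    have := (Real.hasDerivAt_rpow_const (p := 1 - δ) (Or.inl hr.ne')).const_add (y * (1 - y))
    rwa [show 1 - δ - 1 = -δ by ring] at this
  exact h1.div h2 (by positivity)

lemma hasDerivAt_edgeProfile_snd {δ r y : ℝ} (hr : 0 < r) (hy : y ∈ Ioo (0:ℝ) 1) :
    HasDerivAt (fun y => edgeProfile δ r y)
      ((1 - r) * (1 - 2 * y) * r ^ (1 - δ) / (y * (1 - y) + r ^ (1 - δ)) ^ 2) y := by
  have hb : 0 < y * (1 - y) := mul_pos hy.1 (by linarith [hy.2])
  have hτ : 0 < r ^ (1 - δ) := Real.rpow_pos_of_pos hr _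
  have h0 : HasDerivAt (fun y : ℝ => y * (1 - y)) (1 - 2 * y) y := by
    refine ((hasDerivAt_id y).mul ((hasDerivAt_id y).const_sub 1)).congr_deriv ?_
    simp only [id]
    ring
  refine ((h0.const_mul (1 - r)).div (h0.add_const (r ^ (1 - δ))) (by positivity)).congr_deriv ?_
  ring

lemma abs_edgeProfile_le_one {δ r y : ℝ} (hr : r ∈ Ioo (0:ℝ) 1) (hy : y ∈ Ioo (0:ℝ) 1) :
    |edgeProfile δ r y| ≤ 1 := by
  have hb : 0 < y * (1 - y) := mul_pos hy.1 (by linarith [hy.2])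
  have hτ : 0 < r ^ (1 - δ) := Real.rpow_pos_of_pos hr.1 _
  have h1 : 0 < 1 - r := by linarith [hr.2]
  rw [edgeProfile, abs_of_nonneg (by positivity), div_le_one (by positivity)]
  nlinarith [hr.1]

lemma sq_deriv_edgeProfile_fst_le {δ r y : ℝ} (hδ0 : 0 < δ) (hδ1 : δ < 1)
    (hr : r ∈ Ioo (0:ℝ) 1) (hy : y ∈ Ioo (0:ℝ) 1) :
    ((-(y * (1 - y)) * (y * (1 - y) + r ^ (1 - δ)) -
      (1 - r) * (y * (1 - y)) * ((1 - δ) * r ^ (-δ))) / (y * (1 - y) + r ^ (1 - δ)) ^ 2) ^ 2 *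
        r ^ (2 * δ) ≤ 2 + 2 * (1 / (y * (1 - y) + r ^ (1 - δ)) ^ 2) := by
  have hb : 0 < y * (1 - y) := mul_pos hy.1 (by linarith [hy.2])
  have hτ : 0 < r ^ (1 - δ) := Real.rpow_pos_of_pos hr.1 _
  have hρ : 0 < r ^ (-δ) := Real.rpow_pos_of_pos hr.1 _
  have hT : 0 < r ^ (2 * δ) := Real.rpow_pos_of_pos hr.1 _
  have hT1 : r ^ (2 * δ) ≤ 1 := Real.rpow_le_one hr.1.le hr.2.le (by linarith)
  have hRT : (r ^ (-δ)) ^ 2 * r ^ (2 * δ) = 1 := by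
    rw [← Real.rpow_natCast, ← Real.rpow_mul hr.1.le, ← Real.rpow_add hr.1]
    norm_num
    rw [show -(δ * 2) + 2 * δ = 0 by ring, Real.rpow_zero]
  set b := y * (1 - y)
  set τ := r ^ (1 - δ)
  set R := r ^ (-δ)
  set T := r ^ (2 * δ)
  have hD : 0 < b + τ := by positivity
  have hr1 : 0 < 1 - r := by linarith [hr.2]
  have hδ : 0 < 1 - δ := by linarith
  have hA : (b / (b + τ)) ^ 2 ≤ 1 :=
    pow_le_one₀ (by positivity) ((div_le_one hD).2 (by linarith))
  have hB : ((1 - r) * b * ((1 - δ) * R) / (b + τ) ^ 2) ^ 2 ≤ R ^ 2 * (1 / (b + τ) ^ 2) := by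
    have : (1 - r) * b * ((1 - δ) * R) / (b + τ) ^ 2 ≤ R / (b + τ) := by
      rw [div_le_div_iff₀ (by positivity) hD]
      have h1 : (1 - r) * (1 - δ) ≤ 1 := by nlinarith [hr.1]
      have h2 : b * R * (b + τ) ≤ (b + τ) * R * (b + τ) := by gcongr; linarith
      calc (1 - r) * b * ((1 - δ) * R) * (b + τ) = ((1 - r) * (1 - δ)) * (b * R * (b + τ)) := by
            ring
        _ ≤ 1 * (b * R * (b + τ)) := by gcongr
        _ ≤ R * (b + τ) ^ 2 := by linarith
    calc _ ≤ (R / (b + τ)) ^ 2 := by gcongr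
      _ = _ := by rw [div_pow, mul_one_div]
  have heq : (-b * (b + τ) - (1 - r) * b * ((1 - δ) * R)) / (b + τ) ^ 2 =
      -(b / (b + τ) + (1 - r) * b * ((1 - δ) * R) / (b + τ) ^ 2) := by
    field_simp
    ring
  rw [heq, neg_sq]
  set A := b / (b + τ)
  set B := (1 - r) * b * ((1 - δ) * R) / (b + τ) ^ 2
  calc (A + B) ^ 2 * T ≤ (2 * A ^ 2 + 2 * B ^ 2) * T := by
        gcongr
        nlinarith [sq_nonneg (A - B)]
    _ ≤ (2 * 1 + 2 * (R ^ 2 * (1 / (b + τ) ^ 2))) * T := by gcongr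
    _ = 2 * T + 2 * (1 / (b + τ) ^ 2) * (R ^ 2 * T) := by ring
    _ ≤ 2 + 2 * (1 / (b + τ) ^ 2) := by
        rw [hRT]
        linarith

lemma sq_deriv_edgeProfile_snd_le {δ r y : ℝ} (hr : r ∈ Ioo (0:ℝ) 1) (hy : y ∈ Ioo (0:ℝ) 1) :
    ((1 - r) * (1 - 2 * y) * r ^ (1 - δ) / (y * (1 - y) + r ^ (1 - δ)) ^ 2) ^ 2 ≤
      1 / (y * (1 - y) + r ^ (1 - δ)) ^ 2 := by
  have hb : 0 < y * (1 - y) := mul_pos hy.1 (by linarith [hy.2])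
  have hτ : 0 < r ^ (1 - δ) := Real.rpow_pos_of_pos hr.1 _
  set τ := r ^ (1 - δ)
  have h1 : ((1 - r) * (1 - 2 * y)) ^ 2 ≤ 1 := by
    rw [mul_pow]
    refine mul_le_one₀ ?_ (sq_nonneg _) ?_
    · nlinarith [hr.1, hr.2]
    · nlinarith
  have h2 : τ ^ 2 ≤ (y * (1 - y) + τ) ^ 2 := by gcongr; linarith
  rw [div_pow, mul_pow, div_le_div_iff₀ (by positivity) (by positivity)]
  calc ((1 - r) * (1 - 2 * y)) ^ 2 * τ ^ 2 * (y * (1 - y) + τ) ^ 2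
      ≤ 1 * (y * (1 - y) + τ) ^ 2 * (y * (1 - y) + τ) ^ 2 := by gcongr
    _ = 1 * ((y * (1 - y) + τ) ^ 2) ^ 2 := by ring

/-- The edge lifting: `c + σ * x.1` is the distance to the edge. -/
def edgeLift (δ c σ : ℝ) (x : ℝ × ℝ) : ℝ := edgeProfile δ (c + σ * x.1) x.2

lemma integrableOn_mul_prod {f g : ℝ → ℝ} (hf : IntegrableOn f (Ioo 0 1))
    (hg : IntegrableOn g (Ioo 0 1)) : IntegrableOn (fun x : ℝ × ℝ => f x.1 * g x.2) Qhat := by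
  rw [IntegrableOn, restrict_Qhat]
  exact hf.mul_prod hg

lemma edgeLift_spec {s δ c σ : ℝ} (hδ0 : 0 < δ) (hδ1 : δ < 1) (hδs : 4 * δ ≤ s)
    (hσ : (c = 0 ∧ σ = 1) ∨ (c = 1 ∧ σ = -1)) : EdgeLift s (edgeLift δ c σ) := by
  have hσ2 : σ ^ 2 = 1 := by rcases hσ with ⟨-, rfl⟩ | ⟨-, rfl⟩ <;> norm_num
  have hr : ∀ t ∈ Ioo (0:ℝ) 1, c + σ * t ∈ Ioo (0:ℝ) 1 := by
    rintro t ⟨h1, h2⟩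
    rcases hσ with ⟨rfl, rfl⟩ | ⟨rfl, rfl⟩ <;> constructor <;> linarith
  have hr' : ∀ t ∈ Icc (0:ℝ) 1, 0 ≤ c + σ * t := by
    rintro t ⟨h1, h2⟩
    rcases hσ with ⟨rfl, rfl⟩ | ⟨rfl, rfl⟩ <;> linarith
  have hw : ∀ p, ∀ t ∈ Ioo (0:ℝ) 1, (c + σ * t) ^ (-p) ≤ endWeight p t := by
    intro p t ht
    have h1 : endWeight p (c + σ * t) = endWeight p t := by
      rcases hσ with ⟨rfl, rfl⟩ | ⟨rfl, rfl⟩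
      · simp
      · rw [← endWeight_one_sub p t]
        congr 1
        ring
    rw [← h1]
    exact rpow_neg_le_endWeight (hr t ht)
  have hdiffAt : ∀ x ∈ Qhat, DifferentiableAt ℝ (edgeLift δ c σ) x := by
    intro x hx
    have h1 := hr x.1 hx.1
    have h2 : 0 < x.2 * (1 - x.2) := mul_pos hx.2.1 (by linarith [hx.2.2])
    have h3 : DifferentiableAt ℝ (fun x : ℝ × ℝ => (c + σ * x.1) ^ (1 - δ)) x :=
      DifferentiableAt.rpow_const (by fun_prop) (Or.inl h1.1.ne')
    have h4 := Real.rpow_pos_of_pos h1.1 (1 - δ)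
    have h5 : DifferentiableAt ℝ (fun x : ℝ × ℝ => (1 - (c + σ * x.1)) * (x.2 * (1 - x.2))) x := by
      fun_prop
    have h6 : DifferentiableAt ℝ (fun x : ℝ × ℝ => x.2 * (1 - x.2)) x := by fun_prop
    have h7 : x.2 * (1 - x.2) + (c + σ * x.1) ^ (1 - δ) ≠ 0 := by positivity
    have h8 := h5.mul ((h6.fun_add h3).fun_inv h7)
    exact h8
  have hcont : ContinuousOn (edgeLift δ c σ) (closure Qhat \ corners) := by
    refine ContinuousOn.div (by fun_prop) ?_ ?_
    · refine Continuous.continuousOn (Continuous.add (by fun_prop) ?_)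
      exact Continuous.rpow_const (by fun_prop) fun x => Or.inr (by linarith)
    · rintro ⟨a, b⟩ ⟨hx, hxc⟩
      rw [closure_Qhat] at hx
      obtain ⟨⟨ha0, ha1⟩, hb0, hb1⟩ := hx
      simp only at ha0 ha1 hb0 hb1 ⊢
      have p1 : 0 ≤ b * (1 - b) := mul_nonneg hb0 (by linarith)
      have p2 := Real.rpow_nonneg (hr' a ⟨ha0, ha1⟩) (1 - δ)
      intro h0
      have h1 : b * (1 - b) = 0 := by linarith
      have h2 : (c + σ * a) ^ (1 - δ) = 0 := by linarith
      rw [Real.rpow_eq_zero (hr' a ⟨ha0, ha1⟩) (by linarith)] at h2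
      refine hxc ?_
      have hb : b = 0 ∨ b = 1 := by
        rcases mul_eq_zero.1 h1 with h | h
        · exact Or.inl h
        · exact Or.inr (by linarith)
      have ha : a = 0 ∨ a = 1 := by
        rcases hσ with ⟨rfl, rfl⟩ | ⟨rfl, rfl⟩
        · exact Or.inl (by linarith)
        · exact Or.inr (by linarith)
      rcases ha with rfl | rfl <;> rcases hb with rfl | rfl <;> simp [corners]
  have hpd1 : ∀ x ∈ Qhat, pd1 (edgeLift δ c σ) x ^ 2 * (c + σ * x.1) ^ (2 * δ) ≤
      2 + 2 * (1 / (x.2 * (1 - x.2) + (c + σ * x.1) ^ (1 - δ)) ^ 2) := by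
    intro x hx
    have h1 : HasDerivAt (fun t => c + σ * t) σ x.1 := by
      simpa using ((hasDerivAt_id x.1).const_mul σ).const_add c
    have h2 := (hasDerivAt_edgeProfile_fst (δ := δ) (hr x.1 hx.1).1 hx.2).comp x.1 h1
    rw [pd1_eq_of_hasDerivAt (hdiffAt x hx) h2, mul_pow, hσ2, mul_one]
    exact sq_deriv_edgeProfile_fst_le hδ0 hδ1 (hr x.1 hx.1) hx.2
  have hpd2 : ∀ x ∈ Qhat, pd2 (edgeLift δ c σ) x ^ 2 ≤
      1 / (x.2 * (1 - x.2) + (c + σ * x.1) ^ (1 - δ)) ^ 2 := by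
    intro x hx
    rw [pd2_eq_of_hasDerivAt (hdiffAt x hx)
      (hasDerivAt_edgeProfile_snd (δ := δ) (hr x.1 hx.1).1 hx.2)]
    exact sq_deriv_edgeProfile_snd_le (hr x.1 hx.1) hx.2
  have hM : ∀ x ∈ Qhat, 1 / (x.2 * (1 - x.2) + (c + σ * x.1) ^ (1 - δ)) ^ 2 ≤
      endWeight (1 - δ ^ 2) x.1 * (2 * endWeight (1 - δ) x.2) := by
    intro x hx
    refine (inv_sq_le_rpow hδ0 hδ1 (hr x.1 hx.1) hx.2).trans ?_
    exact mul_le_mul_of_nonneg_right (hw _ x.1 hx.1)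
      (mul_nonneg zero_le_two (endWeight_nonneg hx.2))
  have hMi : IntegrableOn (fun x : ℝ × ℝ => endWeight (1 - δ ^ 2) x.1 *
      (2 * endWeight (1 - δ) x.2)) Qhat :=
    integrableOn_mul_prod (integrableOn_endWeight (by nlinarith))
      ((integrableOn_endWeight (by linarith)).const_mul 2)
  have hfin : IsFiniteMeasure (volume.restrict Qhat) :=
    ⟨by simpa using isBounded_Qhat.measure_lt_top⟩
  refine ⟨fun x hx => (hdiffAt x hx).differentiableWithinAt, hcont,
    fun x hx => abs_edgeProfile_le_one (hr x.1 hx.1) hx.2, ?_, ?_, ?_⟩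
  · refine Integrable.mono' ((integrable_const (2:ℝ)).add (hMi.const_mul 2)) ?_ ?_
    · refine ((measurable_pd1 _).pow_const 2).aestronglyMeasurable.mul
        (AEStronglyMeasurable.inv₀ ?_)
      exact (ContinuousOn.comp (continuousOn_endWeight _) continuous_fst.continuousOn
        fun x hx => hx.1).aestronglyMeasurable measurableSet_Qhat
    · filter_upwards [ae_restrict_mem measurableSet_Qhat] with x hx
      have h1 := (hr x.1 hx.1).1
      have h2 : (c + σ * x.1) ^ (-(s / 2)) ≤ endWeight (s / 2) x.1 := hw _ _ hx.1
      have h3 : 0 < (c + σ * x.1) ^ (-(s / 2)) := Real.rpow_pos_of_pos h1 _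
      have h4 : (endWeight (s / 2) x.1)⁻¹ ≤ (c + σ * x.1) ^ (2 * δ) := by
        calc (endWeight (s / 2) x.1)⁻¹ ≤ ((c + σ * x.1) ^ (-(s / 2)))⁻¹ := by gcongr
          _ = (c + σ * x.1) ^ (s / 2) := by rw [Real.rpow_neg h1.le, inv_inv]
          _ ≤ (c + σ * x.1) ^ (2 * δ) :=
              Real.rpow_le_rpow_of_exponent_ge h1 (hr x.1 hx.1).2.le (by linarith)
      rw [Real.norm_eq_abs, abs_of_nonneg (div_nonneg (sq_nonneg _) (endWeight_nonneg hx.1)),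
        div_eq_mul_inv]
      calc pd1 (edgeLift δ c σ) x ^ 2 * (endWeight (s / 2) x.1)⁻¹
          ≤ pd1 (edgeLift δ c σ) x ^ 2 * (c + σ * x.1) ^ (2 * δ) := by gcongr
        _ ≤ 2 + 2 * (endWeight (1 - δ ^ 2) x.1 * (2 * endWeight (1 - δ) x.2)) :=
            (hpd1 x hx).trans (by linarith [hM x hx])
  · refine Integrable.mono' hMi ((measurable_pd2 _).pow_const 2).aestronglyMeasurable ?_
    filter_upwards [ae_restrict_mem measurableSet_Qhat] with x hx
    rw [Real.norm_eq_abs, abs_of_nonneg (sq_nonneg _)]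
    exact (hpd2 x hx).trans (hM x hx)
  · intro t ht
    by_cases hint : IntegrableOn (fun y => pd2 (edgeLift δ c σ) (t, y)) (Ioo 0 1)
    · rw [← intervalIntegrable_iff_integrableOn_Ioo_of_le zero_le_one] at hint
      rw [← integral_Ioc_eq_integral_Ioo, ← intervalIntegral.integral_of_le zero_le_one,
        intervalIntegral.integral_eq_sub_of_hasDerivAt_of_le zero_le_one
          (f := fun y => edgeLift δ c σ (t, y)) ?_ ?_ hint]
      · simp [edgeLift, edgeProfile]
      · refine hcont.comp (by fun_prop) fun y hy => ⟨?_, ?_⟩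
        · rw [closure_Qhat]
          exact ⟨Ioo_subset_Icc_self ht, hy⟩
        · have h1 := ht.1.ne'
          have h2 := ht.2.ne
          simp [corners, h1, h2]
      · intro y hy
        exact hasDerivAt_pd2 (x := (t, y)) (hdiffAt _ ⟨ht, hy⟩)
    · exact integral_undef hint

lemma edgeValues_left {δ : ℝ} (hδ1 : δ < 1) : EdgeValues (edgeLift δ 0 1) 1 0 0 0 := by
  constructor
  · intro t ht
    have hb : 0 < t * (1 - t) := mul_pos ht.1 (by linarith [ht.2])
    simp only [edgeLift, edgeProfile, zero_add, mul_zero, sub_zero, one_mul]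
    rw [Real.zero_rpow (by linarith), add_zero, div_self hb.ne']
  all_goals intro t ht; simp [edgeLift, edgeProfile]

lemma edgeValues_right {δ : ℝ} (hδ1 : δ < 1) : EdgeValues (edgeLift δ 1 (-1)) 0 1 0 0 := by
  constructor
  · intro t ht
    simp [edgeLift, edgeProfile]
  · intro t ht
    have hb : 0 < t * (1 - t) := mul_pos ht.1 (by linarith [ht.2])
    simp only [edgeLift, edgeProfile]
    norm_num
    rw [Real.zero_rpow (by linarith), add_zero, div_self hb.ne']
  all_goals intro t ht; simp [edgeLift, edgeProfile]

lemma exists_edgeLift {s : ℝ} (hs0 : 0 < s) (hs : s ≤ 1 / 2) :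
    (∃ φ, EdgeLift s φ ∧ EdgeValues φ 1 0 0 0) ∧ ∃ φ, EdgeLift s φ ∧ EdgeValues φ 0 1 0 0 :=
  ⟨⟨edgeLift (s / 8) 0 1, edgeLift_spec (by linarith) (by linarith) (by linarith)
      (Or.inl ⟨rfl, rfl⟩), edgeValues_left (by linarith)⟩,
    ⟨edgeLift (s / 8) 1 (-1), edgeLift_spec (by linarith) (by linarith) (by linarith)
      (Or.inr ⟨rfl, rfl⟩), edgeValues_right (by linarith)⟩⟩

/-- The integrand of the two-dimensional Gagliardo seminorm. -/
def gagKernel (s : ℝ) (u : ℝ × ℝ → ℝ) (x y : ℝ × ℝ) : ℝ :=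
  (u x - u y) ^ 2 / ((x.1 - y.1) ^ 2 + (x.2 - y.2) ^ 2) ^ ((2 + 2 * s) / 2)

lemma gagKernel_nonneg (s : ℝ) (u : ℝ × ℝ → ℝ) (x y : ℝ × ℝ) : 0 ≤ gagKernel s u x y := by
  unfold gagKernel
  positivity

lemma sq_sub_le_mul_gagKernel {s r : ℝ} (hs0 : 0 < s) (hs : s ≤ 1 / 2) (hr : 0 ≤ r)
    {u : ℝ × ℝ → ℝ} {x y : ℝ × ℝ} (h1 : |x.1 - y.1| ≤ r) (h2 : |x.2 - y.2| ≤ r) :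
    (u x - u y) ^ 2 ≤ 4 * r ^ (2 + 2 * s) * gagKernel s u x y := by
  have e1 : (x.1 - y.1) ^ 2 ≤ r ^ 2 := sq_le_sq' (abs_le.1 h1).1 (abs_le.1 h1).2
  have e2 : (x.2 - y.2) ^ 2 ≤ r ^ 2 := sq_le_sq' (abs_le.1 h2).1 (abs_le.1 h2).2
  rcases (add_nonneg (sq_nonneg (x.1 - y.1)) (sq_nonneg (x.2 - y.2))).eq_or_lt with h0 | h0
  · have g1 : x.1 = y.1 := by nlinarith [sq_nonneg (x.1 - y.1), sq_nonneg (x.2 - y.2)]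
    have g2 : x.2 = y.2 := by nlinarith [sq_nonneg (x.1 - y.1), sq_nonneg (x.2 - y.2)]
    have : x = y := Prod.ext g1 g2
    rw [this, sub_self, zero_pow two_ne_zero]
    exact mul_nonneg (by positivity) (gagKernel_nonneg _ _ _ _)
  · have hp := Real.rpow_pos_of_pos h0 ((2 + 2 * s) / 2)
    have hle : ((x.1 - y.1) ^ 2 + (x.2 - y.2) ^ 2) ^ ((2 + 2 * s) / 2) ≤ 4 * r ^ (2 + 2 * s) := by
      calc _ ≤ (2 * r ^ 2) ^ ((2 + 2 * s) / 2) :=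
            Real.rpow_le_rpow h0.le (by linarith) (by linarith)
        _ = 2 ^ ((2 + 2 * s) / 2) * r ^ (2 + 2 * s) := by
            rw [Real.mul_rpow (by norm_num) (by positivity), ← Real.rpow_natCast r 2,
              ← Real.rpow_mul hr]
            congr 2
            push_cast
            ring
        _ ≤ 4 * r ^ (2 + 2 * s) := by
            gcongr
            calc (2:ℝ) ^ ((2 + 2 * s) / 2) ≤ 2 ^ (2:ℝ) :=
                  Real.rpow_le_rpow_of_exponent_le (by norm_num) (by linarith)
              _ = 4 := by norm_num
    calc (u x - u y) ^ 2 = ((x.1 - y.1) ^ 2 + (x.2 - y.2) ^ 2) ^ ((2 + 2 * s) / 2) *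
          gagKernel s u x y := by
          rw [gagKernel, mul_div_cancel₀ _ hp.ne']
      _ ≤ _ := mul_le_mul_of_nonneg_right hle (gagKernel_nonneg _ _ _ _)

lemma le_volume_inter_Ioo {a r : ℝ} (ha : a ∈ Ioo (0:ℝ) 1) (hr0 : 0 < r) (hr : r ≤ 1) :
    r ≤ volume.real (Ioo 0 1 ∩ Ioo (a - r) (a + r)) := by
  rw [Ioo_inter_Ioo, Measure.real, Real.volume_Ioo, ENNReal.toReal_ofReal']
  refine le_max_of_le_left ?_
  rcases le_total 0 (a - r) with h1 | h1 <;> rcases le_total 1 (a + r) with h2 | h2 <;>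
    simp [h1, h2] <;> linarith [ha.1, ha.2]

/-- A pointwise bound of Hardy type. -/
lemma sq_mul_rpow_le {s ρ : ℝ} (hs0 : 0 < s) (hs : s ≤ 1 / 2) (hρ : ρ ∈ Ioo (0:ℝ) 1)
    {u : ℝ × ℝ → ℝ} (hu : IntegrableOn (fun x => u x ^ 2) Qhat) {x : ℝ × ℝ} (hx : x ∈ Qhat)
    (hK : IntegrableOn (gagKernel s u x) Qhat) :
    u x ^ 2 * ρ ^ (-(s / 2)) ≤ 8 * (∫ y in Qhat, gagKernel s u x y) +
      2 * (∫ y in Qhat, u y ^ 2) * ρ ^ (-((1 + s) / 2)) := by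
  obtain ⟨r, hr0, hr1, hrs, hrt, hrw⟩ : ∃ r : ℝ, 0 < r ∧ r ≤ 1 ∧
      ρ ^ (-(s / 2)) = r ^ (-(2 * s)) ∧ ρ ^ (-((1 + s) / 2)) = r ^ (-(2 * s)) * (r ^ 2)⁻¹ ∧
      r ^ (2 + 2 * s) * r ^ (-(2 * s)) * (r ^ 2)⁻¹ = 1 := by
    refine ⟨ρ ^ (1 / 4 : ℝ), Real.rpow_pos_of_pos hρ.1 _,
      Real.rpow_le_one hρ.1.le hρ.2.le (by norm_num), ?_, ?_, ?_⟩
    · rw [← Real.rpow_mul hρ.1.le]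
      congr 1
      ring
    · rw [← Real.rpow_natCast, ← Real.rpow_mul hρ.1.le, ← Real.rpow_mul hρ.1.le,
        ← Real.rpow_neg hρ.1.le, ← Real.rpow_add hρ.1]
      congr 1
      push_cast
      ring
    · rw [← Real.rpow_natCast, ← Real.rpow_mul hρ.1.le, ← Real.rpow_mul hρ.1.le,
        ← Real.rpow_mul hρ.1.le, ← Real.rpow_neg hρ.1.le, ← Real.rpow_add hρ.1,
        ← Real.rpow_add hρ.1]
      convert Real.rpow_zero ρ using 2
      push_cast
      ring
  set B : Set (ℝ × ℝ) := (Ioo 0 1 ∩ Ioo (x.1 - r) (x.1 + r)) ×ˢ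
    (Ioo 0 1 ∩ Ioo (x.2 - r) (x.2 + r)) with hB
  have hBQ : B ⊆ Qhat := prod_mono inter_subset_left inter_subset_left
  have hBm : MeasurableSet B := (measurableSet_Ioo.inter measurableSet_Ioo).prod
    (measurableSet_Ioo.inter measurableSet_Ioo)
  have hvol : r ^ 2 ≤ volume.real B := by
    rw [hB, Measure.volume_eq_prod, measureReal_prod_prod, sq]
    exact mul_le_mul (le_volume_inter_Ioo hx.1 hr0 hr1) (le_volume_inter_Ioo hx.2 hr0 hr1) hr0.le
      measureReal_nonneg
  have hBfin : volume B < ⊤ := (isBounded_Qhat.subset hBQ).measure_lt_top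
  have hi : IntegrableOn (fun y => 8 * r ^ (2 + 2 * s) * gagKernel s u x y + 2 * u y ^ 2) Qhat :=
    (hK.const_mul _).add (hu.const_mul _)
  have h1 : r ^ 2 * u x ^ 2 ≤ 8 * r ^ (2 + 2 * s) * (∫ y in Qhat, gagKernel s u x y) +
      2 * ∫ y in Qhat, u y ^ 2 := by
    calc r ^ 2 * u x ^ 2 ≤ volume.real B * u x ^ 2 := by gcongr
      _ = ∫ _ in B, u x ^ 2 := by rw [setIntegral_const, smul_eq_mul]
      _ ≤ ∫ y in B, (8 * r ^ (2 + 2 * s) * gagKernel s u x y + 2 * u y ^ 2) := by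
          refine setIntegral_mono_on (integrableOn_const hBfin.ne) (hi.mono_set hBQ) hBm
            fun y hy => ?_
          have h1 : |x.1 - y.1| ≤ r := abs_le.2 ⟨by linarith [hy.1.2.2], by linarith [hy.1.2.1]⟩
          have h2 : |x.2 - y.2| ≤ r := abs_le.2 ⟨by linarith [hy.2.2.2], by linarith [hy.2.2.1]⟩
          have h3 := sq_sub_le_mul_gagKernel hs0 hs hr0.le (u := u) h1 h2
          nlinarith [sq_nonneg (u x - 2 * u y)]
      _ ≤ ∫ y in Qhat, (8 * r ^ (2 + 2 * s) * gagKernel s u x y + 2 * u y ^ 2) := by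
          refine setIntegral_mono_set hi (Filter.Eventually.of_forall fun y => ?_)
            (Filter.Eventually.of_forall hBQ)
          have := gagKernel_nonneg s u x y
          simp only [Pi.zero_apply]
          positivity
      _ = _ := by
          rw [integral_add (hK.const_mul _) (hu.const_mul _), integral_const_mul,
            integral_const_mul]
  have hq : 0 < r ^ (-(2 * s)) * (r ^ 2)⁻¹ := by
    have := Real.rpow_pos_of_pos hr0 (-(2 * s))
    positivity
  have h2 := mul_le_mul_of_nonneg_left h1 hq.le
  rw [hrs, hrt]
  have h3 : r ^ (-(2 * s)) * (r ^ 2)⁻¹ * (r ^ 2 * u x ^ 2) = u x ^ 2 * r ^ (-(2 * s)) := by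
    field_simp
  calc u x ^ 2 * r ^ (-(2 * s)) ≤ _ := h3.symm.le.trans h2
    _ = 8 * (r ^ (2 + 2 * s) * r ^ (-(2 * s)) * (r ^ 2)⁻¹) * (∫ y in Qhat, gagKernel s u x y) +
        2 * (∫ y in Qhat, u y ^ 2) * (r ^ (-(2 * s)) * (r ^ 2)⁻¹) := by ring
    _ = _ := by rw [hrw, mul_one]

/-- Weighted `L²` bound of Hardy type for functions in `H^s`. -/
lemma integrableOn_sq_mul_endWeight {s : ℝ} (hs0 : 0 < s) (hs : s ≤ 1 / 2) {u : ℝ × ℝ → ℝ}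
    (hm : AEStronglyMeasurable u (volume.restrict Qhat))
    (hu : IntegrableOn (fun x => u x ^ 2) Qhat)
    (hK : IntegrableOn (fun q : (ℝ × ℝ) × (ℝ × ℝ) => gagKernel s u q.1 q.2) (Qhat ×ˢ Qhat)) :
    IntegrableOn (fun x => u x ^ 2 * endWeight (s / 2) x.1) Qhat ∧
    ∫ x in Qhat, u x ^ 2 * endWeight (s / 2) x.1 ≤ 16 * gag2Sq s Qhat u +
      2 * (∫ x in Qhat, endWeight ((1 + s) / 2) x.1) * ∫ x in Qhat, u x ^ 2 := by
  rw [IntegrableOn, Measure.volume_eq_prod, ← Measure.prod_restrict] at hK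
  have hG : IntegrableOn (fun x => ∫ y in Qhat, gagKernel s u x y) Qhat := hK.integral_prod_left
  have hw : IntegrableOn (fun x : ℝ × ℝ => endWeight ((1 + s) / 2) x.1) Qhat := by
    have := integrableOn_mul_prod (integrableOn_endWeight (p := (1 + s) / 2) (by linarith))
      (g := fun _ => 1) (integrableOn_const (by simp))
    simpa using this
  have hb : ∀ᵐ x ∂volume.restrict Qhat, u x ^ 2 * endWeight (s / 2) x.1 ≤
      16 * (∫ y in Qhat, gagKernel s u x y) +
        2 * (∫ y in Qhat, u y ^ 2) * endWeight ((1 + s) / 2) x.1 := by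
    filter_upwards [ae_restrict_mem measurableSet_Qhat, hK.prod_right_ae] with x hx hKx
    have h1 := sq_mul_rpow_le hs0 hs hx.1 hu hx hKx
    have h2 := sq_mul_rpow_le hs0 hs (ρ := 1 - x.1)
      ⟨by linarith [hx.1.2], by linarith [hx.1.1]⟩ hu hx hKx
    simp only [endWeight]
    linarith
  have hbi : IntegrableOn (fun x => 16 * (∫ y in Qhat, gagKernel s u x y) +
      2 * (∫ y in Qhat, u y ^ 2) * endWeight ((1 + s) / 2) x.1) Qhat :=
    (hG.const_mul _).add (hw.const_mul _)
  have hint : IntegrableOn (fun x => u x ^ 2 * endWeight (s / 2) x.1) Qhat := by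
    refine Integrable.mono' hbi ((hm.pow 2).mul ?_) ?_
    · exact (ContinuousOn.comp (continuousOn_endWeight _) continuous_fst.continuousOn
        fun x hx => hx.1).aestronglyMeasurable measurableSet_Qhat
    · filter_upwards [hb, ae_restrict_mem measurableSet_Qhat] with x h1 hx
      rwa [Real.norm_eq_abs, abs_of_nonneg (mul_nonneg (sq_nonneg _) (endWeight_nonneg hx.1))]
  refine ⟨hint, (integral_mono_ae hint hbi hb).trans (le_of_eq ?_)⟩
  rw [integral_add (hG.const_mul _) (hw.const_mul _), integral_const_mul, integral_const_mul]
  simp only [gag2Sq, gagKernel]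
  ring

/-- The integrand of the anisotropic seminorm. -/
def slKernel (s : ℝ) (u : ℝ × ℝ → ℝ) (a b c : ℝ) : ℝ :=
  (u (a, b) - u (a, c)) ^ 2 / |b - c| ^ (1 + 2 * s)

lemma slKernel_nonneg (s : ℝ) (u : ℝ × ℝ → ℝ) (a b c : ℝ) : 0 ≤ slKernel s u a b c := by
  unfold slKernel
  positivity

/-- The integrand obtained by averaging a difference on a vertical slice over nearby points. -/
def avgKernel (s : ℝ) (u : ℝ × ℝ → ℝ) (a b c : ℝ) (z : ℝ × ℝ) : ENNReal :=
  {z : ℝ × ℝ | |a - z.1| < |b - c| ∧ |b - z.2| < |b - c| ∧ |c - z.2| < |b - c|}.indicator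
    (fun z => ENNReal.ofReal (2 * (u (a, b) - u z) ^ 2 * |b - c| ^ (-(3 + 2 * s)))) z

lemma measurable_avgKernel {s : ℝ} {u : ℝ × ℝ → ℝ} (hu : Measurable u) :
    Measurable (fun p : (ℝ × ℝ × ℝ) × ℝ × ℝ => avgKernel s u p.1.1 p.1.2.1 p.1.2.2 p.2) := by
  have : (fun p : (ℝ × ℝ × ℝ) × ℝ × ℝ => avgKernel s u p.1.1 p.1.2.1 p.1.2.2 p.2) =
      {p : (ℝ × ℝ × ℝ) × ℝ × ℝ | |p.1.1 - p.2.1| < |p.1.2.1 - p.1.2.2| ∧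
        |p.1.2.1 - p.2.2| < |p.1.2.1 - p.1.2.2| ∧
        |p.1.2.2 - p.2.2| < |p.1.2.1 - p.1.2.2|}.indicator
      (fun p => ENNReal.ofReal (2 * (u (p.1.1, p.1.2.1) - u p.2) ^ 2 *
        |p.1.2.1 - p.1.2.2| ^ (-(3 + 2 * s)))) := by
    ext p
    simp only [avgKernel, indicator, mem_ofPred_eq]
  rw [this]
  refine Measurable.indicator (by fun_prop) ?_
  have m0 : Measurable fun p : (ℝ × ℝ × ℝ) × ℝ × ℝ => |p.1.2.1 - p.1.2.2| := by fun_prop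
  have m1 : Measurable fun p : (ℝ × ℝ × ℝ) × ℝ × ℝ => |p.1.1 - p.2.1| := by fun_prop
  have m2 : Measurable fun p : (ℝ × ℝ × ℝ) × ℝ × ℝ => |p.1.2.1 - p.2.2| := by fun_prop
  have m3 : Measurable fun p : (ℝ × ℝ × ℝ) × ℝ × ℝ => |p.1.2.2 - p.2.2| := by fun_prop
  exact (measurableSet_lt m1 m0).inter ((measurableSet_lt m2 m0).inter (measurableSet_lt m3 m0))

lemma ofReal_slKernel_le {s : ℝ} {u : ℝ × ℝ → ℝ} {a b c : ℝ}
    (ha : a ∈ Ioo (0:ℝ) 1) (hb : b ∈ Ioo (0:ℝ) 1) (hc : c ∈ Ioo (0:ℝ) 1) :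
    ENNReal.ofReal (slKernel s u a b c) ≤
      ∫⁻ z in Qhat, (avgKernel s u a b c z + avgKernel s u a c b z) := by
  rcases eq_or_ne b c with h | h
  · simp [slKernel, h]
  set t := |b - c| with ht
  have ht0 : 0 < t := abs_pos.2 (sub_ne_zero.2 h)
  have ht1 : t ≤ 1 := abs_le.2 ⟨by linarith [hb.1, hc.2], by linarith [hb.2, hc.1]⟩
  set B : Set (ℝ × ℝ) := (Ioo 0 1 ∩ Ioo (a - t) (a + t)) ×ˢ Ioo (min b c) (max b c) with hB
  have hBQ : B ⊆ Qhat := prod_mono inter_subset_left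
    (Ioo_subset_Ioo (le_min hb.1.le hc.1.le) (max_le hb.2.le hc.2.le))
  have hBm : MeasurableSet B := (measurableSet_Ioo.inter measurableSet_Ioo).prod measurableSet_Ioo
  have hBfin : volume B < ⊤ := (isBounded_Qhat.subset hBQ).measure_lt_top
  have hvol : ENNReal.ofReal (t ^ 2) ≤ volume B := by
    rw [← ENNReal.ofReal_toReal hBfin.ne]
    refine ENNReal.ofReal_le_ofReal ?_
    change t ^ 2 ≤ volume.real B
    rw [hB, Measure.volume_eq_prod, measureReal_prod_prod, sq]
    refine mul_le_mul (le_volume_inter_Ioo ha ht0 ht1) ?_ ht0.le measureReal_nonneg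
    rw [Measure.real, Real.volume_Ioo, ENNReal.toReal_ofReal', max_sub_min_eq_abs]
    exact le_max_of_le_left (by rw [abs_sub_comm])
  have hE : ENNReal.ofReal (slKernel s u a b c) =
      ENNReal.ofReal ((u (a, b) - u (a, c)) ^ 2 * t ^ (-(3 + 2 * s))) *
        ENNReal.ofReal (t ^ 2) := by
    rw [← ENNReal.ofReal_mul (by positivity)]
    congr 1
    rw [mul_assoc, slKernel, ← ht, div_eq_mul_inv, ← Real.rpow_neg ht0.le,
      ← Real.rpow_natCast t 2, ← Real.rpow_add ht0]
    congr 2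
    push_cast
    ring
  rw [hE]
  calc _ ≤ ENNReal.ofReal ((u (a, b) - u (a, c)) ^ 2 * t ^ (-(3 + 2 * s))) * volume B := by gcongr
    _ = ∫⁻ _ in B, ENNReal.ofReal ((u (a, b) - u (a, c)) ^ 2 * t ^ (-(3 + 2 * s))) := by
        rw [setLIntegral_const]
    _ ≤ ∫⁻ z in B, (avgKernel s u a b c z + avgKernel s u a c b z) := by
        refine setLIntegral_mono' hBm fun z hz => ?_
        have z1 : |a - z.1| < t := abs_lt.2 ⟨by linarith [hz.1.2.2], by linarith [hz.1.2.1]⟩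
        have z2 := hz.2.1
        have z3 := hz.2.2
        have z4 : |b - z.2| < t ∧ |c - z.2| < t := by
          rw [ht]
          rcases le_total b c with hbc | hbc
          · rw [min_eq_left hbc] at z2
            rw [max_eq_right hbc] at z3
            rw [abs_of_nonpos (by linarith : b - c ≤ 0), abs_lt, abs_lt]
            refine ⟨⟨?_, ?_⟩, ?_, ?_⟩ <;> linarith
          · rw [min_eq_right hbc] at z2
            rw [max_eq_left hbc] at z3
            rw [abs_of_nonneg (by linarith : 0 ≤ b - c), abs_lt, abs_lt]
            refine ⟨⟨?_, ?_⟩, ?_, ?_⟩ <;> linarith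
        have hcb : |c - b| = t := by rw [abs_sub_comm]
        rw [avgKernel, avgKernel, hcb, ← ht, indicator_of_mem (by exact ⟨z1, z4.1, z4.2⟩),
          indicator_of_mem (by exact ⟨z1, z4.2, z4.1⟩), ← ENNReal.ofReal_add (by positivity) (by positivity)]
        refine ENNReal.ofReal_le_ofReal ?_
        rw [← add_mul]
        refine mul_le_mul_of_nonneg_right ?_ (by positivity)
        nlinarith [sq_nonneg (u (a, b) - u z + (u (a, c) - u z))]
    _ ≤ _ := lintegral_mono_set hBQ

lemma lintegral_rpow_Ioi {s m : ℝ} (hs0 : 0 < s) (hm : 0 < m) :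
    ∫⁻ y, (Ioi m).indicator (fun y => ENNReal.ofReal (y ^ (-(3 + 2 * s)))) y ≤
      ENNReal.ofReal (m ^ (-(2 + 2 * s))) := by
  rw [lintegral_indicator measurableSet_Ioi, ← ofReal_integral_eq_lintegral_ofReal
    (integrableOn_Ioi_rpow_of_lt (by linarith) hm)]
  · refine ENNReal.ofReal_le_ofReal ?_
    rw [integral_Ioi_rpow_of_lt (by linarith) hm, neg_div, ← div_neg]
    rw [show -(3 + 2 * s) + 1 = -(2 + 2 * s) by ring, neg_neg]
    exact div_le_self (Real.rpow_nonneg hm.le _) (by linarith)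
  · filter_upwards [ae_restrict_mem measurableSet_Ioi] with y hy
    exact Real.rpow_nonneg (hm.le.trans (mem_Ioi.1 hy).le) _

lemma lintegral_avgKernel_le {s : ℝ} (hs0 : 0 < s) (hs : s ≤ 1 / 2) {u : ℝ × ℝ → ℝ}
    (a b : ℝ) (z : ℝ × ℝ) :
    ∫⁻ c in Ioo (0:ℝ) 1, avgKernel s u a b c z ≤
      16 * ENNReal.ofReal (gagKernel s u (a, b) z) := by
  set m := max |a - z.1| |b - z.2| with hmdef
  rcases (le_max_of_le_left (abs_nonneg _) : 0 ≤ m).eq_or_lt with h0 | hm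
  · have h1 : a = z.1 := by
      have := (le_max_left |a - z.1| |b - z.2|).trans h0.symm.le
      exact sub_eq_zero.1 (abs_nonpos_iff.1 this)
    have h2 : b = z.2 := by
      have := (le_max_right |a - z.1| |b - z.2|).trans h0.symm.le
      exact sub_eq_zero.1 (abs_nonpos_iff.1 this)
    simp [avgKernel, h1, h2, indicator_apply]
  set f : ℝ → ENNReal := (Ioi m).indicator (fun y => ENNReal.ofReal (y ^ (-(3 + 2 * s)))) with hf
  have hfm : Measurable f := Measurable.indicator (by fun_prop) measurableSet_Ioi
  have hpt : ∀ c, avgKernel s u a b c z ≤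
      ENNReal.ofReal (2 * (u (a, b) - u z) ^ 2) * (f (b - c) + f (c - b)) := by
    intro c
    rw [avgKernel, indicator_apply]
    split_ifs with h
    · have hlt : m < |b - c| := max_lt h.1 h.2.1
      rw [ENNReal.ofReal_mul (by positivity)]
      gcongr
      rcases le_total 0 (b - c) with hbc | hbc
      · rw [abs_of_nonneg hbc] at hlt ⊢
        exact le_add_of_le_of_nonneg (by rw [hf, indicator_of_mem (mem_Ioi.2 hlt)]) (zero_le)
      · rw [abs_of_nonpos hbc, neg_sub] at hlt ⊢
        exact le_add_of_nonneg_of_le (zero_le) (by rw [hf, indicator_of_mem (mem_Ioi.2 hlt)])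
    · exact zero_le
  calc ∫⁻ c in Ioo (0:ℝ) 1, avgKernel s u a b c z ≤ ∫⁻ c, avgKernel s u a b c z :=
        setLIntegral_le_lintegral _ _
    _ ≤ ∫⁻ c, ENNReal.ofReal (2 * (u (a, b) - u z) ^ 2) * (f (b - c) + f (c - b)) :=
        lintegral_mono hpt
    _ = ENNReal.ofReal (2 * (u (a, b) - u z) ^ 2) * ((∫⁻ c, f c) + ∫⁻ c, f c) := by
        rw [lintegral_const_mul _ (by fun_prop), lintegral_add_left (by fun_prop),
          lintegral_sub_left_eq_self f b, lintegral_sub_right_eq_self f b]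
    _ ≤ ENNReal.ofReal (2 * (u (a, b) - u z) ^ 2) *
        (ENNReal.ofReal (m ^ (-(2 + 2 * s))) + ENNReal.ofReal (m ^ (-(2 + 2 * s)))) := by
        gcongr <;> exact lintegral_rpow_Ioi hs0 hm
    _ = ENNReal.ofReal (2 * (u (a, b) - u z) ^ 2 * (2 * m ^ (-(2 + 2 * s)))) := by
        rw [← ENNReal.ofReal_add (by positivity) (by positivity),
          ← ENNReal.ofReal_mul (by positivity), two_mul (m ^ _)]
    _ ≤ ENNReal.ofReal (16 * gagKernel s u (a, b) z) := by
        refine ENNReal.ofReal_le_ofReal ?_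
        have h := sq_sub_le_mul_gagKernel hs0 hs hm.le (u := u) (x := (a, b)) (y := z)
          (le_max_left _ _) (le_max_right _ _)
        have hp : m ^ (2 + 2 * s) * m ^ (-(2 + 2 * s)) = 1 := by
          rw [← Real.rpow_add hm, add_neg_cancel, Real.rpow_zero]
        calc _ ≤ 2 * (4 * m ^ (2 + 2 * s) * gagKernel s u (a, b) z) *
              (2 * m ^ (-(2 + 2 * s))) := by gcongr
          _ = 16 * (m ^ (2 + 2 * s) * m ^ (-(2 + 2 * s))) * gagKernel s u (a, b) z := by ring
          _ = _ := by rw [hp, mul_one]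
    _ = _ := by rw [ENNReal.ofReal_mul (by norm_num), ENNReal.ofReal_ofNat]

/-- Lebesgue measure on the unit interval. -/
abbrev μI : Measure ℝ := volume.restrict (Ioo (0:ℝ) 1)

lemma restrict_Qhat_prod_Qhat : (volume : Measure ((ℝ × ℝ) × ℝ × ℝ)).restrict (Qhat ×ˢ Qhat) =
    (volume.restrict Qhat).prod (volume.restrict Qhat) := by
  rw [Measure.prod_restrict, ← Measure.volume_eq_prod]

lemma integrable_slKernel_of_measurable {s : ℝ} (hs0 : 0 < s) (hs : s ≤ 1 / 2) {u : ℝ × ℝ → ℝ}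
    (hu : Measurable u)
    (hK : IntegrableOn (fun q : (ℝ × ℝ) × (ℝ × ℝ) => gagKernel s u q.1 q.2) (Qhat ×ˢ Qhat)) :
    Integrable (fun p : ℝ × ℝ × ℝ => slKernel s u p.1 p.2.1 p.2.2) (μI.prod (μI.prod μI)) := by
  have hmeas : Measurable (fun p : ℝ × ℝ × ℝ => slKernel s u p.1 p.2.1 p.2.2) := by
    unfold slKernel
    fun_prop
  have hW := measurable_avgKernel (s := s) hu
  have hK' : ∫⁻ x in Qhat, ∫⁻ z in Qhat, ENNReal.ofReal (gagKernel s u x z) < ⊤ := by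
    rw [IntegrableOn, restrict_Qhat_prod_Qhat] at hK
    have h := hK.hasFiniteIntegral
    rw [hasFiniteIntegral_iff_ofReal (Filter.Eventually.of_forall
      fun q => gagKernel_nonneg _ _ _ _), lintegral_prod _
        hK.aestronglyMeasurable.aemeasurable.ennreal_ofReal] at h
    exact h
  refine ⟨hmeas.aestronglyMeasurable, ?_⟩
  rw [hasFiniteIntegral_iff_ofReal (Filter.Eventually.of_forall
    fun q => slKernel_nonneg _ _ _ _ _), lintegral_prod _ hmeas.ennreal_ofReal.aemeasurable]
  set J := ∫⁻ a, ∫⁻ b, ∫⁻ c, (∫⁻ z in Qhat, avgKernel s u a b c z) ∂μI ∂μI ∂μI with hJ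
  have hA : Measurable fun p : ℝ × ℝ × ℝ => ∫⁻ z in Qhat, avgKernel s u p.1 p.2.1 p.2.2 z :=
    hW.lintegral_prod_right'
  have hA2 : Measurable fun p : ℝ × ℝ => ∫⁻ c, (∫⁻ z in Qhat, avgKernel s u p.1 p.2 c z) ∂μI :=
    Measurable.lintegral_prod_right' (f := fun q : (ℝ × ℝ) × ℝ =>
      ∫⁻ z in Qhat, avgKernel s u q.1.1 q.1.2 q.2 z)
      (hA.comp (g := fun p : ℝ × ℝ × ℝ => ∫⁻ z in Qhat, avgKernel s u p.1 p.2.1 p.2.2 z)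
        (f := fun q : (ℝ × ℝ) × ℝ => (q.1.1, q.1.2, q.2)) (by fun_prop))
  have hA1 : Measurable fun a => ∫⁻ b, ∫⁻ c, (∫⁻ z in Qhat, avgKernel s u a b c z) ∂μI ∂μI :=
    hA2.lintegral_prod_right'
  have hJ' : ∀ a, ∫⁻ b, ∫⁻ c, (∫⁻ z in Qhat, avgKernel s u a b c z) ∂μI ∂μI =
      ∫⁻ b, ∫⁻ c, (∫⁻ z in Qhat, avgKernel s u a c b z) ∂μI ∂μI := fun a =>
    lintegral_lintegral_swap (f := fun b c => ∫⁻ z in Qhat, avgKernel s u a b c z)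
      (hA.comp (measurable_prodMk_left (x := a))).aemeasurable
  have h1 : ∫⁻ a, ∫⁻ q : ℝ × ℝ, ENNReal.ofReal (slKernel s u a q.1 q.2) ∂(μI.prod μI) ∂μI ≤
      J + J := by
    rw [hJ, ← lintegral_add_left hA1]
    refine setLIntegral_mono' measurableSet_Ioo fun a ha => ?_
    rw [lintegral_prod _ (by
      exact (hmeas.comp (measurable_prodMk_left (x := a))).ennreal_ofReal.aemeasurable)]
    conv_rhs => enter [2]; rw [hJ' a]
    rw [← lintegral_add_left (by exact hA2.comp (measurable_prodMk_left (x := a)))]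
    refine setLIntegral_mono' measurableSet_Ioo fun b hb => ?_
    rw [← lintegral_add_left (by
      exact hA.comp (f := fun c : ℝ => (a, b, c)) (by fun_prop))]
    refine setLIntegral_mono' measurableSet_Ioo fun c hc => ?_
    refine (ofReal_slKernel_le ha hb hc).trans (le_of_eq ?_)
    exact lintegral_add_left (by
      exact hW.comp (f := fun z : ℝ × ℝ => ((a, b, c), z)) (by fun_prop)) _
  have h2 : J ≤ 16 * ∫⁻ x in Qhat, ∫⁻ z in Qhat, ENNReal.ofReal (gagKernel s u x z) := by
    have hgm : Measurable fun q : (ℝ × ℝ) × ℝ × ℝ => ENNReal.ofReal (gagKernel s u q.1 q.2) := by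
      unfold gagKernel
      fun_prop
    have hgm1 : Measurable fun x : ℝ × ℝ =>
        ∫⁻ z in Qhat, ENNReal.ofReal (gagKernel s u x z) := hgm.lintegral_prod_right'
    rw [← lintegral_const_mul' _ _ (by simp)]
    conv_rhs => rw [restrict_Qhat, lintegral_prod _ (by
      rw [← restrict_Qhat]; exact (hgm1.const_mul _).aemeasurable)]
    refine lintegral_mono fun a => lintegral_mono fun b => ?_
    rw [lintegral_lintegral_swap (by
      exact (hW.comp (f := fun q : ℝ × ℝ × ℝ => ((a, b, q.1), q.2)) (by fun_prop)).aemeasurable)]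
    rw [← restrict_Qhat, ← lintegral_const_mul' _ _ (by simp)]
    exact lintegral_mono fun z => lintegral_avgKernel_le hs0 hs a b z
  have h3 : J < ⊤ := h2.trans_lt (ENNReal.mul_lt_top (by simp) hK')
  exact h1.trans_lt (ENNReal.add_lt_top.2 ⟨h3, h3⟩)

lemma integrable_mul_of_sq {α : Type*} [MeasurableSpace α] {μ : Measure α} {f g : α → ℝ}
    (hf : AEStronglyMeasurable f μ) (hg : AEStronglyMeasurable g μ)
    (hf2 : Integrable (fun x => f x ^ 2) μ) (hg2 : Integrable (fun x => g x ^ 2) μ) :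
    Integrable (fun x => f x * g x) μ := by
  refine (hf2.add hg2).mono' (hf.mul hg) (Filter.Eventually.of_forall fun x => ?_)
  rw [Real.norm_eq_abs, abs_le, Pi.add_apply]
  constructor <;> nlinarith [sq_nonneg (f x + g x), sq_nonneg (f x - g x)]

instance isProbabilityMeasure_μI : IsProbabilityMeasure μI := ⟨by simp⟩

lemma measurePreserving_fst_fst : MeasurePreserving (fun p : ℝ × ℝ × ℝ => (p.1, p.2.1))
    (μI.prod (μI.prod μI)) (volume.restrict Qhat) := by
  rw [restrict_Qhat]
  exact (MeasurePreserving.id μI).prod measurePreserving_fst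

lemma measurePreserving_fst_snd : MeasurePreserving (fun p : ℝ × ℝ × ℝ => (p.1, p.2.2))
    (μI.prod (μI.prod μI)) (volume.restrict Qhat) := by
  rw [restrict_Qhat]
  exact (MeasurePreserving.id μI).prod measurePreserving_snd

lemma gagKernel_congr {s : ℝ} {u v : ℝ × ℝ → ℝ} (h : u =ᵐ[volume.restrict Qhat] v) :
    (fun q : (ℝ × ℝ) × ℝ × ℝ => gagKernel s u q.1 q.2) =ᵐ[volume.restrict (Qhat ×ˢ Qhat)]
      fun q => gagKernel s v q.1 q.2 := by
  rw [restrict_Qhat_prod_Qhat]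
  filter_upwards [Measure.quasiMeasurePreserving_fst.ae h,
    Measure.quasiMeasurePreserving_snd.ae h] with q h1 h2
  simp only [gagKernel, h1, h2]

lemma integrable_slKernel {s : ℝ} (hs0 : 0 < s) (hs : s ≤ 1 / 2) {u : ℝ × ℝ → ℝ}
    (hm : AEStronglyMeasurable u (volume.restrict Qhat))
    (hK : IntegrableOn (fun q : (ℝ × ℝ) × (ℝ × ℝ) => gagKernel s u q.1 q.2) (Qhat ×ˢ Qhat)) :
    Integrable (fun p : ℝ × ℝ × ℝ => slKernel s u p.1 p.2.1 p.2.2) (μI.prod (μI.prod μI)) := by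
  refine (integrable_slKernel_of_measurable hs0 hs hm.stronglyMeasurable_mk.measurable
    (hK.congr (gagKernel_congr hm.ae_eq_mk))).congr ?_
  filter_upwards [measurePreserving_fst_fst.quasiMeasurePreserving.ae hm.ae_eq_mk,
    measurePreserving_fst_snd.quasiMeasurePreserving.ae hm.ae_eq_mk] with p h1 h2
  simp only [slKernel, h1, h2]

lemma AH2Semi_eq {s : ℝ} {u : ℝ × ℝ → ℝ}
    (h : Integrable (fun p : ℝ × ℝ × ℝ => slKernel s u p.1 p.2.1 p.2.2) (μI.prod (μI.prod μI))) :
    AH2Semi s u = √(∫ p : ℝ × ℝ × ℝ, slKernel s u p.1 p.2.1 p.2.2 ∂(μI.prod (μI.prod μI))) := by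
  rw [AH2Semi, integral_prod _ h]
  congr 1
  refine integral_congr_ae ?_
  filter_upwards [h.prod_right_ae] with a ha
  rw [integral_prod _ ha]
  rfl

lemma EdgeLift.abs_integral_mul_pd2_le {s : ℝ} (hs0 : 0 < s) (hs : s ≤ 1 / 2) {φ u : ℝ × ℝ → ℝ}
    (hφ : EdgeLift s φ) (hm : AEStronglyMeasurable u (volume.restrict Qhat))
    (hu : IntegrableOn (fun x => u x ^ 2) Qhat)
    (hK : IntegrableOn (fun q : (ℝ × ℝ) × (ℝ × ℝ) => gagKernel s u q.1 q.2) (Qhat ×ˢ Qhat)) :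
    IntegrableOn (fun x => u x * pd2 φ x) Qhat ∧
    |∫ x in Qhat, u x * pd2 φ x| ≤ AH2Semi s u * √(∫ x in Qhat, pd2 φ x ^ 2) := by
  have hS := integrable_slKernel hs0 hs hm hK
  have hpm : AEStronglyMeasurable (pd2 φ) (volume.restrict Qhat) :=
    (measurable_pd2 φ).aestronglyMeasurable
  have hup : IntegrableOn (fun x => u x * pd2 φ x) Qhat :=
    integrable_mul_of_sq hm hpm hu hφ.grad2
  refine ⟨hup, ?_⟩
  set μ := μI.prod (μI.prod μI) with hμ
  have m1 : AEStronglyMeasurable (fun p : ℝ × ℝ × ℝ => u (p.1, p.2.1)) μ :=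
    hm.comp_measurePreserving measurePreserving_fst_fst
  have m2 : AEStronglyMeasurable (fun p : ℝ × ℝ × ℝ => u (p.1, p.2.2)) μ :=
    hm.comp_measurePreserving measurePreserving_fst_snd
  have m3 : AEStronglyMeasurable (fun p : ℝ × ℝ × ℝ => pd2 φ (p.1, p.2.1)) μ :=
    hpm.comp_measurePreserving measurePreserving_fst_fst
  have i3 : Integrable (fun p : ℝ × ℝ × ℝ => pd2 φ (p.1, p.2.1) ^ 2) μ :=
    measurePreserving_fst_fst.integrable_comp_of_integrable hφ.grad2
  have hle : ∀ᵐ p : ℝ × ℝ × ℝ ∂μ, (u (p.1, p.2.1) - u (p.1, p.2.2)) ^ 2 ≤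
      slKernel s u p.1 p.2.1 p.2.2 := by
    have hI1 : ∀ᵐ p : ℝ × ℝ × ℝ ∂μ, (p.1, p.2.1) ∈ Qhat :=
      measurePreserving_fst_fst.quasiMeasurePreserving.ae (ae_restrict_mem measurableSet_Qhat)
    have hI2 : ∀ᵐ p : ℝ × ℝ × ℝ ∂μ, (p.1, p.2.2) ∈ Qhat :=
      measurePreserving_fst_snd.quasiMeasurePreserving.ae (ae_restrict_mem measurableSet_Qhat)
    filter_upwards [hI1, hI2] with p h1 h2
    rcases eq_or_ne p.2.1 p.2.2 with h | h
    · simp [slKernel, h]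
    have h0 : 0 < |p.2.1 - p.2.2| := abs_pos.2 (sub_ne_zero.2 h)
    refine le_div_self (sq_nonneg _) (Real.rpow_pos_of_pos h0 _)
      (Real.rpow_le_one h0.le (abs_le.2 ⟨?_, ?_⟩) (by linarith)) <;>
    linarith [h1.2.1, h1.2.2, h2.2.1, h2.2.2]
  have iD : Integrable (fun p : ℝ × ℝ × ℝ => (u (p.1, p.2.1) - u (p.1, p.2.2)) ^ 2) μ := by
    refine hS.mono' ((m1.sub m2).pow 2) ?_
    filter_upwards [hle] with p hp
    rwa [Real.norm_eq_abs, abs_of_nonneg (sq_nonneg _)]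
  have iDp : Integrable (fun p : ℝ × ℝ × ℝ =>
      (u (p.1, p.2.1) - u (p.1, p.2.2)) * pd2 φ (p.1, p.2.1)) μ :=
    integrable_mul_of_sq (m1.sub m2) m3 iD i3
  have i1 : Integrable (fun p : ℝ × ℝ × ℝ => u (p.1, p.2.1) * pd2 φ (p.1, p.2.1)) μ :=
    measurePreserving_fst_fst.integrable_comp_of_integrable hup
  have i2 : Integrable (fun p : ℝ × ℝ × ℝ => u (p.1, p.2.2) * pd2 φ (p.1, p.2.1)) μ :=
    (i1.sub iDp).congr (Filter.Eventually.of_forall fun p => by simp only [Pi.sub_apply]; ring)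
  have e2 : ∫ p : ℝ × ℝ × ℝ, u (p.1, p.2.2) * pd2 φ (p.1, p.2.1) ∂μ = 0 := by
    rw [hμ, integral_prod _ i2]
    refine integral_eq_zero_of_ae ?_
    filter_upwards [ae_restrict_mem measurableSet_Ioo] with a ha
    have := integral_prod_mul (μ := μI) (ν := μI) (fun b => pd2 φ (a, b)) (fun c => u (a, c))
    rw [hφ.mean a ha, zero_mul] at this
    rw [Pi.zero_apply, ← this]
    exact integral_congr_ae (Filter.Eventually.of_forall fun q => mul_comm _ _)
  have e1 : ∫ p : ℝ × ℝ × ℝ, u (p.1, p.2.1) * pd2 φ (p.1, p.2.1) ∂μ =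
      ∫ x in Qhat, u x * pd2 φ x := by
    rw [← measurePreserving_fst_fst.map_eq, integral_map
      measurePreserving_fst_fst.measurable.aemeasurable (by
        rw [measurePreserving_fst_fst.map_eq]; exact hup.aestronglyMeasurable)]
  have e3 : ∫ p : ℝ × ℝ × ℝ, pd2 φ (p.1, p.2.1) ^ 2 ∂μ = ∫ x in Qhat, pd2 φ x ^ 2 := by
    rw [← measurePreserving_fst_fst.map_eq, integral_map
      measurePreserving_fst_fst.measurable.aemeasurable (by
        rw [measurePreserving_fst_fst.map_eq]; exact hφ.grad2.aestronglyMeasurable)]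
  have e4 : ∫ x in Qhat, u x * pd2 φ x = ∫ p : ℝ × ℝ × ℝ,
      (u (p.1, p.2.1) - u (p.1, p.2.2)) * pd2 φ (p.1, p.2.1) ∂μ := by
    simp only [sub_mul]
    rw [integral_sub i1 i2, e1, e2, sub_zero]
  rw [e4, AH2Semi_eq hS, ← Real.sqrt_mul (integral_nonneg fun p => slKernel_nonneg _ _ _ _ _)]
  refine Real.abs_le_sqrt ((sq_integral_mul_le iD i3 iDp).trans ?_)
  rw [e3]
  exact mul_le_mul_of_nonneg_right (integral_mono_ae iD hS hle)
    (integral_nonneg fun x => sq_nonneg _)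

lemma sqrt_add_le {a b : ℝ} (ha : 0 ≤ a) (hb : 0 ≤ b) : √(a + b) ≤ √a + √b := by
  refine Real.sqrt_le_iff.2 ⟨by positivity, ?_⟩
  nlinarith [Real.sq_sqrt ha, Real.sq_sqrt hb, mul_nonneg (Real.sqrt_nonneg a) (Real.sqrt_nonneg b)]

lemma endWeight_pos {p t : ℝ} (ht : t ∈ Ioo (0:ℝ) 1) : 0 < endWeight p t :=
  add_pos (Real.rpow_pos_of_pos ht.1 _) (Real.rpow_pos_of_pos (by linarith [ht.2]) _)

lemma EdgeLift.abs_integral_mul_pd1_le {s : ℝ} (hs0 : 0 < s) (hs : s ≤ 1 / 2) {φ u : ℝ × ℝ → ℝ}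
    (hφ : EdgeLift s φ) (hm : AEStronglyMeasurable u (volume.restrict Qhat))
    (hu : IntegrableOn (fun x => u x ^ 2) Qhat)
    (hK : IntegrableOn (fun q : (ℝ × ℝ) × (ℝ × ℝ) => gagKernel s u q.1 q.2) (Qhat ×ˢ Qhat)) :
    IntegrableOn (fun x => u x * pd1 φ x) Qhat ∧
    |∫ x in Qhat, u x * pd1 φ x| ≤ (4 + √(2 * ∫ x in Qhat, endWeight ((1 + s) / 2) x.1)) *
      √(∫ x in Qhat, pd1 φ x ^ 2 / endWeight (s / 2) x.1) * HsNorm s u := by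
  obtain ⟨hi, hle⟩ := integrableOn_sq_mul_endWeight hs0 hs hm hu hK
  have hw : AEStronglyMeasurable (fun x : ℝ × ℝ => √(endWeight (s / 2) x.1))
      (volume.restrict Qhat) :=
    (ContinuousOn.comp (continuousOn_endWeight _) continuous_fst.continuousOn
      fun x hx => hx.1).sqrt.aestronglyMeasurable measurableSet_Qhat
  have hf2 : EqOn (fun x => u x ^ 2 * endWeight (s / 2) x.1)
      (fun x => (u x * √(endWeight (s / 2) x.1)) ^ 2) Qhat := fun x hx => by
    simp only [mul_pow, Real.sq_sqrt (endWeight_nonneg hx.1)]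
  have hg2 : EqOn (fun x => pd1 φ x ^ 2 / endWeight (s / 2) x.1)
      (fun x => (pd1 φ x / √(endWeight (s / 2) x.1)) ^ 2) Qhat := fun x hx => by
    simp only [div_pow, Real.sq_sqrt (endWeight_nonneg hx.1)]
  have hfg : EqOn (fun x => u x * √(endWeight (s / 2) x.1) *
      (pd1 φ x / √(endWeight (s / 2) x.1))) (fun x => u x * pd1 φ x) Qhat := fun x hx => by
    have := (Real.sqrt_pos.2 (endWeight_pos (p := s / 2) hx.1)).ne'
    field_simp
  have if2 := hi.congr_fun hf2 measurableSet_Qhat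
  have ig2 := hφ.grad1.congr_fun hg2 measurableSet_Qhat
  have ifg : IntegrableOn (fun x => u x * √(endWeight (s / 2) x.1) *
      (pd1 φ x / √(endWeight (s / 2) x.1))) Qhat :=
    integrable_mul_of_sq (hm.mul hw)
      ((measurable_pd1 φ).aemeasurable.div hw.aemeasurable).aestronglyMeasurable if2 ig2
  refine ⟨ifg.congr_fun hfg measurableSet_Qhat, ?_⟩
  have hcs := sq_integral_mul_le if2 ig2 ifg
  rw [setIntegral_congr_fun measurableSet_Qhat hfg, ← setIntegral_congr_fun measurableSet_Qhat hf2,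
    ← setIntegral_congr_fun measurableSet_Qhat hg2] at hcs
  set A := ∫ x in Qhat, pd1 φ x ^ 2 / endWeight (s / 2) x.1 with hA
  set E := ∫ x in Qhat, endWeight ((1 + s) / 2) x.1 with hE
  set M := ∫ x in Qhat, u x ^ 2 with hM
  have hE0 : 0 ≤ E := setIntegral_nonneg measurableSet_Qhat fun x hx => endWeight_nonneg hx.1
  have hM0 : 0 ≤ M := integral_nonneg fun x => sq_nonneg _
  have hA0 : 0 ≤ A := setIntegral_nonneg measurableSet_Qhat fun x hx =>
    div_nonneg (sq_nonneg _) (endWeight_nonneg hx.1)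
  have hG0 : 0 ≤ gag2Sq s Qhat u :=
    integral_nonneg fun x => integral_nonneg fun y => gagKernel_nonneg s u x y
  have h1 : √(16 * gag2Sq s Qhat u + 2 * E * M) ≤ (4 + √(2 * E)) * HsNorm s u := by
    have h4 : √(16 : ℝ) = 4 := by
      rw [show (16:ℝ) = 4 ^ 2 by norm_num, Real.sqrt_sq (by norm_num)]
    calc _ ≤ √(16 * gag2Sq s Qhat u) + √(2 * E * M) := sqrt_add_le (by positivity) (by positivity)
      _ = 4 * √(gag2Sq s Qhat u) + √(2 * E) * √M := by
        rw [Real.sqrt_mul (by norm_num), Real.sqrt_mul (by positivity), h4]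
      _ ≤ _ := by
        rw [HsNorm, ← hM]
        nlinarith [Real.sqrt_nonneg M, Real.sqrt_nonneg (gag2Sq s Qhat u),
          mul_nonneg (Real.sqrt_nonneg (2 * E)) (Real.sqrt_nonneg (gag2Sq s Qhat u))]
  calc |∫ x in Qhat, u x * pd1 φ x| ≤ √((16 * gag2Sq s Qhat u + 2 * E * M) * A) :=
        Real.abs_le_sqrt (hcs.trans (mul_le_mul_of_nonneg_right hle hA0))
    _ = √(16 * gag2Sq s Qhat u + 2 * E * M) * √A := by rw [Real.sqrt_mul (by positivity)]
    _ ≤ (4 + √(2 * E)) * HsNorm s u * √A := by gcongr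
    _ = _ := by ring

lemma volume_real_Qhat : volume.real Qhat = 1 := by
  rw [Qhat, Measure.volume_eq_prod, measureReal_prod_prod]
  simp

lemma EdgeLift.abs_integral_mul_le {s : ℝ} {φ d : ℝ × ℝ → ℝ} (hφ : EdgeLift s φ)
    (hm : AEStronglyMeasurable d (volume.restrict Qhat))
    (hd : IntegrableOn (fun x => d x ^ 2) Qhat) :
    IntegrableOn (fun x => d x * φ x) Qhat ∧
    |∫ x in Qhat, d x * φ x| ≤ √(∫ x in Qhat, d x ^ 2) := by
  have hφm : AEStronglyMeasurable φ (volume.restrict Qhat) :=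
    hφ.diff.continuousOn.aestronglyMeasurable measurableSet_Qhat
  have h1 : IntegrableOn (fun _ => (1:ℝ)) Qhat :=
    integrableOn_const isBounded_Qhat.measure_lt_top.ne
  have hle : ∀ x ∈ Qhat, φ x ^ 2 ≤ 1 := fun x hx => by
    rw [sq_le_one_iff_abs_le_one]
    exact hφ.bdd x hx
  have hφ2 : IntegrableOn (fun x => φ x ^ 2) Qhat := by
    refine h1.mono' (hφm.pow 2) ?_
    filter_upwards [ae_restrict_mem measurableSet_Qhat] with x hx
    rw [Real.norm_eq_abs, abs_of_nonneg (sq_nonneg _)]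
    exact hle x hx
  have hi : IntegrableOn (fun x => d x * φ x) Qhat := integrable_mul_of_sq hm hφm hd hφ2
  refine ⟨hi, Real.abs_le_sqrt ((sq_integral_mul_le hd hφ2 hi).trans ?_)⟩
  refine mul_le_of_le_one_right (integral_nonneg fun x => sq_nonneg _) ?_
  refine (setIntegral_mono_on hφ2 h1 measurableSet_Qhat hle).trans (le_of_eq ?_)
  rw [setIntegral_const, volume_real_Qhat, one_smul]

lemma HsNorm_nonneg (s : ℝ) (u : ℝ × ℝ → ℝ) : 0 ≤ HsNorm s u :=
  add_nonneg (Real.sqrt_nonneg _) (Real.sqrt_nonneg _)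

lemma AH2Semi_nonneg (s : ℝ) (u : ℝ × ℝ → ℝ) : 0 ≤ AH2Semi s u := Real.sqrt_nonneg _

/-- The Green pairing with an edge lifting is controlled by the anisotropic norms. -/
lemma EdgeLift.exists_abs_pairing_le {s : ℝ} (hs0 : 0 < s) (hs : s ≤ 1 / 2) {φ : ℝ × ℝ → ℝ}
    (hφ : EdgeLift s φ) :
    ∃ C > 0, ∀ u1 u2 dv : ℝ × ℝ → ℝ, AEStronglyMeasurable u1 (volume.restrict Qhat) →
      AEStronglyMeasurable u2 (volume.restrict Qhat) →
      AEStronglyMeasurable dv (volume.restrict Qhat) →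
      IntegrableOn (fun x => u1 x ^ 2) Qhat → IntegrableOn (fun x => u2 x ^ 2) Qhat →
      IntegrableOn (fun x => dv x ^ 2) Qhat →
      IntegrableOn (fun q : (ℝ × ℝ) × (ℝ × ℝ) => gagKernel s u1 q.1 q.2) (Qhat ×ˢ Qhat) →
      IntegrableOn (fun q : (ℝ × ℝ) × (ℝ × ℝ) => gagKernel s u2 q.1 q.2) (Qhat ×ˢ Qhat) →
      IntegrableOn (fun x => u1 x * pd1 φ x + u2 x * pd2 φ x) Qhat ∧
      IntegrableOn (fun x => dv x * φ x) Qhat ∧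
      |pairing u1 u2 dv φ| ≤ C * (HsNorm s u1 + AH2Semi s u2 + √(∫ x in Qhat, dv x ^ 2)) := by
  set A := (4 + √(2 * ∫ x in Qhat, endWeight ((1 + s) / 2) x.1)) *
      √(∫ x in Qhat, pd1 φ x ^ 2 / endWeight (s / 2) x.1) with hA
  set B := √(∫ x in Qhat, pd2 φ x ^ 2) with hB
  have hA0 : 0 ≤ A := by positivity
  have hB0 : 0 ≤ B := Real.sqrt_nonneg _
  refine ⟨A + B + 1, by positivity, fun u1 u2 dv m1 m2 md i1 i2 id k1 k2 => ?_⟩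
  obtain ⟨j1, e1⟩ := hφ.abs_integral_mul_pd1_le hs0 hs m1 i1 k1
  obtain ⟨j2, e2⟩ := hφ.abs_integral_mul_pd2_le hs0 hs m2 i2 k2
  obtain ⟨jd, ed⟩ := hφ.abs_integral_mul_le md id
  refine ⟨j1.add j2, jd, ?_⟩
  rw [pairing, integral_add j1 j2]
  refine (abs_add_three _ _ _).trans ((add_le_add (add_le_add e1 e2) ed).trans ?_)
  have h1 := HsNorm_nonneg s u1
  have h2 := AH2Semi_nonneg s u2
  have h3 := Real.sqrt_nonneg (∫ x in Qhat, dv x ^ 2)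
  nlinarith [mul_nonneg hA0 h1, mul_nonneg hA0 h2, mul_nonneg hA0 h3, mul_nonneg hB0 h1,
    mul_nonneg hB0 h2, mul_nonneg hB0 h3]

/-- If the Gram kernel `⟪v x, v y⟫` of a vector-valued function is measurable on the product, then
all components of `v` are measurable. -/
lemma aestronglyMeasurable_inner_of_gram {α E : Type*} [MeasurableSpace α] {μ : Measure α}
    [SFinite μ] [NormedAddCommGroup E] [InnerProductSpace ℝ E] [FiniteDimensional ℝ E] {v : α → E}
    (h : AEStronglyMeasurable (fun q : α × α => inner ℝ (v q.1) (v q.2)) (μ.prod μ)) (e : E) :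
    AEStronglyMeasurable (fun y => inner ℝ e (v y)) μ := by
  let S : Submodule ℝ E :=
    { carrier := {w | AEStronglyMeasurable (fun y => inner ℝ w (v y)) μ}
      add_mem' := fun {a b} ha hb => by
        simp only [mem_ofPred_eq, inner_add_left] at ha hb ⊢
        exact ha.add hb
      zero_mem' := by
        simp only [mem_ofPred_eq, inner_zero_left]
        exact aestronglyMeasurable_const
      smul_mem' := fun c a ha => by
        simp only [mem_ofPred_eq, real_inner_smul_left] at ha ⊢
        exact ha.const_mul c }
  have hS : ∀ᵐ x ∂μ, v x ∈ S := h.prodMk_left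
  obtain ⟨p, hp, q, hq, rfl⟩ := S.exists_add_mem_mem_orthogonal e
  have hp' : AEStronglyMeasurable (fun y => inner ℝ p (v y)) μ := hp
  refine hp'.congr ?_
  filter_upwards [hS] with y hy
  rw [inner_add_left, S.inner_left_of_mem_orthogonal hy hq, add_zero]

lemma aestronglyMeasurable_of_sq_sub {α : Type*} [MeasurableSpace α] {μ : Measure α}
    [SFinite μ] {u1 u2 : α → ℝ} (h1 : AEStronglyMeasurable (fun x => u1 x ^ 2) μ)
    (h2 : AEStronglyMeasurable (fun x => u2 x ^ 2) μ)
    (h : AEStronglyMeasurable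
      (fun q : α × α => (u1 q.1 - u1 q.2) ^ 2 + (u2 q.1 - u2 q.2) ^ 2) (μ.prod μ)) :
    AEStronglyMeasurable u1 μ ∧ AEStronglyMeasurable u2 μ := by
  have hin : ∀ a b c d : ℝ, inner ℝ !₂[a, b] !₂[c, d] = a * c + b * d := fun a b c d => by
    simp [PiLp.inner_apply, Fin.sum_univ_two, mul_comm]
  have hN := h1.add h2
  have hG : AEStronglyMeasurable
      (fun q : α × α => inner ℝ !₂[u1 q.1, u2 q.1] !₂[u1 q.2, u2 q.2]) (μ.prod μ) := by
    refine ((((hN.comp_quasiMeasurePreserving Measure.quasiMeasurePreserving_fst).add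
      (hN.comp_quasiMeasurePreserving Measure.quasiMeasurePreserving_snd)).sub h).const_mul
      (1 / 2)).congr (Filter.Eventually.of_forall fun q => ?_)
    simp only [hin, Pi.add_apply, Pi.sub_apply, Function.comp_apply]
    ring
  have key := aestronglyMeasurable_inner_of_gram (v := fun x => !₂[u1 x, u2 x]) hG
  constructor
  · simpa [hin] using key !₂[1, 0]
  · simpa [hin] using key !₂[0, 1]

/-- A vector field with finite Gagliardo seminorm is measurable, and both components have finite
seminorm. -/
lemma aestronglyMeasurable_of_gagliardo {s : ℝ} {u1 u2 : ℝ × ℝ → ℝ}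
    (h1 : IntegrableOn (fun x => u1 x ^ 2) Qhat) (h2 : IntegrableOn (fun x => u2 x ^ 2) Qhat)
    (h : IntegrableOn (fun q : (ℝ × ℝ) × (ℝ × ℝ) =>
          ((u1 q.1 - u1 q.2) ^ 2 + (u2 q.1 - u2 q.2) ^ 2) /
            ((q.1.1 - q.2.1) ^ 2 + (q.1.2 - q.2.2) ^ 2) ^ ((2 + 2 * s) / 2)) (Qhat ×ˢ Qhat)) :
    (AEStronglyMeasurable u1 (volume.restrict Qhat) ∧
      AEStronglyMeasurable u2 (volume.restrict Qhat)) ∧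
    IntegrableOn (fun q : (ℝ × ℝ) × (ℝ × ℝ) => gagKernel s u1 q.1 q.2) (Qhat ×ˢ Qhat) ∧
    IntegrableOn (fun q : (ℝ × ℝ) × (ℝ × ℝ) => gagKernel s u2 q.1 q.2) (Qhat ×ˢ Qhat) := by
  have hdm : Measurable fun q : (ℝ × ℝ) × (ℝ × ℝ) =>
      ((q.1.1 - q.2.1) ^ 2 + (q.1.2 - q.2.2) ^ 2) ^ ((2 + 2 * s) / 2) := by fun_prop
  have hm : AEStronglyMeasurable u1 (volume.restrict Qhat) ∧
      AEStronglyMeasurable u2 (volume.restrict Qhat) := by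
    refine aestronglyMeasurable_of_sq_sub h1.aestronglyMeasurable h2.aestronglyMeasurable ?_
    rw [← restrict_Qhat_prod_Qhat]
    refine (h.aestronglyMeasurable.mul hdm.aestronglyMeasurable).congr
      (Filter.Eventually.of_forall fun q => ?_)
    simp only [Pi.mul_apply]
    rcases eq_or_ne q.1 q.2 with hq | hq
    · simp [hq]
    · refine div_mul_cancel₀ _ (Real.rpow_pos_of_pos ?_ _).ne'
      by_contra! hle
      refine hq (Prod.ext ?_ ?_) <;>
        nlinarith [sq_nonneg (q.1.1 - q.2.1), sq_nonneg (q.1.2 - q.2.2)]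
  have hK : ∀ u : ℝ × ℝ → ℝ, AEStronglyMeasurable u (volume.restrict Qhat) →
      AEStronglyMeasurable (fun q : (ℝ × ℝ) × (ℝ × ℝ) => gagKernel s u q.1 q.2)
        (volume.restrict (Qhat ×ˢ Qhat)) := fun u hu => by
    rw [restrict_Qhat_prod_Qhat]
    exact (((hu.comp_quasiMeasurePreserving Measure.quasiMeasurePreserving_fst).sub
      (hu.comp_quasiMeasurePreserving Measure.quasiMeasurePreserving_snd)).pow 2).aemeasurable.div
      hdm.aemeasurable |>.aestronglyMeasurable
  refine ⟨hm, h.mono' (hK u1 hm.1) (Filter.Eventually.of_forall fun q => ?_),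
    h.mono' (hK u2 hm.2) (Filter.Eventually.of_forall fun q => ?_)⟩ <;>
  · rw [Real.norm_eq_abs, abs_of_nonneg (gagKernel_nonneg _ _ _ _), gagKernel]
    gcongr
    nlinarith [sq_nonneg (u1 q.1 - u1 q.2), sq_nonneg (u2 q.1 - u2 q.2)]

lemma integrableOn_mul_of_compactSupport {v f : ℝ × ℝ → ℝ} (hv : IntegrableOn v Qhat)
    (hf : Continuous f) (hfc : HasCompactSupport f) : IntegrableOn (fun x => v x * f x) Qhat := by
  obtain ⟨K, hK⟩ := hfc.exists_bound_of_continuous hf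
  exact Integrable.mul_bdd hv hf.aestronglyMeasurable (Filter.Eventually.of_forall hK)

lemma integrableOn_gradient_mul {u1 u2 ψ : ℝ × ℝ → ℝ} (i1 : IntegrableOn u1 Qhat)
    (i2 : IntegrableOn u2 Qhat) (hψ : ContDiff ℝ (⊤ : ℕ∞) ψ) (hψc : HasCompactSupport ψ) :
    IntegrableOn (fun x => u1 x * pd1 ψ x + u2 x * pd2 ψ x) Qhat := by
  have hc := hψ.continuous_fderiv (by simp)
  have hs := hψc.fderiv ℝ
  have c1 : Continuous (pd1 ψ) := hc.clm_apply continuous_const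
  have c2 : Continuous (pd2 ψ) := hc.clm_apply continuous_const
  have s1 : HasCompactSupport (pd1 ψ) := hs.comp_left (g := fun L : ℝ × ℝ →L[ℝ] ℝ => L (1, 0)) rfl
  have s2 : HasCompactSupport (pd2 ψ) := hs.comp_left (g := fun L : ℝ × ℝ →L[ℝ] ℝ => L (0, 1)) rfl
  exact (integrableOn_mul_of_compactSupport i1 c1 s1).add
    (integrableOn_mul_of_compactSupport i2 c2 s2)

lemma aestronglyMeasurable_of_mul {d f : ℝ × ℝ → ℝ} (hf : ContinuousOn f Qhat)
    (h : AEStronglyMeasurable (fun x => d x * f x) (volume.restrict Qhat)) :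
    AEStronglyMeasurable d (volume.restrict (Qhat ∩ {x | f x ≠ 0})) := by
  have hU : MeasurableSet (Qhat ∩ {x | f x ≠ 0}) :=
    (hf.isOpen_inter_preimage isOpen_Qhat isOpen_ne).measurableSet
  have hfm : AEMeasurable f (volume.restrict Qhat) := hf.aemeasurable measurableSet_Qhat
  refine ((h.aemeasurable.div hfm).aestronglyMeasurable.mono_measure
    (Measure.restrict_mono_set _ inter_subset_left)).congr ?_
  filter_upwards [ae_restrict_mem hU] with x hx
  exact mul_div_cancel_right₀ _ hx.2

lemma exists_not_aestronglyMeasurable_mul {d : ℝ × ℝ → ℝ}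
    (hd : ¬AEStronglyMeasurable d (volume.restrict Qhat)) :
    ∃ χ : ℝ × ℝ → ℝ, ContDiff ℝ (⊤ : ℕ∞) χ ∧ HasCompactSupport χ ∧ tsupport χ ⊆ Qhat ∧
      ¬AEStronglyMeasurable (fun x => d x * χ x) (volume.restrict Qhat) := by
  by_contra! H
  refine hd ?_
  have hex : ∀ x : ℝ × ℝ, ∃ χ : ℝ × ℝ → ℝ, x ∈ Qhat → tsupport χ ⊆ Qhat ∧ HasCompactSupport χ ∧
      ContDiff ℝ (⊤ : ℕ∞) χ ∧ range χ ⊆ Icc 0 1 ∧ χ x = 1 := fun x => by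
    by_cases hx : x ∈ Qhat
    · obtain ⟨χ, h⟩ := exists_contDiff_tsupport_subset (n := ⊤) (isOpen_Qhat.mem_nhds hx)
      exact ⟨χ, fun _ => h⟩
    · exact ⟨0, fun h => absurd h hx⟩
  choose χ hχ using hex
  obtain ⟨t, htQ, htc, hcov⟩ := TopologicalSpace.countable_cover_nhdsWithin
    (f := fun x => Qhat ∩ {y | χ x y ≠ 0}) (s := Qhat) fun x hx => by
      have hc : Continuous (χ x) := (hχ x hx).2.2.1.continuous
      refine Filter.inter_mem self_mem_nhdsWithin (mem_nhdsWithin_of_mem_nhds ?_)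
      refine hc.continuousAt.eventually_ne ?_
      rw [(hχ x hx).2.2.2.2]
      exact one_ne_zero
  have := htc.to_subtype
  rw [biUnion_eq_iUnion] at hcov
  refine AEStronglyMeasurable.mono_measure (AEStronglyMeasurable.iUnion fun x : t => ?_)
    (Measure.restrict_mono_set _ hcov)
  obtain ⟨h1, h2, h3, -⟩ := hχ x (htQ x.2)
  exact aestronglyMeasurable_of_mul h3.continuous.continuousOn (H _ h3 h2 h1)

/-- The weak divergence can be replaced by a measurable function without changing its action on
functions against which it is integrable. -/
lemma exists_weakDiv {u1 u2 dv : ℝ × ℝ → ℝ} (i1 : IntegrableOn u1 Qhat)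
    (i2 : IntegrableOn u2 Qhat) (hd : IntegrableOn (fun x => dv x ^ 2) Qhat)
    (hw : ∀ ψ : ℝ × ℝ → ℝ, ContDiff ℝ (⊤ : ℕ∞) ψ → HasCompactSupport ψ → tsupport ψ ⊆ Qhat →
        (∫ x in Qhat, (u1 x * pd1 ψ x + u2 x * pd2 ψ x)) = -∫ x in Qhat, dv x * ψ x) :
    ∃ d : ℝ × ℝ → ℝ, AEStronglyMeasurable d (volume.restrict Qhat) ∧
      IntegrableOn (fun x => d x ^ 2) Qhat ∧
      (∫ x in Qhat, d x ^ 2) ≤ (∫ x in Qhat, dv x ^ 2) ∧ WeakDiv u1 u2 d ∧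
      ∀ φ : ℝ × ℝ → ℝ, ContinuousOn φ Qhat → IntegrableOn (fun x => dv x * φ x) Qhat →
        IntegrableOn (fun x => d x * φ x) Qhat ∧
        ∫ x in Qhat, dv x * φ x = ∫ x in Qhat, d x * φ x := by
  by_cases hm : AEStronglyMeasurable dv (volume.restrict Qhat)
  · exact ⟨dv, hm, hd, le_rfl, ⟨i1, i2, integrable_of_sq hm hd, hw⟩, fun φ _ hφ => ⟨hφ, rfl⟩⟩
  obtain ⟨χ, χ1, χ2, χ3, hχ⟩ := exists_not_aestronglyMeasurable_mul hm
  have hnm : ∀ f : ℝ × ℝ → ℝ, ¬AEStronglyMeasurable f (volume.restrict Qhat) →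
      ∫ x in Qhat, f x = 0 := fun f hf =>
    integral_undef fun h => hf h.aestronglyMeasurable
  have hχ0 : ∫ x in Qhat, (u1 x * pd1 χ x + u2 x * pd2 χ x) = 0 := by
    rw [hw χ χ1 χ2 χ3, hnm _ hχ, neg_zero]
  have h0 : ∀ ψ : ℝ × ℝ → ℝ, ContDiff ℝ (⊤ : ℕ∞) ψ → HasCompactSupport ψ → tsupport ψ ⊆ Qhat →
      (∫ x in Qhat, (u1 x * pd1 ψ x + u2 x * pd2 ψ x)) = 0 := by
    intro ψ ψ1 ψ2 ψ3
    by_cases hψ : AEStronglyMeasurable (fun x => dv x * ψ x) (volume.restrict Qhat)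
    · have hs : ¬AEStronglyMeasurable (fun x => dv x * (ψ + χ) x) (volume.restrict Qhat) := by
        intro h
        refine hχ ((h.sub hψ).congr (Filter.Eventually.of_forall fun x => ?_))
        simp only [Pi.sub_apply, Pi.add_apply]
        ring
      have hsum := hw (ψ + χ) (ψ1.add χ1) (ψ2.add χ2)
        ((tsupport_add ψ χ).trans (union_subset ψ3 χ3))
      rw [hnm _ hs, neg_zero] at hsum
      have hpd : ∀ x, u1 x * pd1 (ψ + χ) x + u2 x * pd2 (ψ + χ) x =
          (u1 x * pd1 ψ x + u2 x * pd2 ψ x) + (u1 x * pd1 χ x + u2 x * pd2 χ x) := fun x => by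
        rw [pd1, pd2, fderiv_add (ψ1.differentiable (by simp) x) (χ1.differentiable (by simp) x)]
        simp only [add_apply, pd1, pd2]
        ring
      simp only [hpd] at hsum
      rwa [integral_add (integrableOn_gradient_mul i1 i2 ψ1 ψ2)
        (integrableOn_gradient_mul i1 i2 χ1 χ2), hχ0, add_zero] at hsum
    · rw [hw ψ ψ1 ψ2 ψ3, hnm _ hψ, neg_zero]
  refine ⟨0, aestronglyMeasurable_const, by simp, by
    simpa using integral_nonneg fun x => sq_nonneg (dv x), ⟨i1, i2, by simp [IntegrableOn], by
    simpa using h0⟩, fun φ hφ hφd => ⟨by simp, ?_⟩⟩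
  set U : Set (ℝ × ℝ) := Qhat ∩ {x | φ x ≠ 0} with hUdef
  have hU : IsOpen U := hφ.isOpen_inter_preimage isOpen_Qhat isOpen_ne
  have hUd : AEStronglyMeasurable (U.indicator dv) (volume.restrict Qhat) := by
    rw [aestronglyMeasurable_indicator_iff hU.measurableSet,
      Measure.restrict_restrict hU.measurableSet, inter_eq_left.2 inter_subset_left]
    exact aestronglyMeasurable_of_mul hφ hφd.aestronglyMeasurable
  have hUi : IntegrableOn (U.indicator dv) Qhat := by
    refine integrable_of_sq hUd (hd.mono' (hUd.pow 2) (Filter.Eventually.of_forall fun x => ?_))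
    rw [Real.norm_eq_abs, abs_of_nonneg (sq_nonneg _)]
    by_cases hx : x ∈ U
    · rw [indicator_of_mem hx]
    · rw [indicator_of_notMem hx]
      nlinarith [sq_nonneg (dv x)]
  have hz : ∀ᵐ x, x ∈ U → U.indicator dv x = 0 := by
    refine hU.ae_eq_zero_of_integral_contDiff_smul_eq_zero
      (hUi.mono_set inter_subset_left).locallyIntegrableOn fun g g1 g2 g3 => ?_
    have hg := hw g g1 g2 (g3.trans inter_subset_left)
    rw [h0 g g1 g2 (g3.trans inter_subset_left)] at hg
    have hgz : ∀ x, x ∉ U → g x = 0 := fun x hx => image_eq_zero_of_notMem_tsupport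
      fun h => hx (g3 h)
    rw [← setIntegral_eq_integral_of_forall_compl_eq_zero (s := Qhat) fun x hx => by
      rw [hgz x fun h => hx h.1, zero_smul]]
    rw [← neg_eq_zero, hg]
    congr 1
    refine integral_congr_ae (Filter.Eventually.of_forall fun x => ?_)
    by_cases hx : x ∈ U
    · simp [indicator_of_mem hx, mul_comm]
    · simp [hgz x hx]
  simp only [Pi.zero_apply, zero_mul, integral_zero]
  refine integral_eq_zero_of_ae ?_
  filter_upwards [ae_restrict_of_ae hz, ae_restrict_mem measurableSet_Qhat] with x hx hxQ
  rw [Pi.zero_apply, mul_eq_zero, or_iff_not_imp_right]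
  intro hne
  have hxU : x ∈ U := ⟨hxQ, hne⟩
  rw [← hx hxU, indicator_of_mem hxU]

lemma Adm.edgeValues {ε w1 w2 w3 w4 : ℝ} {u1 u2 dv φ : ℝ × ℝ → ℝ}
    (h : Adm ε u1 u2 dv φ w1 w2 w3 w4) : EdgeValues φ w1 w2 w3 w4 :=
  ⟨h.left, h.right, h.bottom, h.top⟩

/-- The weak flux of an admissible test function whose edge values agree with those of an edge
lifting is controlled by the anisotropic norms. -/
lemma EdgeLift.exists_abs_flux_le {s ε w1 w2 w3 w4 : ℝ} (hs0 : 0 < s) (hs : s ≤ 1 / 2)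
    {η : ℝ × ℝ → ℝ} (hη : EdgeLift s η) (hηe : EdgeValues η w1 w2 w3 w4) :
    ∃ C > 0, ∀ u1 u2 dv : ℝ × ℝ → ℝ,
      IntegrableOn (fun x => u1 x ^ 2) Qhat → IntegrableOn (fun x => u2 x ^ 2) Qhat →
      IntegrableOn (fun x => dv x ^ 2) Qhat →
      IntegrableOn
        (fun q : (ℝ × ℝ) × (ℝ × ℝ) =>
          ((u1 q.1 - u1 q.2) ^ 2 + (u2 q.1 - u2 q.2) ^ 2) /
            ((q.1.1 - q.2.1) ^ 2 + (q.1.2 - q.2.2) ^ 2) ^ ((2 + 2 * s) / 2))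
        (Qhat ×ˢ Qhat) →
      (∀ ψ : ℝ × ℝ → ℝ, ContDiff ℝ (⊤ : ℕ∞) ψ → HasCompactSupport ψ → tsupport ψ ⊆ Qhat →
        (∫ x in Qhat, (u1 x * pd1 ψ x + u2 x * pd2 ψ x)) =
          -∫ x in Qhat, dv x * ψ x) →
      ∀ φ : ℝ × ℝ → ℝ, Adm ε u1 u2 dv φ w1 w2 w3 w4 →
        |pairing u1 u2 dv φ| ≤
          C * (HsNorm s u1 + AH2Semi s u2 + √(∫ x in Qhat, dv x ^ 2)) := by
  obtain ⟨C, hC, H⟩ := hη.exists_abs_pairing_le hs0 hs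
  refine ⟨C, hC, fun u1 u2 dv i1 i2 id hK hw φ hφ => ?_⟩
  obtain ⟨⟨m1, m2⟩, k1, k2⟩ := aestronglyMeasurable_of_gagliardo i1 i2 hK
  obtain ⟨d, hdm, hdi, hdle, hwd, hdφ⟩ :=
    exists_weakDiv (integrable_of_sq m1 i1) (integrable_of_sq m2 i2) id hw
  obtain ⟨j1, j2, hle⟩ := H u1 u2 d m1 m2 hdm i1 i2 hdi k1 k2
  obtain ⟨l1, l2⟩ := hdφ φ hφ.diff.continuousOn hφ.int2
  have hp : pairing u1 u2 dv φ = pairing u1 u2 d η := by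
    rw [← hwd.pairing_congr i1 i2 hφ.diff hη.diff hφ.cont hη.cont
      (fun x hx hxQ => hφ.edgeValues.eq hηe hx hxQ) hφ.int1 j1 l1 j2, pairing, pairing, l2]
  rw [hp]
  exact hle.trans (by gcongr)

lemma sqrt_integral_sq_affine_le {p q K : ℝ} (h : |p| + |q| ≤ K) :
    √(∫ x in Qhat, (-p + (q + p) * x.1) ^ 2) ≤ K := by
  have hK : 0 ≤ K := (by positivity : 0 ≤ |p| + |q|).trans h
  have hle : ∀ x ∈ Qhat, (-p + (q + p) * x.1) ^ 2 ≤ K ^ 2 := fun x hx => by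
    refine sq_le_sq' ?_ ?_ <;>
      nlinarith [hx.1.1, hx.1.2, neg_abs_le p, neg_abs_le q, le_abs_self p, le_abs_self q,
        mul_nonneg (sub_nonneg.2 (le_abs_self p)) (sub_nonneg.2 hx.1.2.le),
        mul_nonneg (sub_nonneg.2 (le_abs_self q)) hx.1.1.le,
        mul_nonneg (by linarith [neg_abs_le p] : 0 ≤ p + |p|) (sub_nonneg.2 hx.1.2.le),
        mul_nonneg (by linarith [neg_abs_le q] : 0 ≤ q + |q|) hx.1.1.le,
        mul_nonneg (abs_nonneg p) hx.1.1.le, mul_nonneg (abs_nonneg q) (sub_nonneg.2 hx.1.2.le)]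
  refine Real.sqrt_le_iff.2 ⟨hK, ?_⟩
  have h1 : IntegrableOn (fun _ => K ^ 2) Qhat :=
    integrableOn_const isBounded_Qhat.measure_lt_top.ne
  have hi : IntegrableOn (fun x : ℝ × ℝ => (-p + (q + p) * x.1) ^ 2) Qhat := by
    refine h1.mono' (by fun_prop) ?_
    filter_upwards [ae_restrict_mem measurableSet_Qhat] with x hx
    rw [Real.norm_eq_abs, abs_of_nonneg (sq_nonneg _)]
    exact hle x hx
  refine (setIntegral_mono_on hi h1 measurableSet_Qhat hle).trans (le_of_eq ?_)
  rw [setIntegral_const, volume_real_Qhat, one_smul]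

/-- Componentwise stability of the lowest-order Raviart–Thomas interpolant on the
reference square for low-regularity fields (Theorem 5.1(ii), `l = 1`):
for `0 < s ≤ 1/2` and `u ∈ H^s(Q̂)² ∩ H(div,Q̂)`, the first component `a + c x₁` of
the interpolant (whose coefficients are defined through the weak edge fluxes
`-a = ⟨u·n,1⟩_{ê₄}`, `a + c = ⟨u·n,1⟩_{ê₂}` via the Green pairing with admissible
test functions) satisfies
`‖(Π̂_RT u)₁‖_{L²(Q̂)} ≤ C (‖u₁‖_{H^s(Q̂)} + |u₂|_{AH₂ˢ(Q̂)} + ‖div u‖_{L²(Q̂)})`. -/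
theorem stmt18 (s ε : ℝ) (hs0 : 0 < s) (hs : s ≤ 1 / 2) (hε0 : 0 < ε) (hεs : ε < s) :
    ∃ C > 0, ∀ u1 u2 dv : ℝ × ℝ → ℝ,
      -- u ∈ H^s(Q̂)², div u ∈ L²(Q̂)
      IntegrableOn (fun x => u1 x ^ 2) Qhat →
      IntegrableOn (fun x => u2 x ^ 2) Qhat →
      IntegrableOn (fun x => dv x ^ 2) Qhat →
      IntegrableOn
        (fun q : (ℝ × ℝ) × (ℝ × ℝ) =>
          ((u1 q.1 - u1 q.2) ^ 2 + (u2 q.1 - u2 q.2) ^ 2) /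
            ((q.1.1 - q.2.1) ^ 2 + (q.1.2 - q.2.2) ^ 2) ^ ((2 + 2 * s) / 2))
        (Qhat ×ˢ Qhat) →
      -- dv is the distributional divergence of u
      (∀ ψ : ℝ × ℝ → ℝ, ContDiff ℝ (⊤ : ℕ∞) ψ → HasCompactSupport ψ → tsupport ψ ⊆ Qhat →
        (∫ x in Qhat, (u1 x * pd1 ψ x + u2 x * pd2 ψ x)) =
          -∫ x in Qhat, dv x * ψ x) →
      -- admissible test functions pinning the fluxes through ê₄ and ê₂
      ∀ φL φR : ℝ × ℝ → ℝ,
        Adm ε u1 u2 dv φL 1 0 0 0 →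
        Adm ε u1 u2 dv φR 0 1 0 0 →
        Real.sqrt (∫ x in Qhat,
            (-(pairing u1 u2 dv φL) +
              (pairing u1 u2 dv φR + pairing u1 u2 dv φL) * x.1) ^ 2) ≤
          C * (HsNorm s u1 + AH2Semi s u2 + Real.sqrt (∫ x in Qhat, dv x ^ 2)) := by
  obtain ⟨⟨ηL, hL, hLe⟩, ηR, hR, hRe⟩ := exists_edgeLift hs0 hs
  obtain ⟨CL, hCL, HL⟩ := hL.exists_abs_flux_le (ε := ε) hs0 hs hLe
  obtain ⟨CR, hCR, HR⟩ := hR.exists_abs_flux_le (ε := ε) hs0 hs hRe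
  refine ⟨CL + CR, by positivity, fun u1 u2 dv i1 i2 id hK hw φL φR hφL hφR => ?_⟩
  refine sqrt_integral_sq_affine_le ?_
  rw [add_mul]
  exact add_le_add (HL u1 u2 dv i1 i2 id hK hw φL hφL) (HR u1 u2 dv i1 i2 id hK hw φR hφR)
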